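/- Let k ≥ 8 and ε > 0. For all real numbers α₁, …, α_k and all sufficiently large N (in terms of k and ε), there exists an integer n with 1 ≤ n ≤ N such that ‖α_k n^k + α_{k−1} n^{k−1} + ⋯ + α₁ n‖ ≤ C(k,ε) · N^{−1/(2k(k−1)) + ε}, where C(k,ε) is a constant depending only on k and ε. -/

import Mathlib

/-- Distance from a real number to the nearest integer. -/
noncomputable def nearestIntDist (x : ℝ) : ℝ := |x - round x|

namespace SFP
open Finset

/-- weighted Minkowski inequality for finite sums -/
lemma mink {E J : Type*} (T : Finset J) (A : Finset E) (W : E → ℝ) (hW : ∀ α, 0 ≤ W α)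
    (g : J → E → ℝ) (hg : ∀ j α, 0 ≤ g j α) (S : ℕ) (hS : 1 ≤ S) :
    (∑ α ∈ A, W α * (∑ j ∈ T, g j α) ^ S) ^ (1 / (S : ℝ)) ≤
      ∑ j ∈ T, (∑ α ∈ A, W α * (g j α) ^ S) ^ (1 / (S : ℝ)) := by
  classical
  have hS0 : (S : ℝ) ≠ 0 := by positivity
  have hS1 : (1 : ℝ) ≤ S := by exact_mod_cast hS
  set w : E → ℝ := fun α => (W α) ^ (1 / (S : ℝ)) with hw
  have hw0 : ∀ α, 0 ≤ w α := fun α => Real.rpow_nonneg (hW α) _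
  have key : ∀ (G : E → ℝ) (α : E), W α * (G α) ^ S = (w α * G α) ^ S := by
    intro G α
    rw [mul_pow, hw]
    simp only
    rw [← Real.rpow_natCast (W α ^ (1 / (S : ℝ))), ← Real.rpow_mul (hW α), one_div_mul_cancel hS0,
      Real.rpow_one]
  induction T using Finset.induction_on with
  | empty =>
    simp only [Finset.sum_empty]
    have : ∑ α ∈ A, W α * (0 : ℝ) ^ S = 0 := by
      apply Finset.sum_eq_zero; intro α _; rw [zero_pow (by omega), mul_zero]
    rw [this, Real.zero_rpow (by positivity)]
  | insert j T hj ih =>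
    rw [Finset.sum_insert hj]
    refine le_trans ?_ (add_le_add_right ih _)
    have := Real.Lp_add_le_of_nonneg A (f := fun α => w α * g j α)
      (g := fun α => w α * ∑ j ∈ T, g j α) hS1
      (fun α _ => mul_nonneg (hw0 α) (hg j α))
      (fun α _ => mul_nonneg (hw0 α) (Finset.sum_nonneg fun j _ => hg j α))
    simp only [Real.rpow_natCast] at this
    have e1 : ∀ α, W α * (∑ j ∈ insert j T, g j α) ^ S
        = (w α * g j α + w α * ∑ j ∈ T, g j α) ^ S := by
      intro α
      rw [key (fun α => ∑ j ∈ insert j T, g j α) α, Finset.sum_insert hj, mul_add]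
    simp only [e1]
    rw [Finset.sum_congr rfl (fun α _ => key (g j) α),
      Finset.sum_congr rfl (fun α _ => key (fun α => ∑ j ∈ T, g j α) α)]
    exact this

lemma sum_pow_le {J : Type*} (T : Finset J) (g : J → ℝ) (hg : ∀ j ∈ T, 0 ≤ g j) (S : ℕ)
    (hS : 1 ≤ S) : ∑ j ∈ T, (g j) ^ S ≤ (∑ j ∈ T, g j) ^ S := by
  obtain ⟨n, rfl⟩ : ∃ n, S = n + 1 := ⟨S - 1, by omega⟩
  rw [pow_succ, Finset.mul_sum]
  apply Finset.sum_le_sum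
  intro j hj
  rw [pow_succ]
  apply mul_le_mul_of_nonneg_right _ (hg j hj)
  exact pow_le_pow_left₀ (hg j hj) (Finset.single_le_sum hg hj) n

section parts
variable {R : Type*} [CommRing R] [DecidableEq R]

open Classical in
/-- partition of a finite set `s` into classes of `t x` modulo `q` -/
noncomputable def parts (q : R) (t : R → R) (s : Finset R) : Finset (Finset R) :=
  s.image (fun x => s.filter (fun y => q ∣ t y - t x))

lemma mem_parts {q : R} {t : R → R} {s J : Finset R} (hJ : J ∈ parts q t s) {x : R} (hx : x ∈ J) :
    ∀ y, y ∈ J ↔ y ∈ s ∧ q ∣ t y - t x := by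
  classical
  unfold parts at hJ
  rw [Finset.mem_image] at hJ
  obtain ⟨z, hz, rfl⟩ := hJ
  intro y
  simp only [Finset.mem_filter] at hx ⊢
  refine and_congr_right fun hy => ⟨fun h => ?_, fun h => ?_⟩
  · have := dvd_sub h hx.2; simpa using this
  · have := dvd_add h hx.2; simpa using this

lemma parts_subset {q : R} {t : R → R} {s J : Finset R} (hJ : J ∈ parts q t s) : J ⊆ s := by
  intro x hx; exact ((mem_parts hJ hx x).1 hx).1

lemma parts_nonempty {q : R} {t : R → R} {s J : Finset R} (hJ : J ∈ parts q t s) : J.Nonempty := by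
  classical
  unfold parts at hJ
  rw [Finset.mem_image] at hJ
  obtain ⟨z, hz, rfl⟩ := hJ
  exact ⟨z, by simp [hz]⟩

lemma parts_ext {q : R} {t : R → R} {s J J' : Finset R} (hJ : J ∈ parts q t s)
    (hJ' : J' ∈ parts q t s) {x : R} (hx : x ∈ J) (hx' : x ∈ J') : J = J' := by
  ext y; rw [mem_parts hJ hx, mem_parts hJ' hx']

lemma exists_parts (q : R) (t : R → R) {s : Finset R} {x : R} (hx : x ∈ s) :
    ∃ J ∈ parts q t s, x ∈ J := by
  classical
  exact ⟨_, Finset.mem_image_of_mem _ hx, by simp [hx]⟩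

lemma sum_parts {A : Type*} [AddCommMonoid A] (q : R) (t : R → R) (s : Finset R) (g : R → A) :
    ∑ J ∈ parts q t s, ∑ x ∈ J, g x = ∑ x ∈ s, g x := by
  classical
  rw [← Finset.sum_biUnion]
  · congr 1
    ext x
    simp only [Finset.mem_biUnion]
    constructor
    · rintro ⟨J, hJ, hx⟩; exact parts_subset hJ hx
    · intro hx; obtain ⟨J, hJ, h⟩ := exists_parts q t hx; exact ⟨J, hJ, h⟩
  · intro J hJ J' hJ' hne
    rw [Function.onFun, Finset.disjoint_left]
    intro x hx hx'
    exact hne (parts_ext hJ hJ' hx hx')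

lemma parts_of_parts {q q' : R} (h : q ∣ q') {t : R → R} {s I J : Finset R}
    (hI : I ∈ parts q t s) (hJ : J ∈ parts q' t I) : J ∈ parts q' t s := by
  classical
  obtain ⟨x, hx⟩ := parts_nonempty hJ
  have hxI := parts_subset hJ hx
  have : J = s.filter (fun y => q' ∣ t y - t x) := by
    ext y
    rw [mem_parts hJ hx, mem_parts hI hxI, Finset.mem_filter]
    constructor
    · rintro ⟨⟨h1, h2⟩, h3⟩; exact ⟨h1, h3⟩
    · rintro ⟨h1, h3⟩; exact ⟨⟨h1, h.trans h3⟩, h3⟩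
  rw [this]
  exact Finset.mem_image_of_mem _ (parts_subset hI hxI)

lemma sum_parts_parts {A : Type*} [AddCommMonoid A] {q q' : R} (h : q ∣ q') (t : R → R)
    (s : Finset R) (G : Finset R → A) :
    ∑ I ∈ parts q t s, ∑ J ∈ parts q' t I, G J = ∑ J ∈ parts q' t s, G J := by
  classical
  rw [← Finset.sum_biUnion]
  · congr 1
    ext J
    simp only [Finset.mem_biUnion]
    constructor
    · rintro ⟨I, hI, hJ⟩; exact parts_of_parts h hI hJ
    · intro hJ
      obtain ⟨x, hx⟩ := parts_nonempty hJ
      obtain ⟨I, hI, hxI⟩ := exists_parts q t (parts_subset hJ hx)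
      obtain ⟨J', hJ', hxJ'⟩ := exists_parts q' t hxI
      have := parts_ext hJ (parts_of_parts h hI hJ') hx hxJ'
      exact ⟨I, hI, this ▸ hJ'⟩
  · intro I hI I' hI' hne
    rw [Function.onFun, Finset.disjoint_left]
    intro J hJ hJ'
    obtain ⟨x, hx⟩ := parts_nonempty hJ
    exact hne (parts_ext hI hI' (parts_subset hJ hx) (parts_subset hJ' hx))

lemma parts_congr {q q' : R} {t u : R → R} {s : Finset R}
    (h : ∀ x ∈ s, ∀ y ∈ s, (q ∣ t y - t x ↔ q' ∣ u y - u x)) : parts q t s = parts q' u s := by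
  classical
  unfold parts
  apply Finset.image_congr
  intro x hx
  simp only
  apply Finset.filter_congr
  intro y hy
  exact h x hx y hy

lemma parts_single {q : R} {t : R → R} {s : Finset R} (hs : s.Nonempty)
    (h : ∀ x ∈ s, ∀ y ∈ s, q ∣ t y - t x) : parts q t s = {s} := by
  classical
  have h1 : ∀ J ∈ parts q t s, J = s := by
    intro J hJ
    obtain ⟨x, hx⟩ := parts_nonempty hJ
    ext y
    rw [mem_parts hJ hx]
    exact ⟨fun h => h.1, fun hy => ⟨hy, h x (parts_subset hJ hx) y hy⟩⟩
  obtain ⟨x, hx⟩ := hs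
  obtain ⟨J, hJ, _⟩ := exists_parts q t hx
  ext J'
  rw [Finset.mem_singleton]
  refine ⟨h1 J', fun h => ?_⟩
  have := h1 J hJ
  rw [this] at hJ
  rw [h]; exact hJ

lemma parts_empty (q : R) (t : R → R) : parts q t ∅ = ∅ := by
  classical
  simp [parts]

end parts

lemma dvd_iff_val {p M m : ℕ} [Fact p.Prime] (hm : m ≤ M) (x : ZMod (p ^ M)) :
    (p : ZMod (p ^ M)) ^ m ∣ x ↔ p ^ m ∣ x.val := by
  constructor
  · rintro ⟨y, rfl⟩
    have : ((p : ZMod (p ^ M)) ^ m * y) = ((p ^ m * y.val : ℕ) : ZMod (p ^ M)) := by simp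
    rw [this, ZMod.val_natCast]
    exact (Nat.dvd_mod_iff (pow_dvd_pow p hm)).2 (Dvd.intro _ rfl)
  · rintro ⟨y, hy⟩
    refine ⟨(y : ZMod (p ^ M)), ?_⟩
    rw [← ZMod.natCast_zmod_val x, hy]; simp

lemma card_parts {p M m : ℕ} [Fact p.Prime] (hm : m ≤ M) (t : ZMod (p ^ M) → ZMod (p ^ M))
    (s : Finset (ZMod (p ^ M))) : (parts ((p : ZMod (p ^ M)) ^ m) t s).card ≤ p ^ m := by
  classical
  have hp : 0 < p ^ m := pow_pos (Fact.out (p := p.Prime)).pos m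
  choose! f hf using fun J (hJ : J ∈ parts ((p : ZMod (p ^ M)) ^ m) t s) => parts_nonempty hJ
  rw [← Finset.card_range (p ^ m)]
  apply Finset.card_le_card_of_injOn (fun J => (t (f J)).val % p ^ m)
  · intro J hJ
    simp only [Finset.coe_range, Set.mem_Iio]
    exact Nat.mod_lt _ hp
  · intro J hJ J' hJ' h
    simp only at h
    apply parts_ext hJ hJ' (hf J hJ)
    rw [mem_parts hJ' (hf J' hJ')]
    refine ⟨parts_subset hJ (hf J hJ), ?_⟩
    have h2 : ((p ^ m : ℕ) : ℤ) ∣ (t (f J)).val - (t (f J')).val :=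
      (Nat.modEq_iff_dvd.1 (Eq.symm h))
    obtain ⟨c, hc⟩ := h2
    refine ⟨(c : ZMod (p ^ M)), ?_⟩
    have := congrArg (Int.cast : ℤ → ZMod (p ^ M)) hc
    push_cast at this
    simpa using this

/-- cancelling `p^a` in divisibility -/
lemma dvd_cancel {p M a m : ℕ} [Fact p.Prime] (h : a + m ≤ M) (x : ZMod (p ^ M)) :
    (p : ZMod (p ^ M)) ^ (a + m) ∣ (p : ZMod (p ^ M)) ^ a * x ↔ (p : ZMod (p ^ M)) ^ m ∣ x := by
  have hp : 0 < p := (Fact.out (p := p.Prime)).pos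
  constructor
  · intro h1
    have e : ((p : ZMod (p ^ M)) ^ a * x) = ((p ^ a * x.val : ℕ) : ZMod (p ^ M)) := by simp
    rw [e, dvd_iff_val h, ZMod.val_natCast, Nat.dvd_mod_iff (pow_dvd_pow p h), pow_add] at h1
    rw [dvd_iff_val (by omega)]
    exact Nat.dvd_of_mul_dvd_mul_left (pow_pos hp a) h1
  · intro h1
    rw [pow_add]; exact mul_dvd_mul_left _ h1

lemma mul_eq_zero_iff_dvd {p M m : ℕ} [Fact p.Prime] (h : m ≤ M) (x : ZMod (p ^ M)) :
    (p : ZMod (p ^ M)) ^ (M - m) * x = 0 ↔ (p : ZMod (p ^ M)) ^ m ∣ x := by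
  have := dvd_cancel (a := M - m) (m := m) (M := M) (by omega) x
  rw [← this, show M - m + m = M by omega]
  have h0 : (p : ZMod (p ^ M)) ^ M = 0 := by
    have := ZMod.natCast_self (p ^ M); push_cast at this; exact this
  rw [h0, zero_dvd_iff]

lemma p_pow_zero {p M n : ℕ} (h : M ≤ n) : (p : ZMod (p ^ M)) ^ n = 0 := by
  have h0 : (p : ZMod (p ^ M)) ^ M = 0 := by
    have := ZMod.natCast_self (p ^ M); push_cast at this; exact this
  rw [← Nat.sub_add_cancel h, pow_add, h0, mul_zero]

end SFP

namespace SFP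
open Finset Polynomial

variable {p : ℕ} [Fact p.Prime]

/-- triangular numbers -/
def T (k : ℕ) : ℕ := k * (k + 1) / 2

lemma two_T (k : ℕ) : 2 * T k = k * (k + 1) := by
  unfold T
  exact Nat.mul_div_cancel' (Nat.even_mul_succ_self k).two_dvd

lemma T_pos {k : ℕ} (hk : 1 ≤ k) : 1 ≤ T k := by
  have := two_T k; nlinarith

/-- exponential sum -/
noncomputable def F {X E : Type*} (e : X → E → ℂ) (a : X → ℂ) (s : Finset X) (α : E) : ℂ :=
  ∑ x ∈ s, a x * e x α

noncomputable def nrm {E : Type*} [Fintype E] (S : ℕ) (G : E → ℂ) : ℝ :=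
  (∑ α, ‖G α‖ ^ (2 * S)) ^ (1 / (S : ℝ))

lemma nrm_nonneg {E : Type*} [Fintype E] (S : ℕ) (G : E → ℂ) : 0 ≤ nrm S G :=
  Real.rpow_nonneg (Finset.sum_nonneg fun _ _ => by positivity) _

lemma rpow_inv_pow {x : ℝ} (hx : 0 ≤ x) {S : ℕ} (hS : 1 ≤ S) : (x ^ (1 / (S : ℝ))) ^ S = x := by
  have hS0 : (S : ℝ) ≠ 0 := by positivity
  rw [← Real.rpow_natCast (x ^ (1 / (S : ℝ))), ← Real.rpow_mul hx, one_div_mul_cancel hS0,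
    Real.rpow_one]

lemma pow_rpow_inv {x : ℝ} (hx : 0 ≤ x) {S : ℕ} (hS : 1 ≤ S) : (x ^ S) ^ (1 / (S : ℝ)) = x := by
  have hS0 : (S : ℝ) ≠ 0 := by positivity
  rw [← Real.rpow_natCast x, ← Real.rpow_mul hx, mul_one_div_cancel hS0, Real.rpow_one]

lemma nrm_pow {E : Type*} [Fintype E] {S : ℕ} (hS : 1 ≤ S) (G : E → ℂ) :
    (nrm S G) ^ S = ∑ α, ‖G α‖ ^ (2 * S) :=
  rpow_inv_pow (Finset.sum_nonneg fun _ _ => by positivity) hS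

noncomputable abbrev psi (p M : ℕ) [Fact p.Prime] : AddChar (ZMod (p ^ M)) ℂ := ZMod.stdAddChar

/-- perturbed moment curves -/
def IsCurve {k M : ℕ} (φ : Fin k → (ZMod (p ^ M))[X]) : Prop :=
  ∀ i, ∃ g : (ZMod (p ^ M))[X], φ i = X ^ ((i : ℕ) + 1) + C (p : ZMod (p ^ M)) * g

noncomputable def ex {k M : ℕ} (m : ℕ) (φ : Fin k → (ZMod (p ^ M))[X])
    (t : ZMod (p ^ M) → ZMod (p ^ M)) (x : ZMod (p ^ M)) (α : Fin k → ZMod (p ^ M)) : ℂ :=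
  psi p M ((p : ZMod (p ^ M)) ^ (M - k * m) * ∑ i, α i * (φ i).eval (t x))

lemma ex_add {k M : ℕ} (m : ℕ) (φ : Fin k → (ZMod (p ^ M))[X])
    (t : ZMod (p ^ M) → ZMod (p ^ M)) (x : ZMod (p ^ M)) (α β : Fin k → ZMod (p ^ M)) :
    ex m φ t x (α + β) = ex m φ t x α * ex m φ t x β := by
  unfold ex
  rw [← AddChar.map_add_eq_mul]
  congr 1
  rw [← mul_add, ← Finset.sum_add_distrib]
  simp only [Pi.add_apply, add_mul]

def Dec (p k m M : ℕ) [Fact p.Prime] (K : ℝ) : Prop :=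
  ∀ φ : Fin k → (ZMod (p ^ M))[X], IsCurve φ → ∀ (t : ZMod (p ^ M) → ZMod (p ^ M))
    (a : ZMod (p ^ M) → ℂ) (s : Finset (ZMod (p ^ M))),
    nrm (T k) (F (ex m φ t) a s) ≤
      K * ∑ J ∈ parts ((p : ZMod (p ^ M)) ^ m) t s, nrm (T k) (F (ex m φ t) a J)

lemma transfer {k l m' M : ℕ} {K : ℝ} (hK : 0 ≤ K) (hD : Dec p l m' M K) (hl : 1 ≤ l)
    (e : ZMod (p ^ M) → (Fin k → ZMod (p ^ M)) → ℂ)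
    (he : ∀ x α β, e x (α + β) = e x α * e x β)
    (a : ZMod (p ^ M) → ℂ) (s : Finset (ZMod (p ^ M)))
    (φ : Fin l → (ZMod (p ^ M))[X]) (hφ : IsCurve φ) (u : ZMod (p ^ M) → ZMod (p ^ M))
    (io : (Fin l → ZMod (p ^ M)) → (Fin k → ZMod (p ^ M)))
    (v : (Fin l → ZMod (p ^ M)) → ℂ) (hv : ∀ c, ‖v c‖ = 1)
    (hio : ∀ x ∈ s, ∀ c, e x (io c) = v c * ex m' φ u x c)
    (W : (Fin k → ZMod (p ^ M)) → ℝ) (hW : ∀ α, 0 ≤ W α)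
    (hWi : ∀ α c, W (α + io c) = W α) :
    (∑ α, W α * ‖F e a s α‖ ^ (2 * T l)) ^ (1 / (T l : ℝ)) ≤
      K * ∑ J ∈ parts ((p : ZMod (p ^ M)) ^ m') u s,
        (∑ α, W α * ‖F e a J α‖ ^ (2 * T l)) ^ (1 / (T l : ℝ)) := by
  classical
  have hT := T_pos hl
  have hT0 : (0 : ℝ) ≤ 1 / (T l : ℝ) := by positivity
  set h : ℝ := (Fintype.card (Fin l → ZMod (p ^ M)) : ℝ) with hh
  have hpos : 0 < h := by rw [hh]; exact_mod_cast Fintype.card_pos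
  let b : (Fin k → ZMod (p ^ M)) → ZMod (p ^ M) → ℂ := fun α x => a x * e x α
  -- pointwise identity
  have key1 : ∀ J ⊆ s, ∀ α c, ‖F e a J (α + io c)‖ = ‖F (ex m' φ u) (b α) J c‖ := by
    intro J hJ α c
    have : F e a J (α + io c) = v c * F (ex m' φ u) (b α) J c := by
      unfold F
      rw [Finset.mul_sum]
      apply Finset.sum_congr rfl
      intro x hx
      rw [he, hio x (hJ hx)]
      simp only [b]; ring
    rw [this, norm_mul, hv, one_mul]
  have key2 : ∀ J ⊆ s, h * ∑ α, W α * ‖F e a J α‖ ^ (2 * T l)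
      = ∑ α, W α * (nrm (T l) (F (ex m' φ u) (b α) J)) ^ (T l) := by
    intro J hJ
    have : ∀ c, ∑ α, W α * ‖F e a J α‖ ^ (2 * T l)
        = ∑ α, W α * ‖F (ex m' φ u) (b α) J c‖ ^ (2 * T l) := by
      intro c
      rw [← Equiv.sum_comp (Equiv.addRight (io c))]
      apply Finset.sum_congr rfl
      intro α _
      simp only [Equiv.coe_addRight]
      rw [hWi, key1 J hJ]
    calc h * ∑ α, W α * ‖F e a J α‖ ^ (2 * T l)
        = ∑ c : Fin l → ZMod (p ^ M), ∑ α, W α * ‖F e a J α‖ ^ (2 * T l) := by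
          rw [Finset.sum_const, Finset.card_univ, nsmul_eq_mul]
      _ = ∑ c : Fin l → ZMod (p ^ M), ∑ α, W α * ‖F (ex m' φ u) (b α) J c‖ ^ (2 * T l) :=
          Finset.sum_congr rfl fun c _ => this c
      _ = _ := by
          rw [Finset.sum_comm]
          apply Finset.sum_congr rfl
          intro α _
          rw [nrm_pow hT, Finset.mul_sum]
  have key3 : ∀ J ⊆ s, h ^ (1 / (T l : ℝ)) *
      (∑ α, W α * ‖F e a J α‖ ^ (2 * T l)) ^ (1 / (T l : ℝ))
      = (∑ α, W α * (nrm (T l) (F (ex m' φ u) (b α) J)) ^ (T l)) ^ (1 / (T l : ℝ)) := by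
    intro J hJ
    rw [← key2 J hJ, Real.mul_rpow hpos.le]
    exact Finset.sum_nonneg fun α _ => mul_nonneg (hW α) (by positivity)
  have hpp : 0 < h ^ (1 / (T l : ℝ)) := Real.rpow_pos_of_pos hpos _
  rw [← mul_le_mul_iff_right₀ hpp, key3 s subset_rfl, mul_left_comm, Finset.mul_sum,
    Finset.sum_congr rfl (fun J hJ => key3 J (parts_subset hJ))]
  have hm := mink (parts ((p : ZMod (p ^ M)) ^ m') u s) Finset.univ W hW
    (fun J α => K * nrm (T l) (F (ex m' φ u) (b α) J))
    (fun J α => mul_nonneg hK (nrm_nonneg _ _)) (T l) hT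
  refine le_trans ?_ (hm.trans (le_of_eq ?_))
  · apply Real.rpow_le_rpow _ _ hT0
    · exact Finset.sum_nonneg fun α _ => mul_nonneg (hW α) (pow_nonneg (nrm_nonneg _ _) _)
    · apply Finset.sum_le_sum
      intro α _
      apply mul_le_mul_of_nonneg_left _ (hW α)
      apply pow_le_pow_left₀ (nrm_nonneg _ _)
      rw [← Finset.mul_sum]
      exact hD φ hφ u (b α) s
  · rw [Finset.mul_sum]
    apply Finset.sum_congr rfl
    intro J _
    have : ∑ α, W α * (K * nrm (T l) (F (ex m' φ u) (b α) J)) ^ (T l)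
      = K ^ (T l) * ∑ α, W α * (nrm (T l) (F (ex m' φ u) (b α) J)) ^ (T l) := by
      rw [Finset.mul_sum]
      apply Finset.sum_congr rfl
      intro α _
      ring
    rw [this, Real.mul_rpow (by positivity), pow_rpow_inv hK hT]
    exact Finset.sum_nonneg fun α _ => mul_nonneg (hW α) (pow_nonneg (nrm_nonneg _ _) _)

/-- base case: degree one -/
lemma dec_one {m M : ℕ} (hm : m ≤ M) (hM : 1 ≤ M) : Dec p 1 m M 1 := by
  classical
  intro φ hφ t a s
  have hT1 : T 1 = 1 := rfl
  rw [one_mul, hT1]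
  simp only [nrm, Nat.cast_one, div_one, Real.rpow_one, mul_one]
  -- vanishing
  have hz : ∀ x y, ¬ (p : ZMod (p ^ M)) ^ m ∣ t y - t x →
      ∑ c, ex m φ t x c * (starRingEnd ℂ) (ex m φ t y c) = 0 := by
    intro x y hxy
    have h1 : ∀ c, ex m φ t x c * (starRingEnd ℂ) (ex m φ t y c)
        = psi p M (c 0 * ((p : ZMod (p ^ M)) ^ (M - m) *
            ((φ 0).eval (t x) - (φ 0).eval (t y)))) := by
      intro c
      unfold ex
      rw [← AddChar.map_neg_eq_conj, ← AddChar.map_add_eq_mul]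
      congr 1
      rw [one_mul]
      simp
      ring
    simp only [h1]
    have h2 := AddChar.sum_mulShift (R' := ℂ) ((p : ZMod (p ^ M)) ^ (M - m) *
            ((φ 0).eval (t x) - (φ 0).eval (t y))) (ZMod.isPrimitive_stdAddChar (p ^ M))
    rw [← Equiv.sum_comp (Equiv.funUnique (Fin 1) (ZMod (p ^ M)))] at h2
    simp only [Equiv.funUnique_apply, Fin.default_eq_zero] at h2
    rw [h2, if_neg, Nat.cast_zero]
    rw [mul_eq_zero_iff_dvd hm]
    obtain ⟨g, hg⟩ := hφ 0
    obtain ⟨w, hw⟩ := Polynomial.sub_dvd_eval_sub (t x) (t y) g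
    have h3 : (φ 0).eval (t x) - (φ 0).eval (t y) = (1 + p * w) * (t x - t y) := by
      rw [hg]
      simp only [eval_add, eval_mul, eval_pow, eval_X, eval_C]
      simp only [Fin.val_zero, zero_add, pow_one]
      linear_combination (p : ZMod (p ^ M)) * hw
    rw [h3]
    have hu : IsUnit (1 + (p : ZMod (p ^ M)) * w) := by
      apply IsNilpotent.isUnit_one_add
      refine ⟨M, ?_⟩
      rw [mul_pow, p_pow_zero le_rfl, zero_mul]
    rw [hu.dvd_mul_left]
    rwa [← dvd_neg, neg_sub]
  have hsq : ∀ z : ℂ, ((‖z‖ ^ 2 : ℝ) : ℂ) = z * (starRingEnd ℂ) z := by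
    intro z; rw [Complex.mul_conj, Complex.normSq_eq_norm_sq]
  apply le_of_eq
  apply Complex.ofReal_injective
  push_cast
  have hexp : ∀ I J : Finset (ZMod (p ^ M)), ∑ c, F (ex m φ t) a I c * (starRingEnd ℂ) (F (ex m φ t) a J c)
      = ∑ x ∈ I, ∑ y ∈ J, a x * (starRingEnd ℂ) (a y) *
        ∑ c, ex m φ t x c * (starRingEnd ℂ) (ex m φ t y c) := by
    intro I J
    simp only [F, map_sum, map_mul, Finset.sum_mul_sum]
    rw [Finset.sum_comm]
    apply Finset.sum_congr rfl; intro x _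
    rw [Finset.sum_comm]
    apply Finset.sum_congr rfl; intro y _
    rw [Finset.mul_sum]
    apply Finset.sum_congr rfl; intro c _
    ring
  have e1 : ∀ J : Finset (ZMod (p ^ M)), ∑ c, ((‖F (ex m φ t) a J c‖ : ℝ) : ℂ) ^ 2
      = ∑ x ∈ J, ∑ y ∈ J, a x * (starRingEnd ℂ) (a y) *
        ∑ c, ex m φ t x c * (starRingEnd ℂ) (ex m φ t y c) := by
    intro J
    rw [← hexp]
    apply Finset.sum_congr rfl; intro c _
    rw [← hsq]; push_cast; rfl
  rw [e1, Finset.sum_congr rfl (fun J _ => e1 J), ← sum_parts ((p : ZMod (p ^ M)) ^ m) t s]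
  apply Finset.sum_congr rfl
  intro J hJ
  apply Finset.sum_congr rfl
  intro x hx
  symm
  apply Finset.sum_subset (parts_subset hJ)
  intro y hy hyJ
  rw [hz, mul_zero]
  intro hd
  exact hyJ ((mem_parts hJ hx y).2 ⟨hy, hd⟩)

end SFP

namespace SFP
open Finset Polynomial

variable {p : ℕ} [Fact p.Prime]

/-- reduction mod p -/
noncomputable def red {p M : ℕ} (hM : 1 ≤ M) : ZMod (p ^ M) →+* ZMod p :=
  ZMod.castHom (dvd_pow_self p (by omega : M ≠ 0)) (ZMod p)

lemma red_eq_zero_iff {M : ℕ} (hM : 1 ≤ M) (x : ZMod (p ^ M)) :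
    red hM x = 0 ↔ (p : ZMod (p ^ M)) ∣ x := by
  have h1 := dvd_iff_val (p := p) hM x
  rw [pow_one, pow_one] at h1
  rw [h1]
  have : red hM x = ((x.val : ℕ) : ZMod p) := by
    conv_lhs => rw [← ZMod.natCast_zmod_val x]
    rw [map_natCast]
  rw [this, ZMod.natCast_eq_zero_iff]

lemma isUnit_of_red {M : ℕ} (hM : 1 ≤ M) (x : ZMod (p ^ M)) (h : red hM x ≠ 0) : IsUnit x := by
  rw [Ne, red_eq_zero_iff] at h
  have h1 := dvd_iff_val (p := p) hM x
  rw [pow_one, pow_one] at h1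
  rw [h1] at h
  rw [← ZMod.natCast_zmod_val x, ZMod.isUnit_iff_coprime]
  apply Nat.Coprime.pow_right
  exact ((Fact.out (p := p.Prime)).coprime_iff_not_dvd.2 h).symm

lemma derivative_taylor {R : Type*} [CommRing R] (r : R) (f : R[X]) :
    derivative (taylor r f) = taylor r (derivative f) := by
  rw [taylor_apply, taylor_apply, derivative_comp]; simp

lemma dvd_of_taylor {R : Type*} [CommRing R] (r : R) (f : R[X]) (n : ℕ)
    (h : ∀ i < n, (taylor r f).coeff (i + 1) = 0) : (X - C r) ^ n ∣ derivative f := by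
  have h1 : X ^ n ∣ taylor r (derivative f) := by
    rw [← derivative_taylor, X_pow_dvd_iff]
    intro d hd
    rw [coeff_derivative, h d hd, zero_mul]
  obtain ⟨g, hg⟩ := h1
  have h2 : derivative f = (taylor r (derivative f)).comp (X - C r) := by
    rw [taylor_apply, comp_assoc]; simp
  rw [h2, hg]
  simp

lemma vander {k n l : ℕ} (hk : n + l = k) (hp : k < p) (η ξ : ZMod p) (hne : ξ ≠ η)
    (v : Fin k → ZMod p)
    (h1 : ∀ i < n, (taylor η (∑ j, C (v j) * X ^ ((j : ℕ) + 1))).coeff (i + 1) = 0)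
    (h2 : ∀ i < l, (taylor ξ (∑ j, C (v j) * X ^ ((j : ℕ) + 1))).coeff (i + 1) = 0) : v = 0 := by
  set Q : (ZMod p)[X] := ∑ j, C (v j) * X ^ ((j : ℕ) + 1) with hQ
  have d1 := dvd_of_taylor _ _ _ h1
  have d2 := dvd_of_taylor _ _ _ h2
  have hc : IsCoprime ((X - C η) ^ n) ((X - C ξ) ^ l) := by
    apply IsCoprime.pow
    exact isCoprime_X_sub_C_of_isUnit_sub (by
      rw [isUnit_iff_ne_zero]; exact sub_ne_zero.2 hne.symm)
  have d3 := hc.mul_dvd d1 d2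
  have hdeg : (derivative Q).natDegree < k ∨ k = 0 := by
    rcases Nat.eq_zero_or_pos k with h | h
    · right; exact h
    left
    have : Q.natDegree ≤ k := by
      apply natDegree_sum_le_of_forall_le
      intro j _
      refine (natDegree_C_mul_X_pow_le _ _).trans ?_
      have := j.2; omega
    have := natDegree_derivative_le Q
    omega
  have hQ0 : derivative Q = 0 := by
    by_contra hne0
    have := natDegree_le_of_dvd d3 hne0
    rw [natDegree_mul (pow_ne_zero _ (X_sub_C_ne_zero _)) (pow_ne_zero _ (X_sub_C_ne_zero _)),
      natDegree_pow, natDegree_pow, natDegree_X_sub_C, natDegree_X_sub_C] at this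
    rcases hdeg with h | h
    · omega
    · subst h
      simp at hQ
      rw [hQ] at hne0; simp at hne0
  funext j
  have h3 : (derivative Q).coeff j = 0 := by rw [hQ0]; simp
  rw [coeff_derivative, hQ, finsetSum_coeff] at h3
  simp only [coeff_C_mul, coeff_X_pow] at h3
  rw [Finset.sum_eq_single j] at h3
  · simp only [if_true, mul_one] at h3
    rcases mul_eq_zero.1 h3 with h | h
    · exact h
    · exfalso
      have h4 : (((j : ℕ) + 1 : ℕ) : ZMod p) = 0 := by push_cast; exact h
      rw [ZMod.natCast_eq_zero_iff] at h4
      have := Nat.le_of_dvd (by omega) h4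
      have := j.2; omega
  · intro b _ hb
    rw [if_neg, mul_zero]
    intro h; apply hb; ext; omega
  · simp

lemma map_taylor' {R S : Type*} [CommRing R] [CommRing S] (f : R →+* S) (r : R) (P : R[X]) :
    (taylor r P).map f = taylor (f r) (P.map f) := by
  rw [taylor_apply, taylor_apply, Polynomial.map_comp]; simp

/-- solving for test vectors -/
lemma solve {k n l M : ℕ} (hM : 1 ≤ M) (hk : n + l = k) (hp : k < p)
    (φ : Fin k → (ZMod (p ^ M))[X]) (hφ : IsCurve φ) (η ξ : ZMod (p ^ M))
    (hne : ¬ (p : ZMod (p ^ M)) ∣ ξ - η) (r : Fin l) :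
    ∃ w : Fin k → ZMod (p ^ M),
      (∀ i < n, (taylor η (∑ j, C (w j) * φ j)).coeff (i + 1) = 0) ∧
      (∀ i < l, (taylor ξ (∑ j, C (w j) * φ j)).coeff (i + 1) = if i = (r : ℕ) then 1 else 0) := by
  classical
  let A : Matrix (Fin k) (Fin k) (ZMod (p ^ M)) := fun i j =>
    if (i : ℕ) < n then (taylor η (φ j)).coeff ((i : ℕ) + 1)
    else (taylor ξ (φ j)).coeff ((i : ℕ) - n + 1)
  have hmap : ∀ j, (φ j).map (red hM) = X ^ ((j : ℕ) + 1) := by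
    intro j
    obtain ⟨g, hg⟩ := hφ j
    rw [hg]
    have : red hM (p : ZMod (p ^ M)) = 0 := (red_eq_zero_iff hM _).2 dvd_rfl
    simp only [Polynomial.map_add, Polynomial.map_mul, Polynomial.map_pow, map_X, map_C, this]
    simp
  have hA : IsUnit A.det := by
    apply isUnit_of_red hM
    rw [RingHom.map_det]
    intro h0
    obtain ⟨v, hv, hv0⟩ := Matrix.exists_mulVec_eq_zero_iff.2 h0
    apply hv
    have hv1 : ∀ i : Fin k, ∑ j, red hM (A i j) * v j = 0 := by
      intro i
      have := congrFun hv0 i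
      simpa [Matrix.mulVec, dotProduct] using this
    have hco : ∀ (z : ZMod p) (i : ℕ), (taylor z (∑ j, C (v j) * X ^ ((j : ℕ) + 1))).coeff i
        = ∑ j : Fin k, (taylor z (X ^ ((j : ℕ) + 1))).coeff i * v j := by
      intro z i
      rw [map_sum, finsetSum_coeff]
      apply Finset.sum_congr rfl; intro j _
      rw [taylor_mul, taylor_C, coeff_C_mul, mul_comm]
    apply vander hk hp (red hM η) (red hM ξ)
    · intro h
      apply hne
      rw [← red_eq_zero_iff hM, map_sub, h, sub_self]
    · intro i hi
      have := hv1 ⟨i, by omega⟩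
      rw [hco, ← this]
      apply Finset.sum_congr rfl; intro j _
      simp only [A, hi, if_true]
      rw [← coeff_map, map_taylor', hmap]
    · intro i hi
      have := hv1 ⟨i + n, by omega⟩
      rw [hco, ← this]
      apply Finset.sum_congr rfl; intro j _
      simp only [A, Nat.add_sub_cancel]
      rw [if_neg (by omega), ← coeff_map, map_taylor', hmap]
  have hco : ∀ (w : Fin k → ZMod (p ^ M)) (z : ZMod (p ^ M)) (i : ℕ),
      (taylor z (∑ j, C (w j) * φ j)).coeff i
        = ∑ j : Fin k, (taylor z (φ j)).coeff i * w j := by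
    intro w z i
    rw [map_sum, finsetSum_coeff]
    apply Finset.sum_congr rfl; intro j _
    rw [taylor_mul, taylor_C, coeff_C_mul, mul_comm]
  let b : Fin k → ZMod (p ^ M) := fun i => if (i : ℕ) = n + r then 1 else 0
  refine ⟨A⁻¹.mulVec b, ?_, ?_⟩
  all_goals
    have hsol : A.mulVec (A⁻¹.mulVec b) = b := by
      rw [Matrix.mulVec_mulVec, Matrix.mul_nonsing_inv _ hA, Matrix.one_mulVec]
    generalize A⁻¹.mulVec b = w at hsol
    have hs : ∀ i : Fin k, ∑ j, A i j * w j = b i := fun i => by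
      have := congrFun hsol i
      simpa [Matrix.mulVec, dotProduct] using this
    intro i hi
    rw [hco]
  · have := hs ⟨i, by omega⟩
    simp only [A, b, hi, if_true] at this
    rw [this, if_neg (by omega)]
  · have := hs ⟨i + n, by omega⟩
    simp only [A, b, Nat.add_sub_cancel] at this
    simp only [if_neg (show ¬ (i + n < n) by omega)] at this
    rw [this]
    by_cases h : i = r
    · rw [if_pos h, if_pos (by omega)]
    · rw [if_neg h, if_neg (by omega)]

lemma local_alg {k n l M : ℕ} (hM : 1 ≤ M) (hk : n + l = k) (hp : k < p)
    (φ : Fin k → (ZMod (p ^ M))[X]) (hφ : IsCurve φ) (η ξ : ZMod (p ^ M))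
    (hne : ¬ (p : ZMod (p ^ M)) ∣ ξ - η) (a : ℕ) (ha : 1 ≤ a) :
    ∃ (w : Fin l → Fin k → ZMod (p ^ M)) (κ : Fin l → ZMod (p ^ M))
      (ψ : Fin l → (ZMod (p ^ M))[X]), IsCurve ψ ∧
      (∀ r t, ∑ j, w r j * (φ j).eval (ξ + (p : ZMod (p ^ M)) ^ a * t)
        = κ r + (p : ZMod (p ^ M)) ^ (a * ((r : ℕ) + 1)) * (ψ r).eval t) ∧
      (∀ r b t, (p : ZMod (p ^ M)) ^ (b * (n + 1)) ∣
        ∑ j, w r j * (φ j).eval (η + (p : ZMod (p ^ M)) ^ b * t) - ∑ j, w r j * (φ j).eval η) := by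
  classical
  choose w hw1 hw2 using solve hM hk hp φ hφ η ξ hne
  set P : Fin l → (ZMod (p ^ M))[X] := fun r => ∑ j, C (w r j) * φ j with hP
  have hPe : ∀ r x, ∑ j, w r j * (φ j).eval x = (P r).eval x := by
    intro r x; simp [hP, eval_finsetSum]
  have e1 : ∀ r, ∃ R : (ZMod (p ^ M))[X],
      taylor η (P r) = C ((taylor η (P r)).coeff 0) + X ^ (n + 1) * R := by
    intro r
    have : X ^ (n + 1) ∣ taylor η (P r) - C ((taylor η (P r)).coeff 0) := by
      rw [X_pow_dvd_iff]
      intro d hd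
      rcases d with _ | d
      · simp
      · rw [coeff_sub, hw1 r d (by omega), coeff_C_succ, sub_zero]
    obtain ⟨R, hR⟩ := this
    exact ⟨R, by rw [← hR]; ring⟩
  have e2 : ∀ r : Fin l, ∃ R : (ZMod (p ^ M))[X],
      taylor ξ (P r) = C ((taylor ξ (P r)).coeff 0) + X ^ ((r : ℕ) + 1) + X ^ (l + 1) * R := by
    intro r
    have : X ^ (l + 1) ∣ taylor ξ (P r) - C ((taylor ξ (P r)).coeff 0) - X ^ ((r : ℕ) + 1) := by
      rw [X_pow_dvd_iff]
      intro d hd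
      rcases d with _ | d
      · simp [coeff_X_pow]
      · rw [coeff_sub, coeff_sub, hw2 r d (by omega), coeff_C_succ, sub_zero, coeff_X_pow]
        simp
    obtain ⟨R, hR⟩ := this
    exact ⟨R, by rw [← hR]; ring⟩
  choose R1 hR1 using e1
  choose R2 hR2 using e2
  refine ⟨w, fun r => (taylor ξ (P r)).coeff 0, fun r => X ^ ((r : ℕ) + 1) +
    C (p : ZMod (p ^ M)) * (C ((p : ZMod (p ^ M)) ^ (a * (l - r) - 1)) * (X ^ (l + 1) *
      (R2 r).comp (C ((p : ZMod (p ^ M)) ^ a) * X))), fun r => ⟨_, rfl⟩, ?_, ?_⟩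
  · intro r t
    have h := congrArg (eval ((p : ZMod (p ^ M)) ^ a * t)) (hR2 r)
    rw [taylor_eval] at h
    rw [hPe, add_comm ξ, h]
    simp only [eval_add, eval_mul, eval_pow, eval_X, eval_C, eval_comp]
    have hr := r.2
    have h1 : 1 ≤ a * (l - r) := Nat.mul_pos ha (by omega)
    have h2 : ((p : ZMod (p ^ M)) ^ a) ^ (l + 1) = (p : ZMod (p ^ M)) ^ (a * ((r : ℕ) + 1)) *
        ((p : ZMod (p ^ M)) * (p : ZMod (p ^ M)) ^ (a * (l - r) - 1)) := by
      rw [← pow_succ', ← pow_mul, ← pow_add]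
      congr 1
      rw [Nat.sub_add_cancel h1, ← Nat.mul_add]
      congr 1; omega
    rw [mul_pow, mul_pow, h2, ← pow_mul]
    ring
  · intro r b t
    have h := congrArg (eval ((p : ZMod (p ^ M)) ^ b * t)) (hR1 r)
    have h0 := congrArg (eval 0) (hR1 r)
    rw [taylor_eval] at h h0
    simp only [eval_add, eval_mul, eval_pow, eval_X, eval_C, eval_comp, zero_add] at h h0
    rw [hPe, hPe, add_comm η, h, h0, mul_pow, ← pow_mul]
    exact ⟨t ^ (n + 1) * eval ((p : ZMod (p ^ M)) ^ b * t) (R1 r), by ring⟩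

end SFP

namespace SFP
open Finset Polynomial

variable {p : ℕ} [Fact p.Prime]

lemma T_mono {l k : ℕ} (h : l ≤ k) : T l ≤ T k := by
  have h1 := two_T k
  have h2 := two_T l
  have : l * (l + 1) ≤ k * (k + 1) := Nat.mul_le_mul h (by omega)
  omega

lemma T_lt {l k : ℕ} (h : l < k) : T l < T k := by
  have h1 := two_T k
  have h2 := two_T l
  have : l * (l + 1) < k * (k + 1) := Nat.mul_lt_mul_of_lt_of_le h (by omega) (by omega)
  omega

lemma T_ident (l r : ℕ) : T (l + 1) * (r + 1) + T r = T (l + 1 + r) + T l * r := by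
  have h1 := two_T (l + 1)
  have h2 := two_T r
  have h3 := two_T (l + 1 + r)
  have h4 := two_T l
  have : 2 * (T (l + 1) * (r + 1) + T r) = 2 * (T (l + 1 + r) + T l * r) := by
    calc 2 * (T (l + 1) * (r + 1) + T r) = (2 * T (l + 1)) * (r + 1) + 2 * T r := by ring
      _ = 2 * T (l + 1 + r) + (2 * T l) * r := by rw [h1, h2, h3, h4]; ring
      _ = _ := by ring
  omega

/-- Hölder with natural exponents -/
lemma holder_nat {E : Type*} (A : Finset E) (U V G : E → ℝ) (hU : ∀ α, 0 ≤ U α) (hV : ∀ α, 0 ≤ V α)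
    (hG : ∀ α, 0 ≤ G α) (i j : ℕ) (hi : 1 ≤ i) (hj : 1 ≤ j)
    (h : ∀ α, G α ^ (i + j) ≤ U α ^ i * V α ^ j) :
    (∑ α ∈ A, G α) ^ (i + j) ≤ (∑ α ∈ A, U α) ^ i * (∑ α ∈ A, V α) ^ j := by
  have hi0 : (0 : ℝ) < i := by exact_mod_cast hi
  have hj0 : (0 : ℝ) < j := by exact_mod_cast hj
  have hij : (0 : ℝ) < (i : ℝ) + j := by positivity
  set P : ℝ := ((i : ℝ) + j) / i
  set Q : ℝ := ((i : ℝ) + j) / j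
  have hPQ : P.HolderConjugate Q := by
    rw [Real.holderConjugate_iff]
    constructor
    · rw [one_lt_div hi0]; linarith
    · simp only [P, Q]; field_simp
  have hP1 : 1 / P = i / ((i : ℝ) + j) := by simp only [P]; field_simp
  have hQ1 : 1 / Q = j / ((i : ℝ) + j) := by simp only [Q]; field_simp
  have hp0 : P ≠ 0 := hPQ.ne_zero
  have hq0 : Q ≠ 0 := hPQ.symm.ne_zero
  have hGle : ∀ α, G α ≤ (U α) ^ (1 / P) * (V α) ^ (1 / Q) := by
    intro α
    have h1 := Real.rpow_le_rpow (pow_nonneg (hG α) _) (h α)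
      (show 0 ≤ 1 / (((i + j : ℕ) : ℝ)) by positivity)
    rw [pow_rpow_inv (hG α) (by omega), Real.mul_rpow (pow_nonneg (hU α) _) (pow_nonneg (hV α) _),
      ← Real.rpow_natCast, ← Real.rpow_natCast, ← Real.rpow_mul (hU α), ← Real.rpow_mul (hV α)] at h1
    rw [hP1, hQ1]
    convert h1 using 3 <;> (push_cast; field_simp)
  have h2 := Real.inner_le_Lp_mul_Lq_of_nonneg A hPQ
    (f := fun α => (U α) ^ (1 / P)) (g := fun α => (V α) ^ (1 / Q))
    (fun α _ => Real.rpow_nonneg (hU α) _) (fun α _ => Real.rpow_nonneg (hV α) _)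
  have eU : ∀ α, ((U α) ^ (1 / P)) ^ P = U α := fun α => by
    rw [← Real.rpow_mul (hU α), one_div_mul_cancel hp0, Real.rpow_one]
  have eV : ∀ α, ((V α) ^ (1 / Q)) ^ Q = V α := fun α => by
    rw [← Real.rpow_mul (hV α), one_div_mul_cancel hq0, Real.rpow_one]
  simp only [eU, eV] at h2
  have h3 : ∑ α ∈ A, G α ≤ (∑ α ∈ A, U α) ^ (1 / P) * (∑ α ∈ A, V α) ^ (1 / Q) :=
    (Finset.sum_le_sum fun α _ => hGle α).trans h2
  have hSU : 0 ≤ ∑ α ∈ A, U α := Finset.sum_nonneg fun α _ => hU α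
  have hSV : 0 ≤ ∑ α ∈ A, V α := Finset.sum_nonneg fun α _ => hV α
  refine (pow_le_pow_left₀ (Finset.sum_nonneg fun α _ => hG α) h3 _).trans (le_of_eq ?_)
  rw [mul_pow, ← Real.rpow_natCast, ← Real.rpow_natCast, ← Real.rpow_mul hSU, ← Real.rpow_mul hSV,
    ← Real.rpow_natCast, ← Real.rpow_natCast, hP1, hQ1]
  congr 2 <;> (push_cast; field_simp)

section ctx
variable {k M : ℕ} (m : ℕ) (φ : Fin k → (ZMod (p ^ M))[X])
    (t : ZMod (p ^ M) → ZMod (p ^ M)) (co : ZMod (p ^ M) → ℂ)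

noncomputable def Nm (s : Finset (ZMod (p ^ M))) : ℝ :=
  ∑ J ∈ parts ((p : ZMod (p ^ M)) ^ m) t s, nrm (T k) (F (ex m φ t) co J)

lemma Nm_nonneg (s : Finset (ZMod (p ^ M))) : 0 ≤ Nm m φ t co s :=
  Finset.sum_nonneg fun _ _ => nrm_nonneg _ _

lemma Nm_parts {a : ℕ} (ha : a ≤ m) (s : Finset (ZMod (p ^ M))) :
    ∑ J ∈ parts ((p : ZMod (p ^ M)) ^ a) t s, Nm m φ t co J = Nm m φ t co s := by
  unfold Nm
  exact sum_parts_parts (pow_dvd_pow _ ha) t s _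

lemma Nm_part_le {a : ℕ} (ha : a ≤ m) (s : Finset (ZMod (p ^ M))) {J : Finset (ZMod (p ^ M))}
    (hJ : J ∈ parts ((p : ZMod (p ^ M)) ^ a) t s) : Nm m φ t co J ≤ Nm m φ t co s := by
  rw [← Nm_parts m φ t co ha s]
  exact Finset.single_le_sum (f := fun J => Nm m φ t co J) (fun _ _ => Nm_nonneg m φ t co _) hJ

/-- bilinear estimates -/
def Bil (l a b : ℕ) (B : ℝ) : Prop :=
  ∀ ξ η : ZMod (p ^ M), ¬ (p : ZMod (p ^ M)) ∣ ξ - η → ∀ I I' : Finset (ZMod (p ^ M)),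
    (∀ x ∈ I, (p : ZMod (p ^ M)) ^ a ∣ t x - ξ) → (∀ x ∈ I', (p : ZMod (p ^ M)) ^ b ∣ t x - η) →
    ∑ α, ‖F (ex m φ t) co I α‖ ^ (2 * T l) * ‖F (ex m φ t) co I' α‖ ^ (2 * (T k - T l)) ≤
      B ^ (T k) * (Nm m φ t co I ^ (T l) * Nm m φ t co I' ^ (T k - T l))

variable {m φ t co}

lemma Bil.mono_const {l a b : ℕ} {B B' : ℝ} (hB : 0 ≤ B) (h : Bil m φ t co l a b B) (hBB : B ≤ B') :
    Bil m φ t co l a b B' := by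
  intro ξ η hne I I' hI hI'
  refine (h ξ η hne I I' hI hI').trans ?_
  apply mul_le_mul_of_nonneg_right (pow_le_pow_left₀ hB hBB _)
  have := Nm_nonneg m φ t co I
  have := Nm_nonneg m φ t co I'
  positivity

lemma ex_norm (x : ZMod (p ^ M)) (α : Fin k → ZMod (p ^ M)) : ‖ex m φ t x α‖ = 1 :=
  AddChar.norm_apply _ _

/-- main transfer lemma -/
lemma core {l n m' a b : ℕ} {K : ℝ} (hM : 1 ≤ M) (hkm : k * m ≤ M) (hkp : k < p)
    (hφ : IsCurve φ) (hnl : n + l = k) (hl : 1 ≤ l) (ha : 1 ≤ a) (ham : a + m' ≤ m)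
    (hK : 0 ≤ K) (hD : Dec p l m' M K)
    (ξ η : ZMod (p ^ M)) (hne : ¬ (p : ZMod (p ^ M)) ∣ ξ - η) (I I' : Finset (ZMod (p ^ M)))
    (hI : ∀ x ∈ I, (p : ZMod (p ^ M)) ^ a ∣ t x - ξ)
    (hI' : ∀ x ∈ I', (p : ZMod (p ^ M)) ^ b ∣ t x - η)
    (hb : I' ≠ ∅ → l * (a + m') ≤ (n + 1) * b) (E : ℕ) :
    (∑ α, ‖F (ex m φ t) co I' α‖ ^ E * ‖F (ex m φ t) co I α‖ ^ (2 * T l)) ^ (1 / (T l : ℝ)) ≤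
      K * ∑ J ∈ parts ((p : ZMod (p ^ M)) ^ (a + m')) t I,
        (∑ α, ‖F (ex m φ t) co I' α‖ ^ E * ‖F (ex m φ t) co J α‖ ^ (2 * T l)) ^ (1 / (T l : ℝ)) := by
  classical
  obtain ⟨w, κ, ψ, hψ, hw1, hw2⟩ := local_alg hM hnl hkp φ hφ η ξ hne a ha
  have hlk : l ≤ k := by omega
  have hmM : m ≤ M := le_trans (Nat.le_mul_of_pos_left m (by omega)) hkm
  choose! u hu using hI
  have hu' : ∀ x ∈ I, t x = ξ + (p : ZMod (p ^ M)) ^ a * u x := fun x hx => by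
    rw [← hu x hx]; ring
  have hparts : parts ((p : ZMod (p ^ M)) ^ (a + m')) t I = parts ((p : ZMod (p ^ M)) ^ m') u I := by
    apply parts_congr
    intro x hx y hy
    rw [hu' x hx, hu' y hy, ← dvd_cancel (a := a) (by omega : a + m' ≤ M)]
    rw [show ξ + (p : ZMod (p ^ M)) ^ a * u y - (ξ + (p : ZMod (p ^ M)) ^ a * u x) =
      (p : ZMod (p ^ M)) ^ a * (u y - u x) by ring]
  rw [hparts]
  have hlm : l * (a + m') ≤ k * m := Nat.mul_le_mul hlk ham
  let Y : Fin l → ℕ := fun r => k * m - l * m' - a * ((r : ℕ) + 1)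
  have hY : ∀ r : Fin l, Y r + l * m' + a * ((r : ℕ) + 1) = k * m := by
    intro r
    have h1 : a * ((r : ℕ) + 1) ≤ a * l := Nat.mul_le_mul_left a r.2
    have h2 : l * (a + m') = a * l + l * m' := by ring
    simp only [Y]; omega
  let io : (Fin l → ZMod (p ^ M)) → (Fin k → ZMod (p ^ M)) := fun c j =>
    ∑ r, c r * (p : ZMod (p ^ M)) ^ (Y r) * w r j
  have hiosum : ∀ (c : Fin l → ZMod (p ^ M)) (z : ZMod (p ^ M)),
      ∑ j, io c j * (φ j).eval z
      = ∑ r, c r * (p : ZMod (p ^ M)) ^ (Y r) * ∑ j, w r j * (φ j).eval z := by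
    intro c z
    simp only [io, Finset.sum_mul, Finset.mul_sum]
    rw [Finset.sum_comm]
    apply Finset.sum_congr rfl; intro r _
    apply Finset.sum_congr rfl; intro j _
    ring
  let v : (Fin l → ZMod (p ^ M)) → ℂ := fun c =>
    psi p M ((p : ZMod (p ^ M)) ^ (M - k * m) * ∑ r, c r * (p : ZMod (p ^ M)) ^ (Y r) * κ r)
  refine transfer hK hD hl (ex m φ t) (ex_add m φ t) co I ψ hψ u io v
    (fun c => AddChar.norm_apply _ _) ?_ _ (fun α => by positivity) ?_
  · intro x hx c
    unfold ex
    simp only [v]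
    rw [← AddChar.map_add_eq_mul]
    congr 1
    rw [hiosum, hu' x hx]
    simp only [hw1, mul_add, Finset.sum_add_distrib]
    congr 1
    rw [Finset.mul_sum, Finset.mul_sum]
    apply Finset.sum_congr rfl; intro r _
    have : (p : ZMod (p ^ M)) ^ (M - l * m') = (p : ZMod (p ^ M)) ^ (M - k * m) *
        ((p : ZMod (p ^ M)) ^ (Y r) * (p : ZMod (p ^ M)) ^ (a * ((r : ℕ) + 1))) := by
      rw [← pow_add, ← pow_add]
      congr 1
      have := hY r
      omega
    rw [this]; ring
  · intro α c
    congr 1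
    have : F (ex m φ t) co I' (α + io c) =
        psi p M ((p : ZMod (p ^ M)) ^ (M - k * m) *
          ∑ r, c r * (p : ZMod (p ^ M)) ^ (Y r) * ∑ j, w r j * (φ j).eval η) *
        F (ex m φ t) co I' α := by
      unfold F
      rw [Finset.mul_sum]
      apply Finset.sum_congr rfl
      intro x hx
      have hb' := hb (Finset.ne_empty_of_mem hx)
      rw [ex_add]
      suffices h : ex m φ t x (io c) = psi p M ((p : ZMod (p ^ M)) ^ (M - k * m) *
          ∑ r, c r * (p : ZMod (p ^ M)) ^ (Y r) * ∑ j, w r j * (φ j).eval η) by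
        rw [h]; ring
      unfold ex
      congr 1
      rw [hiosum, Finset.mul_sum, Finset.mul_sum]
      apply Finset.sum_congr rfl; intro r _
      rw [← sub_eq_zero]
      obtain ⟨g, hg⟩ := hI' x hx
      have hx' : t x = η + (p : ZMod (p ^ M)) ^ b * g := by rw [← hg]; ring
      obtain ⟨g', hg'⟩ := hw2 r b g
      rw [← hx'] at hg'
      calc _ = (p : ZMod (p ^ M)) ^ (M - k * m) * (p : ZMod (p ^ M)) ^ (Y r) * c r *
          (∑ j, w r j * (φ j).eval (t x) - ∑ j, w r j * (φ j).eval η) := by ring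
        _ = (p : ZMod (p ^ M)) ^ (M - k * m + Y r + b * (n + 1)) * (c r * g') := by
          rw [hg', pow_add, pow_add]; ring
        _ = 0 := by
          rw [p_pow_zero, zero_mul]
          have h1 := hY r
          have h2 : a * ((r : ℕ) + 1) ≤ a * l := Nat.mul_le_mul_left a r.2
          have h3 : l * (a + m') = a * l + l * m' := by ring
          have h4 : (n + 1) * b = b * (n + 1) := mul_comm _ _
          omega
    rw [this, norm_mul, AddChar.norm_apply, one_mul]

/-- rescaling -/
lemma rescale {m' a : ℕ} {K : ℝ} (hk : 1 ≤ k) (hM : 1 ≤ M) (hkm : k * m ≤ M) (hkp : k < p)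
    (hφ : IsCurve φ) (ha : 1 ≤ a) (ham : a + m' = m)
    (hK : 0 ≤ K) (hD : Dec p k m' M K)
    (ξ : ZMod (p ^ M)) (I : Finset (ZMod (p ^ M)))
    (hI : ∀ x ∈ I, (p : ZMod (p ^ M)) ^ a ∣ t x - ξ) :
    nrm (T k) (F (ex m φ t) co I) ≤ K * Nm m φ t co I := by
  have h := core (l := k) (n := 0) (m' := m') (a := a) (b := 0) (co := co) (E := 0)
    hM hkm hkp hφ (by omega) hk ha (by omega) hK hD ξ (ξ - 1) (by
      rw [sub_sub_cancel]
      intro h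
      have h2 := dvd_iff_val (p := p) hM (1 : ZMod (p ^ M))
      rw [pow_one, pow_one] at h2
      have hp := (Fact.out (p := p.Prime)).one_lt
      have : Fact (1 < p ^ M) := ⟨Nat.one_lt_pow (by omega) hp⟩
      rw [h2, ZMod.val_one] at h
      have := Nat.le_of_dvd one_pos h
      omega) I ∅ hI (by simp) (by simp)
  simp only [pow_zero, one_mul] at h
  rw [ham] at h
  exact h

lemma bil_zero {m' a b : ℕ} {K : ℝ} (hk : 1 ≤ k) (hM : 1 ≤ M) (hkm : k * m ≤ M) (hkp : k < p)
    (hφ : IsCurve φ) (hb : 1 ≤ b) (hbm : b + m' = m)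
    (hK : 0 ≤ K) (hD : Dec p k m' M K) : Bil m φ t co 0 a b K := by
  intro ξ η hne I I' hI hI'
  have h := rescale (co := co) hk hM hkm hkp hφ hb hbm hK hD η I' hI'
  have h0 : T 0 = 0 := rfl
  simp only [h0, mul_zero, pow_zero, one_mul, Nat.sub_zero]
  rw [← nrm_pow (T_pos hk), ← mul_pow]
  exact pow_le_pow_left₀ (nrm_nonneg _ _) h _

lemma bil_triv {l a b : ℕ} {K : ℝ} (hl : 1 ≤ l) (hlk : l < k)
    (hφ : IsCurve φ) (hK : 0 ≤ K) (hD : Dec p k m M K) : Bil m φ t co l a b K := by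
  intro ξ η hne I I' hI hI'
  have hT := T_pos hl
  have hT2 := T_lt hlk
  have hTk : 1 ≤ T k := by omega
  have h := holder_nat Finset.univ (fun α => ‖F (ex m φ t) co I α‖ ^ (2 * T k))
    (fun α => ‖F (ex m φ t) co I' α‖ ^ (2 * T k))
    (fun α => ‖F (ex m φ t) co I α‖ ^ (2 * T l) * ‖F (ex m φ t) co I' α‖ ^ (2 * (T k - T l)))
    (fun α => by positivity) (fun α => by positivity) (fun α => by positivity)
    (T l) (T k - T l) hT (by omega) (by
      intro α
      rw [show T l + (T k - T l) = T k by omega, mul_pow, ← pow_mul, ← pow_mul, ← pow_mul, ← pow_mul]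
      apply le_of_eq; congr 2 <;> ring)
  rw [show T l + (T k - T l) = T k by omega, ← nrm_pow hTk, ← nrm_pow hTk] at h
  have h1 : nrm (T k) (F (ex m φ t) co I) ≤ K * Nm m φ t co I := hD φ hφ t co I
  have h2 : nrm (T k) (F (ex m φ t) co I') ≤ K * Nm m φ t co I' := hD φ hφ t co I'
  have n1 := Nm_nonneg m φ t co I
  have n2 := Nm_nonneg m φ t co I'
  rw [← pow_le_pow_iff_left₀ (Finset.sum_nonneg fun α _ => by positivity) (by positivity)
    (by omega : T k ≠ 0)]
  refine h.trans ?_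
  have h3 : (nrm (T k) (F (ex m φ t) co I) ^ T k) ^ T l ≤ ((K * Nm m φ t co I) ^ T k) ^ T l :=
    pow_le_pow_left₀ (pow_nonneg (nrm_nonneg _ _) _) (pow_le_pow_left₀ (nrm_nonneg _ _) h1 _) _
  have h4 : (nrm (T k) (F (ex m φ t) co I') ^ T k) ^ (T k - T l) ≤
      ((K * Nm m φ t co I') ^ T k) ^ (T k - T l) :=
    pow_le_pow_left₀ (pow_nonneg (nrm_nonneg _ _) _) (pow_le_pow_left₀ (nrm_nonneg _ _) h2 _) _
  refine (mul_le_mul h3 h4 (pow_nonneg (pow_nonneg (nrm_nonneg _ _) _) _) (by positivity)).trans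
    (le_of_eq ?_)
  have e : K ^ T k = K ^ T l * K ^ (T k - T l) := by
    rw [← pow_add]; congr 1; omega
  have e2 : (K ^ T k) ^ T k = (K ^ T k) ^ T l * (K ^ T k) ^ (T k - T l) := by
    rw [← pow_add]; congr 1; omega
  rw [mul_pow _ _ (T k), mul_pow _ _ (T k), mul_pow, mul_pow, mul_pow, e2, mul_pow,
    ← pow_mul (Nm m φ t co I), ← pow_mul (Nm m φ t co I'), ← pow_mul (Nm m φ t co I),
    ← pow_mul (Nm m φ t co I'), mul_comm (T k) (T l), mul_comm (T k) (T k - T l)]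
  ring

lemma Bil.mono_scale {l a a' b : ℕ} {B : ℝ} (h : Bil m φ t co l a' b B) (haa : a' ≤ a) :
    Bil m φ t co l a b B := by
  intro ξ η hne I I' hI hI'
  exact h ξ η hne I I' (fun x hx => (pow_dvd_pow _ haa).trans (hI x hx)) hI'

lemma not_dvd_of {ξ η y : ZMod (p ^ M)} {a : ℕ} (ha : 1 ≤ a) (hne : ¬ (p : ZMod (p ^ M)) ∣ ξ - η)
    (h : (p : ZMod (p ^ M)) ^ a ∣ y - ξ) : ¬ (p : ZMod (p ^ M)) ∣ y - η := by
  intro h1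
  apply hne
  have h2 : (p : ZMod (p ^ M)) ∣ y - ξ := (dvd_pow_self _ (by omega)).trans h
  have := dvd_sub h1 h2
  rwa [show y - η - (y - ξ) = ξ - η by ring] at this

/-- lower-degree decoupling inside bilinear estimates -/
lemma Bil.lower {l m' n a b : ℕ} {K B : ℝ} (hM : 1 ≤ M) (hkm : k * m ≤ M) (hkp : k < p)
    (hφ : IsCurve φ) (hnl : n + l = k) (hl : 1 ≤ l) (ha : 1 ≤ a)
    (ham : a + m' ≤ m) (hK : 1 ≤ K) (hB : 0 ≤ B) (hD : Dec p l m' M K)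
    (hb : l * (a + m') ≤ (n + 1) * b) (h : Bil m φ t co l (a + m') b B) :
    Bil m φ t co l a b (K * B) := by
  intro ξ η hne I I' hI hI'
  have hTl := T_pos hl
  have hTlk : T l ≤ T k := T_mono (by omega)
  have hc := core (co := co) hM hkm hkp hφ hnl hl ha ham (by linarith) hD ξ η hne I I' hI hI'
    (fun _ => hb) (2 * (T k - T l))
  have n1 := Nm_nonneg m φ t co I
  have n2 := Nm_nonneg m φ t co I'
  set Z : ℝ := B ^ (T k) * Nm m φ t co I' ^ (T k - T l) with hZ
  have hZ0 : 0 ≤ Z := by positivity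
  have hJ : ∀ J ∈ parts ((p : ZMod (p ^ M)) ^ (a + m')) t I,
      (∑ α, ‖F (ex m φ t) co I' α‖ ^ (2 * (T k - T l)) * ‖F (ex m φ t) co J α‖ ^ (2 * T l))
        ^ (1 / (T l : ℝ)) ≤ Z ^ (1 / (T l : ℝ)) * Nm m φ t co J := by
    intro J hJ
    obtain ⟨x, hx⟩ := parts_nonempty hJ
    have h1 := h (t x) η (not_dvd_of ha hne (hI x (parts_subset hJ hx))) J I'
      (fun y hy => ((mem_parts hJ hx y).1 hy).2) hI'
    have h2 : ∑ α, ‖F (ex m φ t) co I' α‖ ^ (2 * (T k - T l)) * ‖F (ex m φ t) co J α‖ ^ (2 * T l)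
        ≤ Z * Nm m φ t co J ^ T l := by
      simp only [mul_comm (‖F (ex m φ t) co I' _‖ ^ (2 * (T k - T l)))]
      refine h1.trans (le_of_eq ?_)
      rw [hZ]; ring
    refine (Real.rpow_le_rpow (Finset.sum_nonneg fun α _ => by positivity) h2
      (by positivity)).trans (le_of_eq ?_)
    have n3 := Nm_nonneg m φ t co J
    rw [Real.mul_rpow hZ0 (by positivity), pow_rpow_inv n3 hTl]
  have h3 := hc.trans (mul_le_mul_of_nonneg_left (Finset.sum_le_sum hJ) (by linarith))
  rw [← Finset.mul_sum, Nm_parts m φ t co ham I] at h3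
  have h4 := pow_le_pow_left₀ (Real.rpow_nonneg (Finset.sum_nonneg fun α _ => by positivity) _)
    h3 (T l)
  rw [rpow_inv_pow (Finset.sum_nonneg fun α _ => by positivity) hTl, mul_pow, mul_pow,
    rpow_inv_pow hZ0 hTl] at h4
  simp only [mul_comm (‖F (ex m φ t) co I' _‖ ^ (2 * (T k - T l)))] at h4
  refine h4.trans ?_
  have h5 : K ^ T l ≤ K ^ T k := pow_le_pow_right₀ hK hTlk
  calc K ^ T l * (Z * Nm m φ t co I ^ T l) ≤ K ^ T k * (Z * Nm m φ t co I ^ T l) := by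
        apply mul_le_mul_of_nonneg_right h5; positivity
    _ = _ := by rw [hZ]; ring

/-- Hölder step -/
lemma Bil.step {l r a b : ℕ} {B B1 B2 : ℝ} (hr : 1 ≤ r) (hlr : l + 1 + r = k)
    (hB : 0 ≤ B) (hB1 : 0 ≤ B1)
    (h1 : Bil m φ t co r b a B1) (h2 : Bil m φ t co l a b B2)
    (hBB : B1 * B2 ^ r ≤ B ^ (r + 1)) (hB2 : 0 ≤ B2) : Bil m φ t co (l + 1) a b B := by
  intro ξ η hne I I' hI hI'
  have hid := T_ident l r
  rw [hlr] at hid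
  have t1 : T r ≤ T k := T_mono (by omega)
  have t2 : T l ≤ T k := T_mono (by omega)
  have t3 : T (l + 1) ≤ T k := T_mono (by omega)
  have hne' : ¬ (p : ZMod (p ^ M)) ∣ η - ξ := by rwa [← dvd_neg, neg_sub]
  have g1 := h1 η ξ hne' I' I hI' hI
  have g2 := h2 ξ η hne I I' hI hI'
  obtain ⟨d1, hd1⟩ := Nat.exists_eq_add_of_le t1
  obtain ⟨d2, hd2⟩ := Nat.exists_eq_add_of_le t2
  obtain ⟨d3, hd3⟩ := Nat.exists_eq_add_of_le t3
  have s1 : T k - T r = d1 := by omega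
  have s2 : T k - T l = d2 := by omega
  have s3 : T k - T (l + 1) = d3 := by omega
  rw [s1] at g1
  rw [s2] at g2
  rw [s3]
  have id1 : T (l + 1) * (r + 1) = d1 + T l * r := by
    rw [hd1] at hid; omega
  have id2 : d3 * (r + 1) = T r + d2 * r := by
    have e1 : T k * (r + 1) = T (l + 1) * (r + 1) + d3 * (r + 1) := by
      rw [← add_mul, ← hd3]
    have e2 : T k * r = T l * r + d2 * r := by rw [← add_mul, ← hd2]
    have e3 : T k * (r + 1) = T k * r + T k := by ring
    omega
  have n1 := Nm_nonneg m φ t co I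
  have n2 := Nm_nonneg m φ t co I'
  have hh := holder_nat Finset.univ
    (fun α => ‖F (ex m φ t) co I' α‖ ^ (2 * T r) * ‖F (ex m φ t) co I α‖ ^ (2 * d1))
    (fun α => ‖F (ex m φ t) co I α‖ ^ (2 * T l) * ‖F (ex m φ t) co I' α‖ ^ (2 * d2))
    (fun α => ‖F (ex m φ t) co I α‖ ^ (2 * T (l + 1)) * ‖F (ex m φ t) co I' α‖ ^ (2 * d3))
    (fun α => by positivity) (fun α => by positivity) (fun α => by positivity)
    1 r le_rfl hr (by
      intro α
      generalize ‖F (ex m φ t) co I α‖ = x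
      generalize ‖F (ex m φ t) co I' α‖ = y
      apply le_of_eq
      have e1 : (x ^ (2 * T (l + 1)) * y ^ (2 * d3)) ^ (r + 1)
          = x ^ (2 * (T (l + 1) * (r + 1))) * y ^ (2 * (d3 * (r + 1))) := by
        rw [mul_pow, ← pow_mul, ← pow_mul, mul_assoc, mul_assoc]
      rw [add_comm 1 r, pow_one, e1, id1, id2]
      ring)
  rw [pow_one, add_comm 1 r] at hh
  rw [← pow_le_pow_iff_left₀ (Finset.sum_nonneg fun α _ => by positivity) (by positivity)
    (by omega : r + 1 ≠ 0)]
  refine hh.trans ?_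
  refine (mul_le_mul g1 (pow_le_pow_left₀ (Finset.sum_nonneg fun α _ => by positivity) g2 r)
    (pow_nonneg (Finset.sum_nonneg fun α _ => by positivity) _) (by positivity)).trans ?_
  generalize Nm m φ t co I = x at *
  generalize Nm m φ t co I' = y at *
  calc _ = (B1 * B2 ^ r) ^ T k * (x ^ (d1 + T l * r) * y ^ (T r + d2 * r)) := by
        simp only [mul_pow, pow_add, pow_mul]
        rw [← pow_mul B2, ← pow_mul B2, mul_comm r]; ring
    _ ≤ (B ^ (r + 1)) ^ T k * (x ^ (d1 + T l * r) * y ^ (T r + d2 * r)) := by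
        apply mul_le_mul_of_nonneg_right (pow_le_pow_left₀ (by positivity) hBB _)
        positivity
    _ = _ := by
        rw [← id1, ← id2, mul_pow, mul_pow, ← pow_mul, ← pow_mul, ← pow_mul, ← pow_mul,
          mul_comm (r + 1) (T k)]

end ctx
end SFP

namespace SFP
open Finset Polynomial

variable {p : ℕ} [Fact p.Prime]

lemma F_parts {E : Type*} {M : ℕ} (e : ZMod (p ^ M) → E → ℂ) (co : ZMod (p ^ M) → ℂ)
    (q : ZMod (p ^ M)) (t : ZMod (p ^ M) → ZMod (p ^ M)) (s : Finset (ZMod (p ^ M))) (α : E) :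
    F e co s α = ∑ J ∈ parts q t s, F e co J α := by
  unfold F; rw [sum_parts]

lemma dec_triv {k m M : ℕ} (hk : 1 ≤ k) (hm : m ≤ M) : Dec p k m M ((p : ℝ) ^ m) := by
  classical
  intro φ _ t co s
  have hT := T_pos hk
  have hp : (0 : ℝ) ≤ (p : ℝ) ^ m := by positivity
  have h1 : ∀ α, ‖F (ex m φ t) co s α‖ ^ 2 ≤
      ∑ J ∈ parts ((p : ZMod (p ^ M)) ^ m) t s, (p : ℝ) ^ m * ‖F (ex m φ t) co J α‖ ^ 2 := by
    intro α
    rw [F_parts (ex m φ t) co ((p : ZMod (p ^ M)) ^ m) t s α]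
    refine (pow_le_pow_left₀ (norm_nonneg _) (norm_sum_le _ _) 2).trans ?_
    refine sq_sum_le_card_mul_sum_sq.trans ?_
    rw [← Finset.mul_sum]
    apply mul_le_mul_of_nonneg_right _ (Finset.sum_nonneg fun _ _ => by positivity)
    exact_mod_cast card_parts hm t s
  have h2 := mink (parts ((p : ZMod (p ^ M)) ^ m) t s) Finset.univ (fun _ => (1 : ℝ))
    (fun _ => zero_le_one) (fun J (α : Fin k → ZMod (p ^ M)) => (p : ℝ) ^ m * ‖F (ex m φ t) co J α‖ ^ 2)
    (fun J α => by positivity) (T k) hT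
  simp only [one_mul] at h2
  refine le_trans ?_ (h2.trans (le_of_eq ?_))
  · unfold nrm
    apply Real.rpow_le_rpow (Finset.sum_nonneg fun _ _ => by positivity) _ (by positivity)
    apply Finset.sum_le_sum; intro α _
    rw [pow_mul]
    exact pow_le_pow_left₀ (by positivity) (h1 α) _
  · rw [Finset.mul_sum]
    apply Finset.sum_congr rfl; intro J _
    unfold nrm
    simp only [mul_pow, ← pow_mul]
    rw [← Finset.mul_sum, Real.mul_rpow (by positivity)
      (Finset.sum_nonneg fun _ _ => by positivity), pow_mul, pow_rpow_inv hp hT]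

lemma dec_zero {k M : ℕ} (hk : 1 ≤ k) : Dec p k 0 M 1 := by
  have := dec_triv (p := p) (k := k) (m := 0) (M := M) hk (by omega)
  simpa using this

lemma Dec.mono {k m M : ℕ} {K K' : ℝ} (h : Dec p k m M K) (hK : K ≤ K') : Dec p k m M K' := by
  intro φ hφ t co s
  refine (h φ hφ t co s).trans ?_
  exact mul_le_mul_of_nonneg_right hK (Finset.sum_nonneg fun _ _ => nrm_nonneg _ _)

lemma pow_sum_le {J : Type*} (A : Finset J) (z : J → ℝ) (hz : ∀ j ∈ A, 0 ≤ z j) (n e : ℕ)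
    (hn : A.card ≤ n) (he : 1 ≤ e) : (∑ j ∈ A, z j) ^ e ≤ (n : ℝ) ^ e * ∑ j ∈ A, z j ^ e := by
  rcases A.eq_empty_or_nonempty with h | h
  · subst h; simp [show e ≠ 0 by omega]
  obtain ⟨i, hi, him⟩ := Finset.exists_max_image A z h
  have h1 : ∑ j ∈ A, z j ≤ n * z i := by
    calc ∑ j ∈ A, z j ≤ A.card • z i := Finset.sum_le_card_nsmul _ _ _ him
      _ ≤ n * z i := by
        rw [nsmul_eq_mul]
        apply mul_le_mul_of_nonneg_right _ (hz i hi)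
        exact_mod_cast hn
  refine (pow_le_pow_left₀ (Finset.sum_nonneg hz) h1 e).trans ?_
  rw [mul_pow]
  apply mul_le_mul_of_nonneg_left _ (by positivity)
  exact Finset.single_le_sum (f := fun j => z j ^ e) (fun j hj => pow_nonneg (hz j hj) e) hi

lemma broad_narrow {J : Type*} [DecidableEq J] (A : Finset J) (z : J → ℝ) (hz : ∀ j, 0 ≤ z j)
    (n : ℕ) (hn1 : 1 ≤ n)
    (hn : A.card ≤ n) (K : ℝ) (hK : 1 ≤ K) (u v : ℕ) (huv : 1 ≤ u + v) :
    (∑ j ∈ A, z j) ^ (u + v) ≤ (1 + 1 / K) ^ (u + v) * ∑ j ∈ A, z j ^ (u + v) +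
      (n * (n * K)) ^ (u + v) * ∑ i ∈ A, ∑ j ∈ A.erase i, z i ^ u * z j ^ v := by
  rcases A.eq_empty_or_nonempty with h | h
  · subst h; rw [Finset.sum_empty, zero_pow (by omega)]; simp
  have hn0 : (1 : ℝ) ≤ n := by exact_mod_cast hn1
  have hnK : 1 ≤ (n : ℝ) * K := by nlinarith
  have hcard : (A.card : ℝ) ≤ n := by exact_mod_cast hn
  have hS : 0 ≤ ∑ j ∈ A, z j := Finset.sum_nonneg fun j _ => hz j
  have hdbl : 0 ≤ ∑ i ∈ A, ∑ j ∈ A.erase i, z i ^ u * z j ^ v :=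
    Finset.sum_nonneg fun i _ => Finset.sum_nonneg fun j _ =>
      mul_nonneg (pow_nonneg (hz i) _) (pow_nonneg (hz j) _)
  have hsg : 0 ≤ ∑ j ∈ A, z j ^ (u + v) := Finset.sum_nonneg fun j _ => pow_nonneg (hz j) _
  obtain ⟨i, hi, him⟩ := Finset.exists_max_image A z h
  by_cases hc : ∀ j ∈ A.erase i, n * K * z j ≤ z i
  · have h1 : ∑ j ∈ A, z j ≤ (1 + 1 / K) * z i := by
      rw [← Finset.add_sum_erase A z hi]
      have h2 : ∑ j ∈ A.erase i, z j ≤ (A.erase i).card • (z i / (n * K)) := by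
        apply Finset.sum_le_card_nsmul
        intro j hj
        rw [le_div_iff₀ (by linarith)]
        have := hc j hj; linarith
      have h3 : (A.erase i).card • (z i / (n * K)) ≤ n * (z i / (n * K)) := by
        rw [nsmul_eq_mul]
        apply mul_le_mul_of_nonneg_right _ (div_nonneg (hz i) (by linarith))
        refine le_trans ?_ hcard
        exact_mod_cast Finset.card_le_card (Finset.erase_subset _ _)
      have h4 : (n : ℝ) * (z i / (n * K)) = 1 / K * z i := by
        field_simp
      linarith
    have h5 := pow_le_pow_left₀ hS h1 (u + v)
    rw [mul_pow] at h5
    have h6 : z i ^ (u + v) ≤ ∑ j ∈ A, z j ^ (u + v) :=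
      Finset.single_le_sum (f := fun j => z j ^ (u + v)) (fun j _ => pow_nonneg (hz j) _) hi
    have h7 : (1 + 1 / K) ^ (u + v) * z i ^ (u + v) ≤
        (1 + 1 / K) ^ (u + v) * ∑ j ∈ A, z j ^ (u + v) :=
      mul_le_mul_of_nonneg_left h6 (by positivity)
    have h8 : 0 ≤ (n * (n * K)) ^ (u + v) * ∑ i ∈ A, ∑ j ∈ A.erase i, z i ^ u * z j ^ v := by
      positivity
    linarith
  · push Not at hc
    obtain ⟨j, hj, hjz⟩ := hc
    have h1 : ∑ j ∈ A, z j ≤ n * z i := by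
      calc ∑ j ∈ A, z j ≤ A.card • z i := Finset.sum_le_card_nsmul _ _ _ him
        _ ≤ n * z i := by
          rw [nsmul_eq_mul]
          exact mul_le_mul_of_nonneg_right hcard (hz i)
    have h2 := pow_le_pow_left₀ hS h1 (u + v)
    have h3 : z i ^ (u + v) ≤ (n * K) ^ (u + v) * (z i ^ u * z j ^ v) := by
      have a1 : z i ^ v ≤ (n * K * z j) ^ v := pow_le_pow_left₀ (hz i) hjz.le v
      have a2 : (1 : ℝ) ≤ (n * K) ^ u := one_le_pow₀ hnK
      have a3 : z i ^ u ≤ (n * K) ^ u * z i ^ u := le_mul_of_one_le_left (pow_nonneg (hz i) _) a2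
      calc z i ^ (u + v) = z i ^ u * z i ^ v := pow_add _ _ _
        _ ≤ ((n * K) ^ u * z i ^ u) * (n * K * z j) ^ v :=
          mul_le_mul a3 a1 (pow_nonneg (hz i) _) (mul_nonneg (by positivity) (pow_nonneg (hz i) _))
        _ = _ := by rw [mul_pow (_ * _), pow_add]; ring
    have h4 : z i ^ u * z j ^ v ≤ ∑ i ∈ A, ∑ j ∈ A.erase i, z i ^ u * z j ^ v := by
      have b1 : z i ^ u * z j ^ v ≤ ∑ j ∈ A.erase i, z i ^ u * z j ^ v :=
        Finset.single_le_sum (f := fun j => z i ^ u * z j ^ v)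
          (fun j _ => mul_nonneg (pow_nonneg (hz i) _) (pow_nonneg (hz j) _)) hj
      refine b1.trans (Finset.single_le_sum (f := fun i => ∑ j ∈ A.erase i, z i ^ u * z j ^ v)
        (fun i _ => Finset.sum_nonneg fun j _ =>
          mul_nonneg (pow_nonneg (hz i) _) (pow_nonneg (hz j) _)) hi)
    have h5 : 0 ≤ (1 + 1 / K) ^ (u + v) * ∑ j ∈ A, z j ^ (u + v) := by positivity
    calc (∑ j ∈ A, z j) ^ (u + v) ≤ (n : ℝ) ^ (u + v) * z i ^ (u + v) := by
          rw [← mul_pow]; exact h2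
      _ ≤ (n : ℝ) ^ (u + v) * ((n * K) ^ (u + v) * (z i ^ u * z j ^ v)) := by gcongr
      _ = (n * (n * K)) ^ (u + v) * (z i ^ u * z j ^ v) := by rw [mul_pow (n : ℝ) (n * K)]; ring
      _ ≤ (n * (n * K)) ^ (u + v) * ∑ i ∈ A, ∑ j ∈ A.erase i, z i ^ u * z j ^ v := by gcongr
      _ ≤ _ := by linarith

/-- splitting the second interval -/
lemma Bil.split {k M m : ℕ} {φ : Fin k → (ZMod (p ^ M))[X]}
    {t : ZMod (p ^ M) → ZMod (p ^ M)} {co : ZMod (p ^ M) → ℂ} {l a b b' : ℕ} {B : ℝ}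
    (hmM : m ≤ M) (hlk : l < k) (hb : 1 ≤ b) (hbm : b' ≤ m) (hB : 0 ≤ B)
    (h : Bil m φ t co l a b' B) : Bil m φ t co l a b (((p : ℝ) ^ b') ^ 2 * B) := by
  intro ξ η hne I I' hI hI'
  have hTlk := T_lt hlk
  have n1 := Nm_nonneg m φ t co I
  have n2 := Nm_nonneg m φ t co I'
  have hp1 : (1 : ℝ) ≤ (p : ℝ) ^ b' :=
    one_le_pow₀ (by exact_mod_cast (Fact.out (p := p.Prime)).one_lt.le)
  have hne' : ¬ (p : ZMod (p ^ M)) ∣ η - ξ := by rwa [← dvd_neg, neg_sub]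
  set A := parts ((p : ZMod (p ^ M)) ^ b') t I' with hA
  have hpt : ∀ α, ‖F (ex m φ t) co I' α‖ ^ (2 * (T k - T l)) ≤
      ((p : ℝ) ^ b') ^ (2 * (T k - T l)) * ∑ J ∈ A, ‖F (ex m φ t) co J α‖ ^ (2 * (T k - T l)) := by
    intro α
    rw [F_parts (ex m φ t) co ((p : ZMod (p ^ M)) ^ b') t I' α]
    refine (pow_le_pow_left₀ (norm_nonneg _) (norm_sum_le _ _) _).trans ?_
    have := pow_sum_le A (fun J => ‖F (ex m φ t) co J α‖) (fun _ _ => norm_nonneg _) (p ^ b')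
      (2 * (T k - T l)) (card_parts (by omega) t I') (by omega)
    push_cast at this
    exact this
  calc _ ≤ ∑ α, ‖F (ex m φ t) co I α‖ ^ (2 * T l) * (((p : ℝ) ^ b') ^ (2 * (T k - T l)) *
        ∑ J ∈ A, ‖F (ex m φ t) co J α‖ ^ (2 * (T k - T l))) := by
        apply Finset.sum_le_sum; intro α _
        exact mul_le_mul_of_nonneg_left (hpt α) (by positivity)
    _ = ((p : ℝ) ^ b') ^ (2 * (T k - T l)) * ∑ J ∈ A, ∑ α, ‖F (ex m φ t) co I α‖ ^ (2 * T l) *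
        ‖F (ex m φ t) co J α‖ ^ (2 * (T k - T l)) := by
        rw [Finset.sum_comm, Finset.mul_sum]
        apply Finset.sum_congr rfl; intro α _
        rw [Finset.mul_sum, Finset.mul_sum, Finset.mul_sum]
        apply Finset.sum_congr rfl; intro J _
        ring
    _ ≤ ((p : ℝ) ^ b') ^ (2 * (T k - T l)) * ∑ J ∈ A, B ^ (T k) * (Nm m φ t co I ^ (T l) *
          Nm m φ t co J ^ (T k - T l)) := by
        apply mul_le_mul_of_nonneg_left _ (by positivity)
        apply Finset.sum_le_sum; intro J hJ
        obtain ⟨x, hx⟩ := parts_nonempty hJ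
        apply h ξ (t x) _ I J hI (fun y hy => ((mem_parts hJ hx y).1 hy).2)
        have := not_dvd_of hb hne' (hI' x (parts_subset hJ hx))
        rwa [← dvd_neg, neg_sub]
    _ = ((p : ℝ) ^ b') ^ (2 * (T k - T l)) * (B ^ (T k) * (Nm m φ t co I ^ (T l) *
          ∑ J ∈ A, Nm m φ t co J ^ (T k - T l))) := by
        rw [← Finset.mul_sum, ← Finset.mul_sum]
    _ ≤ ((p : ℝ) ^ b') ^ (2 * T k) * (B ^ (T k) * (Nm m φ t co I ^ (T l) *
          Nm m φ t co I' ^ (T k - T l))) := by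
        have e1 : ∑ J ∈ A, Nm m φ t co J ^ (T k - T l) ≤ Nm m φ t co I' ^ (T k - T l) := by
          rw [← Nm_parts m φ t co hbm I']
          exact sum_pow_le A _ (fun _ _ => Nm_nonneg m φ t co _) _ (by omega)
        have e2 : ((p : ℝ) ^ b') ^ (2 * (T k - T l)) ≤ ((p : ℝ) ^ b') ^ (2 * T k) :=
          pow_le_pow_right₀ hp1 (by omega)
        have e3 : 0 ≤ ∑ J ∈ A, Nm m φ t co J ^ (T k - T l) :=
          Finset.sum_nonneg fun J _ => pow_nonneg (Nm_nonneg m φ t co _) _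
        gcongr
    _ = _ := by rw [mul_pow _ B, ← pow_mul]; ring

/-- broad-narrow reduction -/
lemma dec_step {k m M l : ℕ} {D B K : ℝ} (hkm : k * (m + 1) ≤ M) (hM : 1 ≤ M)
    (hkp : k < p) (hlk : l < k) (hD0 : 0 ≤ D) (hB0 : 0 ≤ B) (hK : 1 ≤ K)
    (hD : Dec p k m M D)
    (hB : ∀ φ : Fin k → (ZMod (p ^ M))[X], IsCurve φ → ∀ (t : ZMod (p ^ M) → ZMod (p ^ M))
      (co : ZMod (p ^ M) → ℂ), Bil (m + 1) φ t co l 1 1 B) :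
    Dec p k (m + 1) M ((1 + 1 / K) ^ 2 * D + ((p : ℝ) * (p * (p * K))) ^ 2 * B) := by
  classical
  intro φ hφ t co s
  have hk : 1 ≤ k := by omega
  have hT := T_pos hk
  have hTlk := T_lt hlk
  have hp1 : (1 : ℝ) ≤ p := by exact_mod_cast (Fact.out (p := p.Prime)).one_lt.le
  have hn := Nm_nonneg (m + 1) φ t co s
  set A := parts ((p : ZMod (p ^ M)) ^ 1) t s with hA
  have hcard : A.card ≤ p := by
    have := card_parts (p := p) hM t s
    simpa [hA] using this
  have huv : 2 * T l + 2 * (T k - T l) = 2 * T k := by omega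
  have hpt : ∀ α, ‖F (ex (m + 1) φ t) co s α‖ ^ (2 * T k) ≤
      (1 + 1 / K) ^ (2 * T k) * ∑ J ∈ A, ‖F (ex (m + 1) φ t) co J α‖ ^ (2 * T k) +
      (p * (p * K)) ^ (2 * T k) * ∑ I ∈ A, ∑ J ∈ A.erase I,
        ‖F (ex (m + 1) φ t) co I α‖ ^ (2 * T l) * ‖F (ex (m + 1) φ t) co J α‖ ^ (2 * (T k - T l)) := by
    intro α
    rw [F_parts (ex (m + 1) φ t) co ((p : ZMod (p ^ M)) ^ 1) t s α]
    refine (pow_le_pow_left₀ (norm_nonneg _) (norm_sum_le _ _) _).trans ?_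
    have := broad_narrow A (fun J => ‖F (ex (m + 1) φ t) co J α‖) (fun _ => norm_nonneg _) p
      (Fact.out (p := p.Prime)).one_lt.le hcard K hK (2 * T l) (2 * (T k - T l)) (by omega)
    rwa [huv] at this
  have hsum := Finset.sum_le_sum (s := Finset.univ) (fun α _ => hpt α)
  rw [Finset.sum_add_distrib, ← Finset.mul_sum, ← Finset.mul_sum, Finset.sum_comm,
    Finset.sum_comm (s := Finset.univ) (t := A)] at hsum
  rw [← nrm_pow hT] at hsum
  have h1 : ∑ J ∈ A, ∑ α, ‖F (ex (m + 1) φ t) co J α‖ ^ (2 * T k) ≤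
      (D * Nm (m + 1) φ t co s) ^ T k := by
    rw [← Nm_parts (m + 1) φ t co (by omega : 1 ≤ m + 1) s, Finset.mul_sum]
    refine le_trans ?_ (sum_pow_le A _ (fun J _ => mul_nonneg hD0 (Nm_nonneg (m + 1) φ t co J)) _ hT)
    apply Finset.sum_le_sum
    intro J hJ
    rw [← nrm_pow hT]
    apply pow_le_pow_left₀ (nrm_nonneg _ _)
    obtain ⟨x, hx⟩ := parts_nonempty hJ
    exact rescale hk hM hkm hkp hφ le_rfl (by omega) hD0 hD (t x) J
      (fun y hy => ((mem_parts hJ hx y).1 hy).2)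
  have h2 : ∑ I ∈ A, ∑ α, ∑ J ∈ A.erase I,
        ‖F (ex (m + 1) φ t) co I α‖ ^ (2 * T l) * ‖F (ex (m + 1) φ t) co J α‖ ^ (2 * (T k - T l))
      ≤ (p : ℝ) ^ 2 * (B ^ T k * Nm (m + 1) φ t co s ^ T k) := by
    have e1 : ∀ I ∈ A, ∑ α, ∑ J ∈ A.erase I,
        ‖F (ex (m + 1) φ t) co I α‖ ^ (2 * T l) * ‖F (ex (m + 1) φ t) co J α‖ ^ (2 * (T k - T l))
        ≤ p * (B ^ T k * Nm (m + 1) φ t co s ^ T k) := by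
      intro I hI
      rw [Finset.sum_comm]
      have e2 : ∀ J ∈ A.erase I, ∑ α, ‖F (ex (m + 1) φ t) co I α‖ ^ (2 * T l) *
          ‖F (ex (m + 1) φ t) co J α‖ ^ (2 * (T k - T l)) ≤
          B ^ T k * Nm (m + 1) φ t co s ^ T k := by
        intro J hJ
        obtain ⟨hne, hJ⟩ := Finset.mem_erase.1 hJ
        obtain ⟨x, hx⟩ := parts_nonempty hI
        obtain ⟨y, hy⟩ := parts_nonempty hJ
        refine (hB φ hφ t co (t x) (t y) ?_ I J (fun z hz => ((mem_parts hI hx z).1 hz).2)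
          (fun z hz => ((mem_parts hJ hy z).1 hz).2)).trans ?_
        · intro hd
          apply hne
          apply parts_ext hJ hI (x := x) _ hx
          rw [mem_parts hJ hy]
          exact ⟨parts_subset hI hx, by rwa [pow_one]⟩
        · have g1 := Nm_part_le (m + 1) φ t co (by omega : 1 ≤ m + 1) s hI
          have g2 := Nm_part_le (m + 1) φ t co (by omega : 1 ≤ m + 1) s hJ
          have g3 := Nm_nonneg (m + 1) φ t co I
          have g4 := Nm_nonneg (m + 1) φ t co J
          have : Nm (m + 1) φ t co s ^ T k =
              Nm (m + 1) φ t co s ^ T l * Nm (m + 1) φ t co s ^ (T k - T l) := by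
            rw [← pow_add]; congr 1; omega
          rw [this]
          gcongr
      refine (Finset.sum_le_card_nsmul _ _ _ e2).trans ?_
      rw [nsmul_eq_mul]
      apply mul_le_mul_of_nonneg_right _ (by positivity)
      exact_mod_cast (Finset.card_le_card (Finset.erase_subset _ _)).trans hcard
    refine (Finset.sum_le_card_nsmul _ _ _ e1).trans ?_
    rw [nsmul_eq_mul, pow_two, mul_assoc]
    apply mul_le_mul_of_nonneg_right _ (by positivity)
    exact_mod_cast hcard
  change nrm (T k) (F (ex (m + 1) φ t) co s) ≤ _ * Nm (m + 1) φ t co s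
  rw [← pow_le_pow_iff_left₀ (nrm_nonneg _ _) (by positivity) (by omega : T k ≠ 0)]
  have hp2 : (p : ℝ) ^ 2 ≤ ((p : ℝ) ^ 2) ^ T k := le_self_pow₀ (by nlinarith) (by omega)
  have h2' : (p * (p * K)) ^ (2 * T k) * ((p : ℝ) ^ 2 * (B ^ T k * Nm (m + 1) φ t co s ^ T k))
      ≤ (p * (p * K)) ^ (2 * T k) * (((p : ℝ) ^ 2) ^ T k * (B ^ T k * Nm (m + 1) φ t co s ^ T k)) := by
    gcongr
  have h3 : ((1 + 1 / K) ^ 2 * D * Nm (m + 1) φ t co s) ^ T k +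
      (((p : ℝ) * (p * (p * K))) ^ 2 * B * Nm (m + 1) φ t co s) ^ T k ≤
      (((1 + 1 / K) ^ 2 * D + ((p : ℝ) * (p * (p * K))) ^ 2 * B) * Nm (m + 1) φ t co s) ^ T k := by
    rw [add_mul]
    exact pow_add_pow_le (by positivity) (by positivity) (by omega)
  refine le_trans ?_ h3
  refine hsum.trans (add_le_add ?_ ?_)
  · refine (mul_le_mul_of_nonneg_left h1 (by positivity)).trans (le_of_eq ?_)
    rw [pow_mul, ← mul_pow]; ring
  · refine ((mul_le_mul_of_nonneg_left h2 (by positivity)).trans h2').trans (le_of_eq ?_)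
    rw [pow_mul, ← mul_pow, ← mul_pow, ← mul_pow]; ring

end SFP

namespace SFP
open Finset Polynomial

variable {p : ℕ} [Fact p.Prime]

def DecBound (p k : ℕ) [Fact p.Prime] (η : ℝ) : Prop :=
  ∃ C : ℝ, 1 ≤ C ∧ ∀ m M : ℕ, k * m ≤ M → 1 ≤ M → Dec p k m M (C * (p : ℝ) ^ (η * m))

lemma one_lt_p : (1 : ℝ) < p := by exact_mod_cast (Fact.out (p := p.Prime)).one_lt
lemma p_pos : (0 : ℝ) < p := lt_trans one_pos one_lt_p

lemma one_le_Cp {C e : ℝ} (hC : 1 ≤ C) (he : 0 ≤ e) : 1 ≤ C * (p : ℝ) ^ e := by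
  have := Real.one_le_rpow (one_lt_p (p := p)).le he
  nlinarith

noncomputable def xs (k : ℕ) : ℕ → ℕ → ℝ
  | 0, l => if l = 0 then 1 else 0
  | n + 1, l => if l = 0 then 1 else
      xs k n (k - l) / l + ((k - l : ℕ) : ℝ) / ((k - l : ℕ) + 1) * xs k n (l - 1)

lemma xs_zero (k n : ℕ) : xs k n 0 = 1 := by
  cases n <;> simp [xs]

lemma xs_sum (k n : ℕ) (hk : 2 ≤ k) :
    ∑ l ∈ Finset.Ico 1 k, xs k n l = n * (((k : ℝ) - 1) / k) := by
  induction n with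
  | zero =>
    simp only [CharP.cast_eq_zero, zero_mul]
    apply Finset.sum_eq_zero
    intro l hl
    have := (Finset.mem_Ico.1 hl).1
    simp [xs]; omega
  | succ n ih =>
    have h1 : ∑ l ∈ Finset.Ico 1 k, xs k (n + 1) l = ∑ l ∈ Finset.Ico 1 k, xs k n (k - l) / l +
        ∑ l ∈ Finset.Ico 1 k, ((k - l : ℕ) : ℝ) / ((k - l : ℕ) + 1) * xs k n (l - 1) := by
      rw [← Finset.sum_add_distrib]
      apply Finset.sum_congr rfl; intro l hl
      have := (Finset.mem_Ico.1 hl).1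
      simp only [xs]; rw [if_neg (by omega)]
    have h2 : ∑ l ∈ Finset.Ico 1 k, xs k n (k - l) / l
        = ∑ j ∈ Finset.Ico 1 k, xs k n j / ((k - j : ℕ) : ℝ) := by
      apply Finset.sum_nbij' (fun l => k - l) (fun l => k - l)
      · intro l hl; simp only [Finset.mem_Ico] at hl ⊢; omega
      · intro l hl; simp only [Finset.mem_Ico] at hl ⊢; omega
      · intro l hl; simp only [Finset.mem_Ico] at hl; omega
      · intro l hl; simp only [Finset.mem_Ico] at hl; omega
      · intro l hl; simp only [Finset.mem_Ico] at hl
        rw [show k - (k - l) = l by omega]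
    have h3 : ∑ l ∈ Finset.Ico 1 k, ((k - l : ℕ) : ℝ) / ((k - l : ℕ) + 1) * xs k n (l - 1)
        = ∑ j ∈ Finset.Ico 0 (k - 1), ((k - 1 - j : ℕ) : ℝ) / ((k - 1 - j : ℕ) + 1) * xs k n j := by
      have := Finset.sum_Ico_add' (fun l => ((k - l : ℕ) : ℝ) / ((k - l : ℕ) + 1) * xs k n (l - 1))
        0 (k - 1) 1
      rw [show 0 + 1 = 1 by rfl, show k - 1 + 1 = k by omega] at this
      rw [← this]
      apply Finset.sum_congr rfl; intro j hj
      rw [show k - (j + 1) = k - 1 - j by omega, Nat.add_sub_cancel]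
    have h4 : ∑ j ∈ Finset.Ico 0 (k - 1), ((k - 1 - j : ℕ) : ℝ) / ((k - 1 - j : ℕ) + 1) * xs k n j
        = ∑ j ∈ Finset.Ico 0 k, ((k - 1 - j : ℕ) : ℝ) / ((k - 1 - j : ℕ) + 1) * xs k n j := by
      have := Finset.sum_Ico_succ_top (show 0 ≤ k - 1 by omega)
        (fun j => ((k - 1 - j : ℕ) : ℝ) / ((k - 1 - j : ℕ) + 1) * xs k n j)
      rw [show k - 1 + 1 = k by omega] at this
      rw [this, Nat.sub_self]
      simp
    rw [h1, h2, h3, h4, Finset.sum_eq_sum_Ico_succ_bot (a := 0) (b := k) (by omega), xs_zero, add_left_comm,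
      ← Finset.sum_add_distrib]
    rw [show ∑ x ∈ Finset.Ico (0 + 1) k, (xs k n x / ((k - x : ℕ) : ℝ) +
      ((k - 1 - x : ℕ) : ℝ) / ((k - 1 - x : ℕ) + 1) * xs k n x) = ∑ x ∈ Finset.Ico 1 k, xs k n x from ?_,
      ih]
    · rw [Nat.sub_zero, Nat.cast_sub (by omega)]
      have : (k : ℝ) ≠ 0 := by positivity
      push_cast
      rw [sub_add_cancel]
      field_simp; ring
    · apply Finset.sum_congr rfl; intro j hj
      have hj2 := (Finset.mem_Ico.1 hj).2
      obtain ⟨d, rfl⟩ : ∃ d, k = j + 1 + d := ⟨k - (j + 1), by omega⟩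
      rw [show j + 1 + d - j = d + 1 by omega, show j + 1 + d - 1 - j = d by omega]
      push_cast
      field_simp
      ring

lemma xs_large (k : ℕ) (hk : 2 ≤ k) (Z : ℝ) : ∃ n l, 1 ≤ l ∧ l < k ∧ Z ≤ xs k n l := by
  by_contra hcon
  push Not at hcon
  obtain ⟨n, hn⟩ := exists_nat_gt ((k : ℝ) * |Z| * 2)
  have h1 := xs_sum k n hk
  have h2 : ∑ l ∈ Finset.Ico 1 k, xs k n l ≤ ∑ l ∈ Finset.Ico 1 k, |Z| := by
    apply Finset.sum_le_sum
    intro l hl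
    have h := Finset.mem_Ico.1 hl
    exact (hcon n l h.1 h.2).le.trans (le_abs_self Z)
  rw [Finset.sum_const, Nat.card_Ico, nsmul_eq_mul, h1] at h2
  have h3 : ((k - 1 : ℕ) : ℝ) * |Z| ≤ k * |Z| := by
    apply mul_le_mul_of_nonneg_right _ (abs_nonneg Z)
    exact_mod_cast Nat.sub_le _ _
  have hk2 : (2 : ℝ) ≤ k := by exact_mod_cast hk
  have h4 : (1 : ℝ) / 2 ≤ ((k : ℝ) - 1) / k := by
    rw [div_le_div_iff₀ (by norm_num) (by linarith)]; linarith
  have h5 : (n : ℝ) * (1 / 2) ≤ n * (((k : ℝ) - 1) / k) := by gcongr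
  linarith

def Cl (p k n : ℕ) [Fact p.Prime] (η ε : ℝ) : Prop :=
  ∃ C : ℝ, 1 ≤ C ∧ ∀ m M : ℕ, k * m ≤ M → 1 ≤ M →
    ∀ φ : Fin k → (ZMod (p ^ M))[X], IsCurve φ → ∀ (t : ZMod (p ^ M) → ZMod (p ^ M))
      (co : ZMod (p ^ M) → ℂ) (b : ℕ), 1 ≤ b → k.factorial ^ n ∣ b → k ^ n * b ≤ m →
      ∀ l < k, ∀ a, 1 ≤ a → l * a ≤ (k - l + 1) * b →
        Bil m φ t co l a b (C * (p : ℝ) ^ (η * m - η * xs k n l * b + ε * m))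

lemma cl_bil_zero {k m M : ℕ} {C η ε : ℝ} (hk : 1 ≤ k) (hkp : k < p) (hε : 0 ≤ ε) (hC : 1 ≤ C)
    (hD : ∀ m M : ℕ, k * m ≤ M → 1 ≤ M → Dec p k m M (C * (p : ℝ) ^ (η * m)))
    (hkm : k * m ≤ M) (hM : 1 ≤ M) {φ : Fin k → (ZMod (p ^ M))[X]} (hφ : IsCurve φ)
    (t : ZMod (p ^ M) → ZMod (p ^ M)) (co : ZMod (p ^ M) → ℂ) (b : ℕ) (hb : 1 ≤ b) (hbm : b ≤ m)
    (a : ℕ) : Bil m φ t co 0 a b (C * (p : ℝ) ^ (η * m - η * b + ε * m)) := by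
  have h := hD (m - b) M (le_trans (Nat.mul_le_mul_left k (Nat.sub_le _ _)) hkm) hM
  have hp := p_pos (p := p)
  refine (bil_zero (a := a) hk hM hkm hkp hφ hb (by omega) (by positivity) h).mono_const
    (by positivity) ?_
  have : (0 : ℝ) ≤ ε * m := by positivity
  apply mul_le_mul_of_nonneg_left _ (by linarith)
  apply Real.rpow_le_rpow_of_exponent_le one_lt_p.le
  rw [Nat.cast_sub hbm]; linarith

lemma cl_all {k : ℕ} (hk : 2 ≤ k) (hkp : k < p) {η : ℝ} (hη : DecBound p k η)
    (hlow : ∀ l, 1 ≤ l → l < k → ∀ ε > 0, DecBound p l ε) (n : ℕ) :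
    ∀ ε > 0, Cl p k n η ε := by
  have hp := p_pos (p := p)
  have hp1 := one_lt_p (p := p)
  obtain ⟨C0, hC0, hD⟩ := hη
  induction n with
  | zero =>
    intro ε hε
    refine ⟨C0, hC0, ?_⟩
    intro m M hkm hM φ hφ t co b hb _ hbm l hl a ha _
    have hbm' : b ≤ m := by simpa using hbm
    rcases Nat.eq_zero_or_pos l with h0 | h0
    · subst h0
      rw [xs_zero, mul_one]
      exact cl_bil_zero (by omega) hkp hε.le hC0 hD hkm hM hφ t co b hb hbm' a
    · refine (bil_triv h0 hl hφ (by positivity) (hD m M hkm hM)).mono_const (by positivity) ?_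
      apply mul_le_mul_of_nonneg_left _ (by linarith)
      apply Real.rpow_le_rpow_of_exponent_le hp1.le
      have : xs k 0 l = 0 := by simp [xs]; omega
      rw [this]
      have : (0 : ℝ) ≤ ε * m := by positivity
      linarith
  | succ n ih =>
    intro ε hε
    obtain ⟨C1, hC1, hcl⟩ := ih (ε / 2) (by positivity)
    have hlow' : ∀ l, ∃ C : ℝ, 1 ≤ C ∧ (1 ≤ l → l < k → ∀ m M : ℕ, l * m ≤ M → 1 ≤ M →
        Dec p l m M (C * (p : ℝ) ^ (ε / 2 * m))) := by
      intro l
      by_cases h : 1 ≤ l ∧ l < k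
      · obtain ⟨C, hC, h'⟩ := hlow l h.1 h.2 (ε / 2) (by positivity)
        exact ⟨C, hC, fun _ _ => h'⟩
      · exact ⟨1, le_rfl, fun h1 h2 => absurd ⟨h1, h2⟩ h⟩
    choose Cl hCl hClD using hlow'
    set C2 : ℝ := ∑ l ∈ Finset.range k, Cl l with hC2d
    have hC2 : ∀ l < k, Cl l ≤ C2 := fun l hl =>
      Finset.single_le_sum (f := Cl) (fun i _ => by linarith [hCl i]) (Finset.mem_range.2 hl)
    have hC2' : 1 ≤ C2 := (hCl 0).trans (hC2 0 (by omega))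
    refine ⟨C0 * (C2 * C1), one_le_mul_of_one_le_of_one_le hC0
      (one_le_mul_of_one_le_of_one_le hC2' hC1), ?_⟩
    intro m M hkm hM φ hφ t co b hb hdvd hbm l hl a ha hab
    have hbm0 : b ≤ m := le_trans (Nat.le_mul_of_pos_left b (by positivity)) hbm
    rcases Nat.eq_zero_or_pos l with h0 | h0
    · subst h0
      rw [xs_zero, mul_one]
      refine (cl_bil_zero (by omega) hkp hε.le hC0 hD hkm hM hφ t co b hb hbm0 a).mono_const
        (by positivity) ?_
      apply mul_le_mul_of_nonneg_right _ (by positivity)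
      exact le_mul_of_one_le_right (by linarith) (one_le_mul_of_one_le_of_one_le hC2' hC1)
    obtain ⟨l, rfl⟩ : ∃ l', l = l' + 1 := ⟨l - 1, by omega⟩
    obtain ⟨r, hr⟩ : ∃ r, l + 1 + r = k := ⟨k - (l + 1), by omega⟩
    have hr1 : 1 ≤ r := by omega
    have hkl : k - (l + 1) = r := by omega
    rw [hkl] at hab
    -- the scale a0
    obtain ⟨b', hb'⟩ := hdvd
    obtain ⟨f, hf⟩ : l + 1 ∣ k.factorial := Nat.dvd_factorial (by omega) (by omega)
    set a0 := (r + 1) * (f * k.factorial ^ n * b') with ha0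
    have ha0b : (l + 1) * a0 = (r + 1) * b := by
      rw [ha0, hb', pow_succ]
      conv_rhs => rw [hf]
      rw [hf]; ring
    have ha0pos : 1 ≤ a0 := by
      rcases Nat.eq_zero_or_pos a0 with h | h
      · rw [h] at ha0b; simp at ha0b; omega
      · exact h
    have haa0 : a ≤ a0 := by
      rw [← ha0b] at hab
      exact Nat.le_of_mul_le_mul_left hab (by omega)
    have ha0k : a0 ≤ k * b := by
      have : a0 ≤ (l + 1) * a0 := Nat.le_mul_of_pos_left _ (by omega)
      rw [ha0b] at this
      exact this.trans (Nat.mul_le_mul_right b (by omega))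
    have hna0 : k ^ n * a0 ≤ m := by
      refine le_trans (Nat.mul_le_mul_left _ ha0k) ?_
      rw [← mul_assoc, ← pow_succ]; exact hbm
    have hnb : k ^ n * b ≤ m := by
      refine le_trans ?_ hbm
      rw [pow_succ]
      exact Nat.mul_le_mul_right b (Nat.le_mul_of_pos_right _ (by omega))
    have ha0m : a0 ≤ m := le_trans (Nat.le_mul_of_pos_left a0 (by positivity)) hna0
    have B1 := hcl m M hkm hM φ hφ t co a0 ha0pos ⟨(r + 1) * (f * b'), by rw [ha0]; ring⟩ hna0
      r (by omega) b hb (by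
        rw [show k - r = l + 1 by omega]
        have : r * b ≤ (r + 1) * b := Nat.mul_le_mul_right b (by omega)
        rw [← ha0b] at this
        exact this.trans (Nat.mul_le_mul_right _ (by omega)))
    have B2 := hcl m M hkm hM φ hφ t co b hb ⟨k.factorial * b', by rw [hb', pow_succ]; ring⟩ hnb
      l (by omega) a0 ha0pos (by
        rw [show k - l = r + 1 by omega]
        have : l * a0 ≤ (l + 1) * a0 := Nat.mul_le_mul_right _ (by omega)
        rw [ha0b] at this
        exact this.trans (Nat.mul_le_mul_right _ (by omega)))
    have B3 : Bil m φ t co (l + 1) a0 b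
        (C1 * (p : ℝ) ^ (η * m - η * xs k (n + 1) (l + 1) * b + ε / 2 * m)) := by
      refine Bil.step hr1 hr (by positivity) (by positivity) B1 B2 (le_of_eq ?_) (by positivity)
      rw [mul_pow, mul_pow, pow_succ C1, ← Real.rpow_natCast ((p : ℝ) ^ _),
        ← Real.rpow_natCast ((p : ℝ) ^ _), ← Real.rpow_mul hp.le, ← Real.rpow_mul hp.le]
      rw [mul_mul_mul_comm, ← Real.rpow_add hp, mul_comm C1]
      congr 2
      have hx : xs k (n + 1) (l + 1) = xs k n r / ((l : ℝ) + 1) + (r : ℝ) / (r + 1) * xs k n l := by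
        simp only [xs]; rw [if_neg (by omega), hkl]
        push_cast; simp
      have hq : ((l : ℝ) + 1) * a0 = (r + 1) * b := by exact_mod_cast ha0b
      have ha0' : (a0 : ℝ) = (r + 1) * b / (l + 1) := by
        rw [eq_div_iff (by positivity)]; linarith
      rw [hx, ha0']
      push_cast
      field_simp
      ring
    have hDl := hClD (l + 1) (by omega) hl (a0 - a) M (by
      refine le_trans (Nat.mul_le_mul hl.le ?_) hkm
      omega) hM
    have hK1 : 1 ≤ Cl (l + 1) * (p : ℝ) ^ (ε / 2 * ((a0 - a : ℕ) : ℝ)) :=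
      one_le_Cp (hCl _) (by positivity)
    have B4 := Bil.lower (m' := a0 - a) (n := r) (a := a) hM hkm hkp hφ (by omega) (by omega) ha
      (by omega) hK1 (B := C1 * (p : ℝ) ^ (η * m - η * xs k (n + 1) (l + 1) * b + ε / 2 * m))
      (by positivity) hDl (by
        rw [show a + (a0 - a) = a0 by omega, ha0b]) (by
        rw [show a + (a0 - a) = a0 by omega]; exact B3)
    refine B4.mono_const (by positivity) ?_
    have e1 : (p : ℝ) ^ (ε / 2 * ((a0 - a : ℕ) : ℝ)) ≤ (p : ℝ) ^ (ε / 2 * m) := by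
      apply Real.rpow_le_rpow_of_exponent_le hp1.le
      apply mul_le_mul_of_nonneg_left _ (by positivity)
      exact_mod_cast (by omega : a0 - a ≤ m)
    have e2 : (p : ℝ) ^ (η * m - η * xs k (n + 1) (l + 1) * b + ε * m) =
        (p : ℝ) ^ (ε / 2 * m) * (p : ℝ) ^ (η * m - η * xs k (n + 1) (l + 1) * b + ε / 2 * m) := by
      rw [← Real.rpow_add hp]; congr 1; ring
    rw [e2]
    have e3 := hC2 (l + 1) hl
    have e4 : 0 ≤ Cl (l + 1) := by linarith [hCl (l + 1)]
    calc _ ≤ (C2 * (p : ℝ) ^ (ε / 2 * m)) *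
          (C1 * (p : ℝ) ^ (η * m - η * xs k (n + 1) (l + 1) * b + ε / 2 * m)) := by
          gcongr
      _ = 1 * ((C2 * C1) * ((p : ℝ) ^ (ε / 2 * m) *
          (p : ℝ) ^ (η * m - η * xs k (n + 1) (l + 1) * b + ε / 2 * m))) := by ring
      _ ≤ C0 * ((C2 * C1) * ((p : ℝ) ^ (ε / 2 * m) *
          (p : ℝ) ^ (η * m - η * xs k (n + 1) (l + 1) * b + ε / 2 * m))) := by
          gcongr
      _ = _ := by ring

end SFP

namespace SFP
open Finset Polynomial

variable {p : ℕ} [Fact p.Prime]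

lemma improve {k : ℕ} (hk : 2 ≤ k) (hkp : k < p)
    (hlow : ∀ l, 1 ≤ l → l < k → ∀ ε > 0, DecBound p l ε) (ρ : ℝ) (hρ : 0 < ρ) :
    ∃ c > 0, ∀ η ≥ ρ, DecBound p k η → DecBound p k (max (η - c) ρ) := by
  have hp := p_pos (p := p)
  have hp1 := one_lt_p (p := p)
  obtain ⟨n, l, hl1, hlk, hx⟩ := xs_large k hk (4 / ρ)
  have hkn : (0 : ℝ) < (k : ℝ) ^ n := by positivity
  set c : ℝ := 1 / (k : ℝ) ^ n with hc
  have hc0 : 0 < c := by positivity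
  refine ⟨c, hc0, ?_⟩
  intro η hη hD
  obtain ⟨C, hC, hcl⟩ := cl_all hk hkp hD hlow n c hc0
  set L := k.factorial ^ n with hL
  have hLpos : 0 < L := by positivity
  set Q := k ^ n * L with hQ
  have hQpos : 0 < Q := by positivity
  set σ := max (η - c) ρ with hσ
  have hσρ : ρ ≤ σ := le_max_right _ _
  have hση : η - c ≤ σ := le_max_left _ _
  obtain ⟨K', hK'⟩ := exists_nat_one_div_lt (show (0 : ℝ) < (p : ℝ) ^ (ρ / 4) - 1 by
    have := Real.one_lt_rpow hp1 (show 0 < ρ / 4 by positivity)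
    linarith)
  set K : ℝ := (K' : ℝ) + 1 with hKd
  have hK : 1 ≤ K := by have : (0 : ℝ) ≤ K' := by positivity
                        linarith
  have hKp : (1 + 1 / K) ^ 2 ≤ (p : ℝ) ^ (ρ / 2) := by
    have e : (p : ℝ) ^ (ρ / 2) = ((p : ℝ) ^ (ρ / 4)) ^ 2 := by
      rw [← Real.rpow_natCast, ← Real.rpow_mul hp.le]; congr 1; push_cast; ring
    rw [e]
    apply pow_le_pow_left₀ (by positivity)
    linarith
  set C1 : ℝ := ((p : ℝ) * (p * (p * K))) ^ 2 with hC1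
  set C' : ℝ := C * (p : ℝ) ^ (2 * (L : ℝ)) with hC'
  set θ : ℝ := (p : ℝ) ^ (-(ρ / 2)) with hθ
  have hθ1 : θ < 1 := Real.rpow_lt_one_of_one_lt_of_neg hp1 (by linarith)
  have hθ0 : 0 < θ := by positivity
  have hC1' : 0 ≤ C1 * C' / (1 - θ) := by
    apply div_nonneg (by positivity); linarith
  set A : ℝ := (p : ℝ) ^ (k * Q) + C1 * C' / (1 - θ) with hA
  have hA1 : (1 : ℝ) ≤ (p : ℝ) ^ (k * Q) := one_le_pow₀ hp1.le
  have hA1' : 1 ≤ A := by linarith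
  have hAθ : A * θ + C1 * C' ≤ A := by
    have h1 : C1 * C' / (1 - θ) ≤ A := by linarith
    rw [div_le_iff₀ (by linarith)] at h1
    linarith
  refine ⟨A, hA1', ?_⟩
  intro m M
  induction m with
  | zero =>
    intro _ _
    refine (dec_zero (by omega)).mono ?_
    exact one_le_Cp hA1' (by simp)
  | succ m ih =>
    intro hkm hM
    have hmM : m + 1 ≤ M := le_trans (Nat.le_mul_of_pos_left _ (by omega)) hkm
    by_cases hsm : m + 1 ≤ k * Q
    · refine (dec_triv (by omega) hmM).mono ?_
      have h1 : (p : ℝ) ^ (m + 1) ≤ (p : ℝ) ^ (k * Q) := pow_le_pow_right₀ hp1.le hsm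
      have h2 : A ≤ A * (p : ℝ) ^ (σ * ((m + 1 : ℕ) : ℝ)) :=
        le_mul_of_one_le_right (by linarith) (Real.one_le_rpow hp1.le
          (mul_nonneg (by linarith) (by positivity)))
      linarith
    · push Not at hsm
      have ih' := ih (le_trans (Nat.mul_le_mul_left k (by omega)) hkm) hM
      set b := L * ((m + 1) / Q) with hb
      have hdiv : k ≤ (m + 1) / Q := (Nat.le_div_iff_mul_le hQpos).2 hsm.le
      have hbk : k ≤ b := hdiv.trans (Nat.le_mul_of_pos_left _ hLpos)
      have hkb : k ^ n * b ≤ m + 1 := by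
        rw [hb, ← mul_assoc, ← hQ]; exact Nat.mul_div_le _ _
      have hbm : b ≤ m + 1 := le_trans (Nat.le_mul_of_pos_left b (by positivity)) hkb
      have hblow : c * ((m + 1 : ℕ) : ℝ) - L ≤ b := by
        have h1 : m + 1 ≤ k ^ n * b + k ^ n * L := by
          have h2 := Nat.div_add_mod (m + 1) Q
          have h3 := Nat.mod_lt (m + 1) hQpos
          have h4 : k ^ n * b = Q * ((m + 1) / Q) := by rw [hb, hQ]; ring
          rw [h4, ← hQ]; omega
        have h2 : ((m + 1 : ℕ) : ℝ) ≤ (k : ℝ) ^ n * b + (k : ℝ) ^ n * L := by exact_mod_cast h1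
        rw [hc, one_div, sub_le_iff_le_add, inv_mul_le_iff₀ hkn]
        linarith
      have hBil : ∀ φ : Fin k → (ZMod (p ^ M))[X], IsCurve φ → ∀ (t : ZMod (p ^ M) → ZMod (p ^ M))
          (co : ZMod (p ^ M) → ℂ), Bil (m + 1) φ t co l 1 1
            (C' * (p : ℝ) ^ (σ * ((m + 1 : ℕ) : ℝ))) := by
        intro φ hφ t co
        have h1 := hcl (m + 1) M hkm hM φ hφ t co b (by omega) (Dvd.intro _ rfl) hkb l hlk 1 le_rfl
          (by
            rw [mul_one]
            calc l ≤ k := hlk.le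
              _ ≤ b := hbk
              _ ≤ _ := Nat.le_mul_of_pos_left _ (by omega))
        refine (h1.split hmM hlk le_rfl hbm (by positivity)).mono_const (by positivity) ?_
        have e1 : ((p : ℝ) ^ b) ^ 2 = (p : ℝ) ^ (2 * (b : ℝ)) := by
          rw [← pow_mul, ← Real.rpow_natCast]; congr 1; push_cast; ring
        rw [e1, mul_left_comm, ← Real.rpow_add hp, hC', mul_assoc C, ← Real.rpow_add hp]
        apply mul_le_mul_of_nonneg_left _ (by linarith)
        apply Real.rpow_le_rpow_of_exponent_le hp1.le
        have hηx : 4 ≤ η * xs k n l := by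
          have : ρ * (4 / ρ) = 4 := by field_simp
          calc (4 : ℝ) = ρ * (4 / ρ) := this.symm
            _ ≤ η * xs k n l := mul_le_mul hη hx (by positivity) (by linarith)
        have hb0 : (0 : ℝ) ≤ b := by positivity
        have e2 : 4 * (b : ℝ) ≤ η * xs k n l * b := mul_le_mul_of_nonneg_right hηx hb0
        have e3 : (η - c) * ((m + 1 : ℕ) : ℝ) ≤ σ * ((m + 1 : ℕ) : ℝ) :=
          mul_le_mul_of_nonneg_right hση (by positivity)
        linarith
      refine (dec_step hkm hM hkp hlk (by positivity) (by positivity) hK ih' hBil).mono ?_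
      have e1 : (p : ℝ) ^ (ρ / 2) * (p : ℝ) ^ (σ * (m : ℝ)) ≤ θ * (p : ℝ) ^ (σ * ((m + 1 : ℕ) : ℝ)) := by
        rw [hθ, ← Real.rpow_add hp, ← Real.rpow_add hp]
        apply Real.rpow_le_rpow_of_exponent_le hp1.le
        push_cast; linarith
      have e2 : (1 + 1 / K) ^ 2 * (A * (p : ℝ) ^ (σ * (m : ℝ))) ≤
          A * (θ * (p : ℝ) ^ (σ * ((m + 1 : ℕ) : ℝ))) := by
        calc _ ≤ (p : ℝ) ^ (ρ / 2) * (A * (p : ℝ) ^ (σ * (m : ℝ))) := by gcongr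
          _ = A * ((p : ℝ) ^ (ρ / 2) * (p : ℝ) ^ (σ * (m : ℝ))) := by ring
          _ ≤ _ := by gcongr
      calc _ ≤ A * (θ * (p : ℝ) ^ (σ * ((m + 1 : ℕ) : ℝ))) +
            C1 * (C' * (p : ℝ) ^ (σ * ((m + 1 : ℕ) : ℝ))) := by linarith
        _ = (A * θ + C1 * C') * (p : ℝ) ^ (σ * ((m + 1 : ℕ) : ℝ)) := by ring
        _ ≤ _ := by gcongr

theorem decBound (k : ℕ) (hk : 1 ≤ k) (hkp : k < p) : ∀ ε > 0, DecBound p k ε := by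
  have hp1 := one_lt_p (p := p)
  induction k using Nat.strong_induction_on with
  | _ k ih =>
    intro ε hε
    rcases Nat.lt_or_ge k 2 with h | h
    · obtain rfl : k = 1 := by omega
      refine ⟨1, le_rfl, ?_⟩
      intro m M hm hM
      refine (dec_one (by omega) hM).mono ?_
      exact one_le_Cp le_rfl (by positivity)
    obtain ⟨c, hc, himp⟩ := improve h hkp (fun l h1 h2 => ih l h2 h1 (by omega)) ε hε
    have hstep : ∀ j : ℕ, DecBound p k (max (1 - j * c) ε) := by
      intro j
      induction j with
      | zero =>
        refine ⟨1, le_rfl, ?_⟩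
        intro m M hm hM
        refine (dec_triv hk (le_trans (Nat.le_mul_of_pos_left m (by omega)) hm)).mono ?_
        rw [one_mul, ← Real.rpow_natCast]
        apply Real.rpow_le_rpow_of_exponent_le hp1.le
        have : (1 : ℝ) ≤ max (1 - ((0 : ℕ) : ℝ) * c) ε := by
          refine le_trans ?_ (le_max_left _ _); simp
        exact le_mul_of_one_le_left (by positivity) this
      | succ j ihj =>
        have h1 := himp _ (le_max_right _ _) ihj
        convert h1 using 1
        push_cast
        rcases le_total (1 - (j : ℝ) * c) ε with h2 | h2
        · rw [max_eq_right h2, max_eq_right (by linarith), max_eq_right (by linarith)]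
        · rw [max_eq_left h2]; congr 1; ring
    obtain ⟨j, hj⟩ := exists_nat_gt (1 / c)
    have := hstep j
    rwa [max_eq_right] at this
    rw [div_lt_iff₀ hc] at hj
    linarith

end SFP

namespace SFP
open Finset Polynomial

variable {p : ℕ} [Fact p.Prime]

lemma char_orth {ι : Type*} [Fintype ι] [DecidableEq ι] (q : ι → ℕ) [∀ i, NeZero (q i)]
    (v : ∀ i, ZMod (q i)) :
    ∑ c : (∀ i, ZMod (q i)), ∏ i, (ZMod.stdAddChar (c i * v i) : ℂ) =
      if v = 0 then ((∏ i, q i : ℕ) : ℂ) else 0 := by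
  have h := Finset.prod_univ_sum (fun i => (Finset.univ : Finset (ZMod (q i))))
    (fun i x => (ZMod.stdAddChar (x * v i) : ℂ))
  rw [Fintype.piFinset_univ] at h
  rw [← h]
  have h2 : ∀ i, ∑ x : ZMod (q i), (ZMod.stdAddChar (x * v i) : ℂ) =
      if v i = 0 then (q i : ℂ) else 0 := by
    intro i
    rw [AddChar.sum_mulShift (v i) (ZMod.isPrimitive_stdAddChar (q i)), ZMod.card]
    split_ifs <;> simp
  simp only [h2]
  split_ifs with hv
  · subst hv; simp
  · have : ∃ i, v i ≠ 0 := by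
      by_contra hh; push Not at hh; exact hv (funext hh)
    obtain ⟨i, hi⟩ := this
    exact Finset.prod_eq_zero (Finset.mem_univ i) (by simp [hi])

/-- solutions of the system attached to `w` -/
noncomputable def sols {X A : Type*} [AddCommMonoid A] (D : ℕ) (s : Finset X) (w : X → A) :
    Finset ((Fin D → X) × (Fin D → X)) := by
  classical
  exact ((Fintype.piFinset fun _ : Fin D => s) ×ˢ (Fintype.piFinset fun _ : Fin D => s)).filter
    (fun z => ∑ j, w (z.1 j) = ∑ j, w (z.2 j))

lemma mem_sols {X A : Type*} [AddCommMonoid A] {D : ℕ} {s : Finset X} {w : X → A}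
    {z : (Fin D → X) × (Fin D → X)} : z ∈ sols D s w ↔
      ((∀ j, z.1 j ∈ s) ∧ (∀ j, z.2 j ∈ s)) ∧ ∑ j, w (z.1 j) = ∑ j, w (z.2 j) := by
  classical
  unfold sols
  simp [Fintype.mem_piFinset]

lemma stdAddChar_sum {κ : Type*} (t : Finset κ) {n : ℕ} [NeZero n] (g : κ → ZMod n) :
    ∏ j ∈ t, (ZMod.stdAddChar (g j) : ℂ) = ZMod.stdAddChar (∑ j ∈ t, g j) := by
  classical
  induction t using Finset.induction_on with
  | empty => simp
  | insert a t ha ih =>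
    rw [Finset.prod_insert ha, Finset.sum_insert ha, ih, AddChar.map_add_eq_mul]

lemma expand {ι X : Type*} [Fintype ι] [DecidableEq ι] (q : ι → ℕ) [∀ i, NeZero (q i)]
    (D : ℕ) (s : Finset X) (w : X → ∀ i, ZMod (q i)) (a : X → ℂ) :
    ((∑ c : (∀ i, ZMod (q i)),
      ‖∑ x ∈ s, a x * ∏ i, (ZMod.stdAddChar (c i * w x i) : ℂ)‖ ^ (2 * D) : ℝ) : ℂ) =
    ((∏ i, q i : ℕ) : ℂ) *
      ∑ z ∈ sols D s w, (∏ j, a (z.1 j)) * (∏ j, (starRingEnd ℂ) (a (z.2 j))) := by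
  classical
  have h1 : ∀ c : (∀ i, ZMod (q i)),
      ((‖∑ x ∈ s, a x * ∏ i, (ZMod.stdAddChar (c i * w x i) : ℂ)‖ ^ (2 * D) : ℝ) : ℂ) =
      ∑ z ∈ (Fintype.piFinset fun _ : Fin D => s) ×ˢ (Fintype.piFinset fun _ : Fin D => s),
        ((∏ j, a (z.1 j)) * (∏ j, (starRingEnd ℂ) (a (z.2 j)))) *
        ∏ i, (ZMod.stdAddChar (c i * (∑ j, w (z.1 j) - ∑ j, w (z.2 j)) i) : ℂ) := by
    intro c
    set S := ∑ x ∈ s, a x * ∏ i, (ZMod.stdAddChar (c i * w x i) : ℂ) with hS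
    have e : ((‖S‖ ^ (2 * D) : ℝ) : ℂ) = S ^ D * ((starRingEnd ℂ) S) ^ D := by
      rw [← mul_pow, Complex.mul_conj, Complex.normSq_eq_norm_sq]
      push_cast
      rw [pow_mul]
    rw [e, hS, map_sum, Finset.sum_pow', Finset.sum_pow', Finset.sum_mul_sum, Finset.sum_product]
    refine Finset.sum_congr rfl fun x _ => Finset.sum_congr rfl fun y _ => ?_
    simp only [map_mul, map_prod, Finset.prod_mul_distrib]
    rw [mul_mul_mul_comm]
    congr 1
    rw [Finset.prod_comm, Finset.prod_comm (s := (Finset.univ : Finset (Fin D))),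
      ← Finset.prod_mul_distrib]
    refine Finset.prod_congr rfl fun i _ => ?_
    simp only [← AddChar.map_neg_eq_conj]
    rw [stdAddChar_sum, stdAddChar_sum, ← AddChar.map_add_eq_mul]
    congr 1
    simp only [Pi.sub_apply, Finset.sum_apply, mul_sub, Finset.mul_sum, Finset.sum_neg_distrib]
    ring
  rw [Complex.ofReal_sum]
  simp only [h1]
  rw [Finset.sum_comm]
  simp only [← Finset.mul_sum, char_orth]
  unfold sols
  rw [Finset.sum_filter, Finset.mul_sum]
  refine Finset.sum_congr rfl fun z _ => ?_
  by_cases hz : ∑ j, w (z.1 j) = ∑ j, w (z.2 j)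
  · rw [if_pos (sub_eq_zero.2 hz), if_pos hz, mul_comm]
  · rw [if_neg (fun h => hz (sub_eq_zero.1 h)), if_neg hz]; simp

lemma expand_le {ι X : Type*} [Fintype ι] [DecidableEq ι] (q : ι → ℕ) [∀ i, NeZero (q i)]
    (D : ℕ) (s : Finset X) (w : X → ∀ i, ZMod (q i)) (a : X → ℂ) (ha : ∀ x, ‖a x‖ ≤ 1) :
    ∑ c : (∀ i, ZMod (q i)),
      ‖∑ x ∈ s, a x * ∏ i, (ZMod.stdAddChar (c i * w x i) : ℂ)‖ ^ (2 * D) ≤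
    ((∏ i, q i : ℕ) : ℝ) * (sols D s w).card := by
  have h := congrArg (fun z : ℂ => ‖z‖) (expand q D s w a)
  simp only [Complex.norm_real, norm_mul, Complex.norm_natCast] at h
  rw [Real.norm_of_nonneg (Finset.sum_nonneg fun _ _ => by positivity)] at h
  rw [h]
  apply mul_le_mul_of_nonneg_left _ (by positivity)
  refine (norm_sum_le _ _).trans ?_
  refine (Finset.sum_le_card_nsmul _ _ 1 ?_).trans (by simp)
  intro z _
  rw [norm_mul, norm_prod, norm_prod]
  refine mul_le_one₀ (Finset.prod_le_one (fun _ _ => norm_nonneg _) fun _ _ => ha _)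
    (Finset.prod_nonneg fun _ _ => norm_nonneg _)
    (Finset.prod_le_one (fun _ _ => norm_nonneg _) fun _ _ => ?_)
  rw [RCLike.norm_conj]; exact ha _

lemma expand_one {ι X : Type*} [Fintype ι] [DecidableEq ι] (q : ι → ℕ) [∀ i, NeZero (q i)]
    (D : ℕ) (s : Finset X) (w : X → ∀ i, ZMod (q i)) :
    ∑ c : (∀ i, ZMod (q i)),
      ‖∑ x ∈ s, ∏ i, (ZMod.stdAddChar (c i * w x i) : ℂ)‖ ^ (2 * D) =
    ((∏ i, q i : ℕ) : ℝ) * (sols D s w).card := by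
  have h := expand q D s w (fun _ => 1)
  simp only [one_mul, map_one, Finset.prod_const_one, mul_one, Finset.sum_const, nsmul_eq_mul] at h
  exact_mod_cast h

/-- Vinogradov mean value -/
noncomputable def VJ (d D N : ℕ) : ℕ :=
  (sols D (Finset.range N) (fun (n : ℕ) (i : Fin d) => n ^ ((i : ℕ) + 1))).card

lemma VJ_le (d D N : ℕ) (q : Fin d → ℕ) :
    VJ d D N ≤ (sols D (Finset.range N)
      (fun (n : ℕ) (i : Fin d) => (n : ZMod (q i)) ^ ((i : ℕ) + 1))).card := by
  classical
  apply Finset.card_le_card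
  intro z hz
  rw [mem_sols] at hz ⊢
  refine ⟨hz.1, ?_⟩
  funext i
  have h := congrFun hz.2 i
  simp only [Finset.sum_apply] at h ⊢
  exact_mod_cast congrArg (fun n : ℕ => (n : ZMod (q i))) h

lemma le_VJ (d D N : ℕ) (q : Fin d → ℕ) (hq : ∀ i : Fin d, D * N ^ ((i : ℕ) + 1) < q i) :
    (sols D (Finset.range N)
      (fun (n : ℕ) (i : Fin d) => (n : ZMod (q i)) ^ ((i : ℕ) + 1))).card ≤ VJ d D N := by
  classical
  apply Finset.card_le_card
  intro z hz
  rw [mem_sols] at hz ⊢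
  refine ⟨hz.1, ?_⟩
  funext i
  have h := congrFun hz.2 i
  simp only [Finset.sum_apply] at h ⊢
  have hb : ∀ x : Fin D → ℕ, (∀ j, x j ∈ Finset.range N) →
      ∑ j, x j ^ ((i : ℕ) + 1) < q i := by
    intro x hx
    refine lt_of_le_of_lt ?_ (hq i)
    refine (Finset.sum_le_card_nsmul _ _ (N ^ ((i : ℕ) + 1)) ?_).trans (by simp)
    intro j _
    exact Nat.pow_le_pow_left (Finset.mem_range.1 (hx j)).le _
  have h2 : ((∑ j, z.1 j ^ ((i : ℕ) + 1) : ℕ) : ZMod (q i)) =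
      ((∑ j, z.2 j ^ ((i : ℕ) + 1) : ℕ) : ZMod (q i)) := by push_cast; exact h
  rw [ZMod.natCast_eq_natCast_iff'] at h2
  have hz1 := hz.1
  rwa [Nat.mod_eq_of_lt (hb _ hz1.1), Nat.mod_eq_of_lt (hb _ hz1.2)] at h2

lemma grid_moment (d D N : ℕ) (q : Fin d → ℕ) [∀ i, NeZero (q i)]
    (hq : ∀ i : Fin d, D * N ^ ((i : ℕ) + 1) < q i) (a : ℕ → ℂ) (ha : ∀ x, ‖a x‖ ≤ 1) :
    ∑ c : (∀ i, ZMod (q i)), ‖∑ n ∈ Finset.range N, a n *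
      ∏ i, (ZMod.stdAddChar (c i * (n : ZMod (q i)) ^ ((i : ℕ) + 1)) : ℂ)‖ ^ (2 * D) ≤
    ((∏ i, q i : ℕ) : ℝ) * VJ d D N := by
  refine (expand_le q D (Finset.range N)
    (fun (n : ℕ) (i : Fin d) => (n : ZMod (q i)) ^ ((i : ℕ) + 1)) a ha).trans ?_
  gcongr
  exact le_VJ d D N q hq

end SFP

namespace SFP
open Finset Polynomial

variable {p : ℕ} [Fact p.Prime]

lemma parts_range_single {m M N : ℕ} (hm : m ≤ M) (hN : N ≤ p ^ m)
    {J : Finset (ZMod (p ^ M))}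
    (hJ : J ∈ parts ((p : ZMod (p ^ M)) ^ m) id ((Finset.range N).image (fun n : ℕ => (n : ZMod (p ^ M)))))
    {x y : ZMod (p ^ M)} (hx : x ∈ J) (hy : y ∈ J) : x = y := by
  have hd := ((mem_parts hJ hx y).1 hy).2
  have hx' := parts_subset hJ hx
  have hy' := parts_subset hJ hy
  obtain ⟨n, hn, rfl⟩ := Finset.mem_image.1 hx'
  obtain ⟨n', hn', rfl⟩ := Finset.mem_image.1 hy'
  simp only [id] at hd
  have h2 := map_dvd (ZMod.castHom (pow_dvd_pow p hm) (ZMod (p ^ m))) hd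
  simp only [map_sub, map_natCast, map_pow] at h2
  have h0 : (p : ZMod (p ^ m)) ^ m = 0 := p_pow_zero le_rfl
  rw [h0, zero_dvd_iff, sub_eq_zero] at h2
  rw [ZMod.natCast_eq_natCast_iff', Nat.mod_eq_of_lt ((Finset.mem_range.1 hn').trans_le hN),
    Nat.mod_eq_of_lt ((Finset.mem_range.1 hn).trans_le hN)] at h2
  rw [h2]


lemma VJ_pow_le {d m M N : ℕ} (hd : 1 ≤ d) (hm : 1 ≤ m) (hM : M = d * m) (hN : N ≤ p ^ m) {K : ℝ}
    (hK : 0 ≤ K) (h : Dec p d m M K) : (VJ d (T d) N : ℝ) ≤ (K * (p : ℝ) ^ m) ^ T d := by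
  classical
  have hmM : m ≤ M := by rw [hM]; exact Nat.le_mul_of_pos_left _ (by omega)
  have hD : 1 ≤ T d := T_pos hd
  have hinj : Set.InjOn (fun n : ℕ => (n : ZMod (p ^ M))) (Finset.range N : Set ℕ) := by
    intro a ha b hb hab
    have hNM : N ≤ p ^ M := hN.trans (Nat.pow_le_pow_right (Fact.out (p := p.Prime)).pos hmM)
    simp only at hab
    rw [ZMod.natCast_eq_natCast_iff', Nat.mod_eq_of_lt ((Finset.mem_range.1 ha).trans_le hNM),
      Nat.mod_eq_of_lt ((Finset.mem_range.1 hb).trans_le hNM)] at hab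
    exact hab
  set s := (Finset.range N).image (fun n : ℕ => (n : ZMod (p ^ M))) with hs
  set φ : Fin d → (ZMod (p ^ M))[X] := fun i => X ^ ((i : ℕ) + 1) with hφ
  have hcurve : IsCurve φ := fun i => ⟨0, by simp [hφ]⟩
  have hdec := h φ hcurve id (fun _ => 1) s
  set P : ℝ := ((∏ _i : Fin d, p ^ M : ℕ) : ℝ) with hP
  have hPpos : 0 < P := by
    rw [hP]; exact_mod_cast Finset.prod_pos fun _ _ => pow_pos (Fact.out (p := p.Prime)).pos M
  have hJ : ∀ J ∈ parts ((p : ZMod (p ^ M)) ^ m) id s,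
      nrm (T d) (F (ex m φ id) (fun _ => 1) J) ≤ P ^ (1 / (T d : ℝ)) := by
    intro J hJ
    unfold nrm
    apply Real.rpow_le_rpow (Finset.sum_nonneg fun _ _ => by positivity) _ (by positivity)
    have h1 : ∀ α, ‖F (ex m φ id) (fun _ => 1) J α‖ ^ (2 * T d) ≤ 1 := by
      intro α
      apply pow_le_one₀ (norm_nonneg _)
      obtain ⟨x, hx⟩ := parts_nonempty hJ
      have : J = {x} := by
        apply Finset.eq_singleton_iff_unique_mem.2 ⟨hx, fun y hy => ?_⟩
        exact parts_range_single hmM hN hJ hy hx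
      rw [this]
      simp [F, ex, AddChar.norm_apply]
    refine (Finset.sum_le_card_nsmul _ _ 1 fun α _ => h1 α).trans ?_
    rw [hP]
    simp [ZMod.card]
  have hL : P * VJ d (T d) N ≤ (nrm (T d) (F (ex m φ id) (fun _ => 1) s)) ^ T d := by
    rw [nrm_pow hD]
    have he := expand_one (fun _ : Fin d => p ^ M) (T d) (Finset.range N)
      (fun (n : ℕ) (i : Fin d) => (n : ZMod (p ^ M)) ^ ((i : ℕ) + 1))
    have hV := VJ_le d (T d) N (fun _ : Fin d => p ^ M)
    calc P * VJ d (T d) N ≤ P * (sols (T d) (Finset.range N)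
          (fun (n : ℕ) (i : Fin d) => (n : ZMod (p ^ M)) ^ ((i : ℕ) + 1))).card := by
          gcongr
      _ = _ := he.symm
      _ = _ := by
        refine Finset.sum_congr rfl fun α _ => ?_
        congr 2
        unfold F
        rw [hs, Finset.sum_image hinj]
        refine Finset.sum_congr rfl fun n _ => ?_
        rw [stdAddChar_sum]
        simp [ex, hφ, hM]
  have hR : nrm (T d) (F (ex m φ id) (fun _ => 1) s) ≤ K * ((p : ℝ) ^ m * P ^ (1 / (T d : ℝ))) := by
    refine hdec.trans (mul_le_mul_of_nonneg_left ?_ hK)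
    refine (Finset.sum_le_card_nsmul _ _ _ hJ).trans ?_
    rw [nsmul_eq_mul]
    gcongr
    exact_mod_cast card_parts hmM id s
  have hR2 := pow_le_pow_left₀ (nrm_nonneg _ _) hR (T d)
  rw [← mul_assoc, mul_pow, rpow_inv_pow hPpos.le hD] at hR2
  have := hL.trans hR2
  rw [mul_comm] at this
  exact le_of_mul_le_mul_right this hPpos

theorem VJ_bound (d : ℕ) (hd : 1 ≤ d) (η : ℝ) (hη : 0 < η) : ∃ C : ℝ, 1 ≤ C ∧ ∀ N : ℕ, 1 ≤ N →
    (VJ d (T d) N : ℝ) ≤ C * (N : ℝ) ^ ((T d : ℝ) + η) := by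
  obtain ⟨p, hdp, hp⟩ := Nat.exists_infinite_primes (d + 1)
  haveI : Fact p.Prime := ⟨hp⟩
  have hD : 1 ≤ T d := T_pos hd
  have hD' : (0 : ℝ) < T d := by exact_mod_cast hD
  obtain ⟨C, hC, hdec⟩ := decBound (p := p) d hd (by omega) (η / T d) (by positivity)
  have hp1 := one_lt_p (p := p)
  have hp0 := p_pos (p := p)
  refine ⟨C ^ T d * (p : ℝ) ^ ((T d : ℝ) + η), ?_, ?_⟩
  · exact one_le_mul_of_one_le_of_one_le (one_le_pow₀ hC)
      (Real.one_le_rpow hp1.le (by positivity))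
  intro N hN
  set m := Nat.log p N + 1 with hm
  have h1 : N ≤ p ^ m := (Nat.lt_pow_succ_log_self hp.one_lt N).le
  have h2 : (p : ℝ) ^ m ≤ p * N := by
    rw [hm, pow_succ, mul_comm]
    gcongr
    exact_mod_cast Nat.pow_log_le_self p (by omega)
  have h3 := VJ_pow_le hd (by omega) rfl h1 (by positivity)
    (hdec m (d * m) le_rfl (Nat.mul_pos (by omega) (by omega)))
  refine h3.trans ?_
  rw [mul_assoc, mul_pow, mul_assoc]
  gcongr
  rw [← Real.mul_rpow hp0.le (by positivity)]
  have e : ((p : ℝ) ^ (η / T d * m) * (p : ℝ) ^ m) ^ T d = ((p : ℝ) ^ m) ^ ((T d : ℝ) + η) := by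
    rw [← Real.rpow_natCast (p : ℝ) m, ← Real.rpow_add hp0, ← Real.rpow_natCast,
      ← Real.rpow_mul hp0.le, ← Real.rpow_mul hp0.le]
    congr 1
    field_simp
    ring
  rw [e]
  exact Real.rpow_le_rpow (by positivity) h2 (by positivity)

end SFP

namespace SFP
open Finset Polynomial

lemma nd_nonneg (x : ℝ) : 0 ≤ nearestIntDist x := abs_nonneg _
lemma nd_le (x : ℝ) (z : ℤ) : nearestIntDist x ≤ |x - z| := round_le x z
lemma nd_add (x y : ℝ) : nearestIntDist (x + y) ≤ nearestIntDist x + nearestIntDist y := by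
  refine (nd_le (x + y) (round x + round y)).trans ?_
  unfold nearestIntDist
  refine le_trans (le_of_eq ?_) (abs_add_le _ _)
  push_cast; congr 1; ring
lemma nd_neg (x : ℝ) : nearestIntDist (-x) ≤ nearestIntDist x := by
  refine (nd_le (-x) (-round x)).trans ?_
  unfold nearestIntDist
  rw [← abs_neg]; push_cast; apply le_of_eq; congr 1; ring
lemma nd_sub (x y : ℝ) : nearestIntDist (x - y) ≤ nearestIntDist x + nearestIntDist y := by
  rw [sub_eq_add_neg]
  exact (nd_add _ _).trans (by linarith [nd_neg y])
lemma nd_mul (n : ℕ) (x : ℝ) : nearestIntDist (n * x) ≤ n * nearestIntDist x := by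
  refine (nd_le (n * x) (n * round x)).trans ?_
  unfold nearestIntDist
  push_cast
  rw [← mul_sub, abs_mul, Nat.abs_cast]
lemma nd_zero : nearestIntDist 0 = 0 := by simp [nearestIntDist]
lemma nd_sum {ι : Type*} (s : Finset ι) (g : ι → ℝ) : nearestIntDist (∑ i ∈ s, g i) ≤ ∑ i ∈ s, nearestIntDist (g i) := by
  classical
  induction s using Finset.induction_on with
  | empty => simp [nd_zero]
  | insert a t ha ih =>
    rw [Finset.sum_insert ha, Finset.sum_insert ha]
    exact (nd_add _ _).trans (by linarith)

/-- `e(x)` -/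
noncomputable def ee (x : ℝ) : ℂ := Complex.exp (Complex.I * ((2 * Real.pi * x : ℝ) : ℂ))

lemma ee_add (x y : ℝ) : ee (x + y) = ee x * ee y := by
  unfold ee; rw [← Complex.exp_add]; congr 1; push_cast; ring
lemma ee_zero : ee 0 = 1 := by simp [ee]
lemma ee_norm (x : ℝ) : ‖ee x‖ = 1 := by
  unfold ee; rw [mul_comm]; exact Complex.norm_exp_ofReal_mul_I _
lemma ee_int (z : ℤ) : ee z = 1 := by
  unfold ee
  rw [Complex.exp_eq_one_iff]
  exact ⟨z, by push_cast; ring⟩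
lemma ee_neg (x : ℝ) : ee (-x) = (starRingEnd ℂ) (ee x) := by
  unfold ee
  rw [← Complex.exp_conj]
  congr 1
  rw [map_mul, Complex.conj_I, Complex.conj_ofReal]; push_cast; ring
lemma ee_nat_mul (n : ℕ) (x : ℝ) : ee (n * x) = ee x ^ n := by
  unfold ee
  rw [← Complex.exp_nat_mul]; congr 1; push_cast; ring
lemma ee_sub (x y : ℝ) : ee (x - y) = ee x * (starRingEnd ℂ) (ee y) := by
  rw [sub_eq_add_neg, ee_add, ee_neg]
lemma ee_lip (x y : ℝ) : ‖ee x - ee y‖ ≤ 2 * Real.pi * |x - y| := by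
  have h : ee x - ee y = ee y * (ee (x - y) - 1) := by
    rw [mul_sub, ← ee_add]; simp
  rw [h, norm_mul, ee_norm, one_mul]
  refine (Real.norm_exp_I_mul_ofReal_sub_one_le).trans ?_
  rw [Real.norm_eq_abs, abs_mul, abs_of_pos (by positivity : (0:ℝ) < 2 * Real.pi)]
lemma ee_lower (x : ℝ) : 4 * nearestIntDist x ≤ ‖ee x - 1‖ := by
  set u := x - round x with hu
  have h1 : ee x = ee u := by
    have : x = u + (round x : ℤ) := by rw [hu]; ring
    conv_lhs => rw [this, ee_add, ee_int, mul_one]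
  have hu2 : |u| ≤ 1 / 2 := abs_sub_round x
  have hpi := Real.pi_pos
  rw [h1]
  unfold ee nearestIntDist
  rw [Complex.norm_exp_I_mul_ofReal_sub_one, ← hu, norm_mul, Real.norm_eq_abs, Real.norm_eq_abs]
  have e : 2 * Real.pi * u / 2 = Real.pi * u := by ring
  rw [e]
  have h2 := Real.mul_abs_le_abs_sin (x := Real.pi * u) (by
    rw [abs_mul, abs_of_pos hpi]; nlinarith)
  rw [abs_mul, abs_of_pos hpi] at h2
  have h3 : 2 / Real.pi * (Real.pi * |u|) = 2 * |u| := by field_simp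
  rw [h3] at h2
  rw [abs_of_pos (by norm_num : (0:ℝ) < 2)]
  linarith
lemma ee_std (q : ℕ) [NeZero q] (j : ℤ) : (ZMod.stdAddChar (j : ZMod q) : ℂ) = ee ((j : ℝ) / q) := by
  rw [ZMod.stdAddChar_coe]
  unfold ee
  congr 1; push_cast; ring

lemma geom_bound {H θ : ℝ} (hH : 0 < H) (h : 1 / H < nearestIntDist θ) (L : ℕ) :
    ‖∑ j ∈ Finset.range L, ee (j * θ)‖ ≤ H / 2 := by
  have h1 := ee_lower θ
  have h2 : (0:ℝ) < 1 / H := by positivity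
  have h3 : 0 < ‖ee θ - 1‖ := by linarith
  simp only [ee_nat_mul]
  have h4 := geom_sum_mul (ee θ) L
  have h5 := congrArg (fun z : ℂ => ‖z‖) h4
  simp only [norm_mul] at h5
  have h6 : ‖ee θ ^ L - 1‖ ≤ 2 := by
    refine (norm_sub_le _ _).trans ?_
    rw [norm_pow, ee_norm]; norm_num
  rw [← h5] at h6
  have h7 : 4 / H ≤ ‖ee θ - 1‖ := by
    have : 4 / H = 4 * (1 / H) := by ring
    linarith
  have h8 : ‖∑ i ∈ Finset.range L, ee θ ^ i‖ * (4 / H) ≤ 2 :=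
    (mul_le_mul_of_nonneg_left h7 (norm_nonneg _)).trans h6
  rw [mul_div_assoc', div_le_iff₀ hH] at h8
  linarith

lemma energy_lower (L : ℕ) (hL : 1 ≤ L) :
    (L : ℝ) ^ 3 / 2 ≤ (Finset.addEnergy (Finset.range L) (Finset.range L) : ℝ) := by
  open scoped Pointwise in
  have h := Finset.le_card_add_mul_addEnergy (Finset.range L) (Finset.range L)
  have h2 : (Finset.range L + Finset.range L).card ≤ 2 * L := by
    rw [← Finset.card_range (2 * L)]
    apply Finset.card_le_card
    intro x hx
    obtain ⟨a, ha, b, hb, rfl⟩ := Finset.mem_add.1 hx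
    rw [Finset.mem_range] at *
    omega
  rw [Finset.card_range] at h
  have h3 := h.trans (Nat.mul_le_mul_right _ h2)
  have h4 : (L : ℝ) ^ 2 * (L : ℝ) ^ 2 ≤ 2 * L * (Finset.addEnergy (Finset.range L) (Finset.range L) : ℝ) := by
    exact_mod_cast h3
  have hL' : (0 : ℝ) < L := by exact_mod_cast hL
  have h5 : (2 * (L : ℝ)) * ((L : ℝ) ^ 3 / 2) ≤
      2 * L * (Finset.addEnergy (Finset.range L) (Finset.range L) : ℝ) := by
    refine le_trans (le_of_eq ?_) h4; ring
  exact le_of_mul_le_mul_left h5 (by positivity)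

lemma detect {ι : Type*} (s : Finset ι) (θ : ι → ℝ) (H : ℝ) (L : ℕ) (hL : 1 ≤ L) (hH : 0 < H)
    (hHL : H ^ 4 < 4 * (L : ℝ) ^ 3) (hs : s.Nonempty) (hθ : ∀ n ∈ s, 1 / H < nearestIntDist (θ n)) :
    ∃ h : ℕ, 1 ≤ h ∧ h < 2 * L ∧ (s.card : ℝ) / (4 * L) ≤ ‖∑ n ∈ s, ee (h * θ n)‖ := by
  by_contra hcon
  push Not at hcon
  set R := (Finset.range L ×ˢ Finset.range L) ×ˢ (Finset.range L ×ˢ Finset.range L) with hR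
  set g : (ℕ × ℕ) × (ℕ × ℕ) → ℂ := fun x =>
    ∑ n ∈ s, ee (((x.1.1 : ℝ) + x.2.1 - x.1.2 - x.2.2) * θ n) with hg
  have hL' : (0 : ℝ) < L := by exact_mod_cast hL
  have hs' : (0 : ℝ) < s.card := by exact_mod_cast hs.card_pos
  have hsum : ∑ x ∈ R, g x = ((∑ n ∈ s, ‖∑ j ∈ Finset.range L, ee (j * θ n)‖ ^ 4 : ℝ) : ℂ) := by
    rw [hg, Finset.sum_comm, Complex.ofReal_sum]
    refine Finset.sum_congr rfl fun n _ => ?_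
    set S := ∑ j ∈ Finset.range L, ee (j * θ n) with hS
    have e : ((‖S‖ ^ 4 : ℝ) : ℂ) = (S * (starRingEnd ℂ) S) * (S * (starRingEnd ℂ) S) := by
      rw [Complex.mul_conj, Complex.normSq_eq_norm_sq]; push_cast; ring
    rw [e, hS, map_sum, Finset.sum_mul_sum, ← Finset.sum_product', Finset.sum_mul_sum,
      ← Finset.sum_product']
    refine Finset.sum_congr rfl fun x _ => ?_
    rw [← ee_sub, ← ee_sub, ← ee_add]
    congr 1; ring
  have hup : ‖∑ x ∈ R, g x‖ ≤ s.card * (H / 2) ^ 4 := by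
    rw [hsum, Complex.norm_real, Real.norm_of_nonneg (Finset.sum_nonneg fun _ _ => by positivity)]
    refine (Finset.sum_le_card_nsmul _ _ ((H / 2) ^ 4) ?_).trans (by rw [nsmul_eq_mul])
    intro n hn
    exact pow_le_pow_left₀ (norm_nonneg _) (geom_bound hH (hθ n hn) L) 4
  rw [← Finset.sum_filter_add_sum_filter_not R (fun x => x.1.1 + x.2.1 = x.1.2 + x.2.2)] at hup
  have h1 : ∑ x ∈ R.filter (fun x => x.1.1 + x.2.1 = x.1.2 + x.2.2), g x =
      (((Finset.addEnergy (Finset.range L) (Finset.range L) : ℝ) * s.card : ℝ) : ℂ) := by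
    have : ∀ x ∈ R.filter (fun x => x.1.1 + x.2.1 = x.1.2 + x.2.2), g x = (s.card : ℂ) := by
      intro x hx
      have hx2 := (Finset.mem_filter.1 hx).2
      have hx3 : (x.1.1 : ℝ) + x.2.1 - x.1.2 - x.2.2 = 0 := by
        have : (x.1.1 : ℝ) + x.2.1 = x.1.2 + x.2.2 := by exact_mod_cast hx2
        linarith
      simp [hg, hx3, ee_zero]
    rw [Finset.sum_congr rfl this, Finset.sum_const, nsmul_eq_mul]
    push_cast
    rfl
  have h2 : ‖∑ x ∈ R.filter (fun x => ¬ (x.1.1 + x.2.1 = x.1.2 + x.2.2)), g x‖ ≤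
      (L : ℝ) ^ 4 * (s.card / (4 * L)) := by
    refine (norm_sum_le _ _).trans ?_
    refine (Finset.sum_le_card_nsmul _ _ ((s.card : ℝ) / (4 * L)) ?_).trans ?_
    · intro x hx
      rw [Finset.mem_filter, hR] at hx
      simp only [Finset.mem_product, Finset.mem_range] at hx
      obtain ⟨⟨⟨a1, a2⟩, a3, a4⟩, hne⟩ := hx
      rcases lt_or_gt_of_ne hne with hlt | hlt
      · have := hcon (x.1.2 + x.2.2 - (x.1.1 + x.2.1)) (by omega) (by omega)
        refine le_trans (le_of_eq ?_) this.le
        rw [← RCLike.norm_conj, hg, map_sum]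
        congr 1
        refine Finset.sum_congr rfl fun n _ => ?_
        rw [← ee_neg, Nat.cast_sub hlt.le]
        congr 1; push_cast; ring
      · have := hcon (x.1.1 + x.2.1 - (x.1.2 + x.2.2)) (by omega) (by omega)
        refine le_trans (le_of_eq ?_) this.le
        rw [hg]
        congr 1
        refine Finset.sum_congr rfl fun n _ => ?_
        rw [Nat.cast_sub hlt.le]
        congr 1; push_cast; ring
    · rw [nsmul_eq_mul]
      apply mul_le_mul_of_nonneg_right _ (by positivity)
      have : (R.filter (fun x => ¬ (x.1.1 + x.2.1 = x.1.2 + x.2.2))).card ≤ L ^ 4 := by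
        refine (Finset.card_filter_le _ _).trans (le_of_eq ?_)
        rw [hR]; simp only [Finset.card_product, Finset.card_range]; ring
      exact_mod_cast this
  have h3 := energy_lower L hL
  rw [h1] at hup
  have h4 : (Finset.addEnergy (Finset.range L) (Finset.range L) : ℝ) * s.card ≤
      s.card * (H / 2) ^ 4 + (L : ℝ) ^ 4 * (s.card / (4 * L)) := by
    have := norm_sub_norm_le
      ((((Finset.addEnergy (Finset.range L) (Finset.range L) : ℝ) * s.card : ℝ) : ℂ))
      (-(∑ x ∈ R.filter (fun x => ¬ (x.1.1 + x.2.1 = x.1.2 + x.2.2)), g x))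
    rw [sub_neg_eq_add, norm_neg, Complex.norm_real, Real.norm_of_nonneg (by positivity)] at this
    linarith
  have h5 : (L : ℝ) ^ 4 * (s.card / (4 * L)) = s.card * ((L : ℝ) ^ 3 / 4) := by
    field_simp
  rw [h5, ← mul_add, mul_comm] at h4
  have h6 := le_of_mul_le_mul_left h4 hs'
  have h7 : (H / 2) ^ 4 = H ^ 4 / 16 := by ring
  rw [h7] at h6
  linarith

end SFP

namespace SFP
open Finset Polynomial

/-- Taylor coefficients -/
noncomputable def be (d : ℕ) (γ : ℕ → ℝ) (j y : ℕ) : ℝ :=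
  ∑ i ∈ Finset.Icc 1 (d + 1), γ i * (i.choose j : ℝ) * (y : ℝ) ^ (i - j)

lemma taylor (d : ℕ) (γ : ℕ → ℝ) (n y : ℕ) :
    ∑ i ∈ Finset.Icc 1 (d + 1), γ i * ((n + y : ℕ) : ℝ) ^ i =
      be d γ 0 y + ∑ j : Fin d, be d γ ((j : ℕ) + 1) y * (n : ℝ) ^ ((j : ℕ) + 1) +
        γ (d + 1) * (n : ℝ) ^ (d + 1) := by
  have h1 : ∀ i ∈ Finset.Icc 1 (d + 1), γ i * ((n + y : ℕ) : ℝ) ^ i =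
      ∑ j ∈ Finset.range (d + 2), γ i * (i.choose j : ℝ) * (y : ℝ) ^ (i - j) * (n : ℝ) ^ j := by
    intro i hi
    rw [Finset.mem_Icc] at hi
    push_cast
    rw [add_pow, Finset.mul_sum]
    have : Finset.range (i + 1) ⊆ Finset.range (d + 2) := Finset.range_mono (by omega)
    rw [← Finset.sum_subset this]
    · refine Finset.sum_congr rfl fun j _ => by ring
    · intro j _ hj
      rw [Nat.choose_eq_zero_of_lt (by simpa using hj)]; simp
  rw [Finset.sum_congr rfl h1, Finset.sum_comm]
  have h2 : ∀ j, ∑ i ∈ Finset.Icc 1 (d + 1), γ i * (i.choose j : ℝ) * (y : ℝ) ^ (i - j) * (n : ℝ) ^ j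
      = be d γ j y * (n : ℝ) ^ j := by
    intro j; rw [be, Finset.sum_mul]
  simp only [h2]
  rw [Finset.sum_range_succ, Finset.sum_range_succ',
    Fin.sum_univ_eq_sum_range (fun j => be d γ (j + 1) y * (n : ℝ) ^ (j + 1))]
  have h3 : be d γ (d + 1) y = γ (d + 1) := by
    unfold be
    rw [Finset.sum_eq_single (d + 1)]
    · simp
    · intro i hi hne
      rw [Finset.mem_Icc] at hi
      rw [Nat.choose_eq_zero_of_lt (by omega)]; simp
    · intro h; simp at h
  rw [h3]; simp; ring

lemma ee_sum {κ : Type*} (t : Finset κ) (g : κ → ℝ) : ∏ j ∈ t, ee (g j) = ee (∑ j ∈ t, g j) := by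
  classical
  induction t using Finset.induction_on with
  | empty => simp [ee_zero]
  | insert a t ha ih => rw [Finset.prod_insert ha, Finset.sum_insert ha, ih, ee_add]

/-- grid code -/
noncomputable def code (d : ℕ) (γ : ℕ → ℝ) (q : Fin d → ℕ) (y : ℕ) : ∀ i, ZMod (q i) :=
  fun i => ((round ((q i : ℝ) * be d γ ((i : ℕ) + 1) y) : ℤ) : ZMod (q i))

lemma code_near (d : ℕ) (γ : ℕ → ℝ) (q : Fin d → ℕ) (hq : ∀ i, 0 < q i) (y y' : ℕ)
    (h : code d γ q y = code d γ q y') (i : Fin d) :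
    nearestIntDist (be d γ ((i : ℕ) + 1) y' - be d γ ((i : ℕ) + 1) y) ≤ 1 / (q i : ℝ) := by
  have h1 := congrFun h i
  unfold code at h1
  rw [ZMod.intCast_eq_intCast_iff_dvd_sub] at h1
  obtain ⟨m, hm⟩ := h1
  have hm' : (round ((q i : ℝ) * be d γ ((i : ℕ) + 1) y') : ℝ) -
      round ((q i : ℝ) * be d γ ((i : ℕ) + 1) y) = q i * m := by exact_mod_cast hm
  refine (nd_le _ m).trans ?_
  have hq' : (0 : ℝ) < q i := by exact_mod_cast hq i
  have h2 := abs_sub_round ((q i : ℝ) * be d γ ((i : ℕ) + 1) y')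
  have h3 := abs_sub_round ((q i : ℝ) * be d γ ((i : ℕ) + 1) y)
  rw [le_div_iff₀ hq', ← abs_of_pos hq', ← abs_mul]
  rw [abs_le] at *
  constructor <;> nlinarith

lemma grid_lower (d D L N : ℕ) (hd : d ≤ D) (hD : 1 ≤ D) (hL : 1 ≤ L) (hN : 1 ≤ N) (γ : ℕ → ℝ)
    (q : Fin d → ℕ) [∀ i, NeZero (q i)] (hq : ∀ i : Fin d, q i = 32 * D * L * N ^ ((i : ℕ) + 1))
    (y : ℕ)
    (hy : (N : ℝ) / (4 * L) ≤ ‖∑ n ∈ Finset.range N,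
      ee (∑ i ∈ Finset.Icc 1 (d + 1), γ i * ((n + y : ℕ) : ℝ) ^ i)‖) :
    (N : ℝ) / (8 * L) ≤ ‖∑ n ∈ Finset.range N, ee (γ (d + 1) * (n : ℝ) ^ (d + 1)) *
      ∏ i, (ZMod.stdAddChar (code d γ q y i * (n : ZMod (q i)) ^ ((i : ℕ) + 1)) : ℂ)‖ := by
  have hL' : (0 : ℝ) < L := by exact_mod_cast hL
  have hN' : (0 : ℝ) < N := by exact_mod_cast hN
  have hD' : (1 : ℝ) ≤ D := by exact_mod_cast hD
  have hdD : (d : ℝ) ≤ D := by exact_mod_cast hd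
  set r : Fin d → ℝ := fun i => (round ((q i : ℝ) * be d γ ((i : ℕ) + 1) y) : ℝ) with hr
  have hterm : ∀ n : ℕ, ∏ i, (ZMod.stdAddChar (code d γ q y i * (n : ZMod (q i)) ^ ((i : ℕ) + 1)) : ℂ)
      = ee (∑ i : Fin d, r i / q i * (n : ℝ) ^ ((i : ℕ) + 1)) := by
    intro n
    rw [← ee_sum]
    refine Finset.prod_congr rfl fun i _ => ?_
    have : code d γ q y i * (n : ZMod (q i)) ^ ((i : ℕ) + 1) =
        ((round ((q i : ℝ) * be d γ ((i : ℕ) + 1) y) * (n : ℤ) ^ ((i : ℕ) + 1) : ℤ) : ZMod (q i)) := by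
      unfold code; push_cast; rfl
    rw [this, ee_std]
    congr 1
    rw [hr]; push_cast; ring
  simp only [hterm, ← ee_add]
  simp only [taylor] at hy
  have h1 : ∑ n ∈ Finset.range N, ee (be d γ 0 y +
      ∑ j : Fin d, be d γ ((j : ℕ) + 1) y * (n : ℝ) ^ ((j : ℕ) + 1) + γ (d + 1) * (n : ℝ) ^ (d + 1)) =
      ee (be d γ 0 y) * ∑ n ∈ Finset.range N, ee (γ (d + 1) * (n : ℝ) ^ (d + 1) +
        ∑ j : Fin d, be d γ ((j : ℕ) + 1) y * (n : ℝ) ^ ((j : ℕ) + 1)) := by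
    rw [Finset.mul_sum]
    refine Finset.sum_congr rfl fun n _ => ?_
    rw [← ee_add]; congr 1; ring
  rw [h1, norm_mul, ee_norm, one_mul] at hy
  have h2 : ‖∑ n ∈ Finset.range N, ee (γ (d + 1) * (n : ℝ) ^ (d + 1) +
        ∑ j : Fin d, be d γ ((j : ℕ) + 1) y * (n : ℝ) ^ ((j : ℕ) + 1)) -
      ∑ n ∈ Finset.range N, ee (γ (d + 1) * (n : ℝ) ^ (d + 1) +
        ∑ i : Fin d, r i / q i * (n : ℝ) ^ ((i : ℕ) + 1))‖ ≤ N / (8 * L) := by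
    rw [← Finset.sum_sub_distrib]
    refine (norm_sum_le _ _).trans ?_
    refine (Finset.sum_le_card_nsmul _ _ (1 / (8 * (L : ℝ))) ?_).trans (le_of_eq ?_)
    · intro n hn
      refine (ee_lip _ _).trans ?_
      rw [add_sub_add_left_eq_sub, ← Finset.sum_sub_distrib]
      have h3 : ∀ i ∈ (Finset.univ : Finset (Fin d)),
          |be d γ ((i : ℕ) + 1) y * (n : ℝ) ^ ((i : ℕ) + 1) - r i / q i * (n : ℝ) ^ ((i : ℕ) + 1)| ≤
          1 / (64 * D * L) := by
        intro i _
        have hqi : (q i : ℝ) = 32 * D * L * (N : ℝ) ^ ((i : ℕ) + 1) := by rw [hq i]; push_cast; ring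
        have hqp : (0 : ℝ) < q i := by rw [hqi]; positivity
        have e : be d γ ((i : ℕ) + 1) y * (n : ℝ) ^ ((i : ℕ) + 1) - r i / q i * (n : ℝ) ^ ((i : ℕ) + 1) =
          ((q i : ℝ) * be d γ ((i : ℕ) + 1) y - r i) * ((n : ℝ) ^ ((i : ℕ) + 1) / q i) := by
          field_simp
        rw [e, abs_mul, abs_of_nonneg (by positivity : (0 : ℝ) ≤ (n : ℝ) ^ ((i : ℕ) + 1) / q i)]
        have h5 : (n : ℝ) ^ ((i : ℕ) + 1) / q i ≤ 1 / (32 * D * L) := by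
          rw [hqi, div_le_div_iff₀ (by positivity) (by positivity), one_mul, mul_comm]
          apply mul_le_mul_of_nonneg_left _ (by positivity)
          apply pow_le_pow_left₀ (by positivity)
          exact_mod_cast (Finset.mem_range.1 hn).le
        calc _ ≤ (1 / 2) * (1 / (32 * (D : ℝ) * L)) :=
              mul_le_mul (abs_sub_round _) h5 (by positivity) (by norm_num)
          _ = _ := by field_simp; norm_num
      have h4 := (Finset.abs_sum_le_sum_abs _ _).trans (Finset.sum_le_card_nsmul _ _ _ h3)
      rw [Finset.card_univ, Fintype.card_fin, nsmul_eq_mul] at h4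
      calc _ ≤ 2 * Real.pi * ((d : ℝ) * (1 / (64 * D * L))) := by gcongr
        _ ≤ 2 * 4 * ((D : ℝ) * (1 / (64 * D * L))) := by
          gcongr
          exact Real.pi_le_four
        _ = _ := by field_simp; norm_num
    · rw [Finset.card_range, nsmul_eq_mul]; ring
  have h5 := norm_sub_norm_le (∑ n ∈ Finset.range N, ee (γ (d + 1) * (n : ℝ) ^ (d + 1) +
        ∑ j : Fin d, be d γ ((j : ℕ) + 1) y * (n : ℝ) ^ ((j : ℕ) + 1)))
      (∑ n ∈ Finset.range N, ee (γ (d + 1) * (n : ℝ) ^ (d + 1) +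
        ∑ i : Fin d, r i / q i * (n : ℝ) ^ ((i : ℕ) + 1)))
  have h6 : (N : ℝ) / (4 * L) = N / (8 * L) + N / (8 * L) := by field_simp; norm_num
  linarith

lemma grid_count (d D L N : ℕ) (hd : d ≤ D) (hD : 1 ≤ D) (hL : 1 ≤ L) (hN : 1 ≤ N) (γ : ℕ → ℝ)
    (q : Fin d → ℕ) [∀ i, NeZero (q i)] (hq : ∀ i : Fin d, q i = 32 * D * L * N ^ ((i : ℕ) + 1))
    (W : Finset (∀ i, ZMod (q i)))
    (hW : ∀ c ∈ W, ∃ y : ℕ, c = code d γ q y ∧ (N : ℝ) / (4 * L) ≤ ‖∑ n ∈ Finset.range N,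
      ee (∑ i ∈ Finset.Icc 1 (d + 1), γ i * ((n + y : ℕ) : ℝ) ^ i)‖) :
    (W.card : ℝ) * ((N : ℝ) / (8 * L)) ^ (2 * D) ≤ ((∏ i, q i : ℕ) : ℝ) * VJ d D N := by
  refine le_trans ?_ (grid_moment d D N q ?_ (fun n => ee (γ (d + 1) * (n : ℝ) ^ (d + 1)))
    (fun _ => (ee_norm _).le))
  · rw [← nsmul_eq_mul]
    refine le_trans (Finset.card_nsmul_le_sum W _ _ ?_)
      (Finset.sum_le_sum_of_subset_of_nonneg (Finset.subset_univ W) fun _ _ _ => by positivity)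
    intro c hc
    obtain ⟨y, rfl, hy⟩ := hW c hc
    exact pow_le_pow_left₀ (by positivity) (grid_lower d D L N hd hD hL hN γ q hq y hy) _
  · intro i
    rw [hq i]
    have : 0 < N ^ ((i : ℕ) + 1) := by positivity
    have h2 : D < 32 * D * L := by nlinarith
    exact Nat.mul_lt_mul_of_pos_right h2 this

lemma prod_q (d Q N : ℕ) : ∏ i : Fin d, Q * N ^ ((i : ℕ) + 1) = Q ^ d * N ^ T d := by
  rw [Finset.prod_mul_distrib, Finset.prod_const, Finset.card_univ, Fintype.card_fin,
    Finset.prod_pow_eq_pow_sum]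
  congr 2
  rw [Fin.sum_univ_eq_sum_range (fun i => i + 1)]
  have h := two_T d
  have : ∀ d : ℕ, 2 * ∑ i ∈ Finset.range d, (i + 1) = d * (d + 1) := by
    intro d
    induction d with
    | zero => simp
    | succ d ih => rw [Finset.sum_range_succ, mul_add, ih]; ring
  have := this d
  omega

lemma two_close (d D L N : ℕ) (hd : d ≤ D) (hD : 1 ≤ D) (hL : 1 ≤ L) (hN : 1 ≤ N) (γ : ℕ → ℝ)
    (Y : Finset ℕ) (hYN : Y ⊆ Finset.Icc 1 N) (hYc : N ≤ 2 * L * Y.card)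
    (hY : ∀ y ∈ Y, (N : ℝ) / (4 * L) ≤ ‖∑ n ∈ Finset.range N,
      ee (∑ i ∈ Finset.Icc 1 (d + 1), γ i * ((n + y : ℕ) : ℝ) ^ i)‖)
    (A : ℝ) (hA : (((32 * D * L) ^ d * N ^ T d : ℕ) : ℝ) * VJ d D N ≤ A * ((N : ℝ) / (8 * L)) ^ (2 * D))
    (Z : ℕ) (hZ : 4 * L * A < Z) (hZ1 : 1 ≤ Z) (hZN : Z ≤ N) :
    ∃ y z : ℕ, 1 ≤ z ∧ z < Z ∧ y + z ≤ N ∧ ∀ j, 1 ≤ j → j ≤ d →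
      nearestIntDist (be d γ j (y + z) - be d γ j y) ≤ 1 / (N : ℝ) ^ j := by
  classical
  have hL' : (0 : ℝ) < L := by exact_mod_cast hL
  have hN' : (0 : ℝ) < N := by exact_mod_cast hN
  have hZ' : (0 : ℝ) < Z := by exact_mod_cast hZ1
  set q : Fin d → ℕ := fun i => 32 * D * L * N ^ ((i : ℕ) + 1) with hq
  have hqp : ∀ i, 0 < q i := fun i => by rw [hq]; positivity
  have : ∀ i, NeZero (q i) := fun i => ⟨(hqp i).ne'⟩
  set W := Y.image (code d γ q) with hW
  have h1 := grid_count d D L N hd hD hL hN γ q (fun i => rfl) W (by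
    intro c hc
    obtain ⟨y, hy, rfl⟩ := Finset.mem_image.1 hc
    exact ⟨y, rfl, hY y hy⟩)
  rw [prod_q] at h1
  have h2 : (W.card : ℝ) ≤ A := le_of_mul_le_mul_right (h1.trans hA) (by positivity)
  have hcard : (W ×ˢ Finset.range (N / Z + 1)).card < Y.card := by
    rw [Finset.card_product, Finset.card_range]
    have h3 : ((N / Z + 1 : ℕ) : ℝ) ≤ 2 * N / Z := by
      push_cast
      have e1 : ((N / Z : ℕ) : ℝ) ≤ N / Z := Nat.cast_div_le
      have e2 : (1 : ℝ) ≤ N / Z := by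
        rw [le_div_iff₀ hZ', one_mul]; exact_mod_cast hZN
      have e3 : 2 * (N : ℝ) / Z = N / Z + N / Z := by ring
      linarith
    have h4 : (W.card : ℝ) * ((N / Z + 1 : ℕ) : ℝ) < Y.card := by
      have h5 : (W.card : ℝ) * ((N / Z + 1 : ℕ) : ℝ) ≤ A * (2 * N / Z) :=
        mul_le_mul h2 h3 (by positivity) (le_trans (by positivity) h2)
      refine lt_of_le_of_lt h5 ?_
      have h6 : (N : ℝ) ≤ 2 * L * Y.card := by exact_mod_cast hYc
      rw [mul_div_assoc', div_lt_iff₀ hZ']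
      have hYp : (0 : ℝ) < Y.card := by
        by_contra hh; push Not at hh; nlinarith
      have h7 : A * (2 * N) ≤ A * (2 * (2 * L * Y.card)) := by
        have : 0 ≤ A := le_trans (by positivity) h2
        gcongr
      nlinarith
    exact_mod_cast h4
  obtain ⟨y, hy, y', hy', hne, heq⟩ := Finset.exists_ne_map_eq_of_card_lt_of_maps_to hcard
    (f := fun y => (code d γ q y, y / Z)) (by
      intro y hy
      have := Finset.mem_Icc.1 (hYN hy)
      simp only [Finset.coe_product, Set.mem_prod, Finset.mem_coe, Finset.mem_range]
      exact ⟨Finset.mem_image_of_mem _ hy, Nat.lt_succ_of_le (Nat.div_le_div_right this.2)⟩)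
  have key : ∀ y ∈ Y, ∀ y' ∈ Y, y < y' → (code d γ q y, y / Z) = (code d γ q y', y' / Z) →
      ∃ y z : ℕ, 1 ≤ z ∧ z < Z ∧ y + z ≤ N ∧ ∀ j, 1 ≤ j → j ≤ d →
      nearestIntDist (be d γ j (y + z) - be d γ j y) ≤ 1 / (N : ℝ) ^ j := by
    intro y hy y' hy' hlt heq
    obtain ⟨e1, e2⟩ := Prod.mk.inj heq
    refine ⟨y, y' - y, by omega, ?_, ?_, ?_⟩
    · have a1 := Nat.div_add_mod y Z
      have a2 := Nat.div_add_mod y' Z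
      have a3 := Nat.mod_lt y' hZ1
      rw [e2] at a1
      omega
    · have := Finset.mem_Icc.1 (hYN hy'); omega
    · intro j hj1 hjd
      rw [Nat.add_sub_cancel' hlt.le]
      have := code_near d γ q hqp y y' e1 ⟨j - 1, by omega⟩
      simp only [Nat.sub_add_cancel hj1] at this
      refine this.trans ?_
      apply one_div_le_one_div_of_le (by positivity)
      rw [hq]; simp only [Nat.sub_add_cancel hj1]
      have : N ^ j ≤ 32 * D * L * N ^ j := Nat.le_mul_of_pos_left _ (by positivity)
      exact_mod_cast this
  rcases lt_or_gt_of_ne hne with hlt | hlt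
  · exact key y hy y' hy' hlt heq
  · exact key y' hy' y hy hlt heq.symm

end SFP

namespace SFP
open Finset Polynomial

lemma pow_diff (m y z N : ℕ) (h : y + z ≤ N) :
    ∃ w : ℕ, (y + z) ^ m = y ^ m + z * w ∧ w * N ≤ m * N ^ m := by
  induction m with
  | zero => exact ⟨0, by simp, by simp⟩
  | succ m ih =>
    obtain ⟨w, h1, h2⟩ := ih
    refine ⟨y ^ m + w * (y + z), ?_, ?_⟩
    · rw [pow_succ, h1]; ring_nf
    · have h3 : y ^ m ≤ N ^ m := Nat.pow_le_pow_left (by omega) m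
      calc (y ^ m + w * (y + z)) * N = y ^ m * N + w * N * (y + z) := by ring
        _ ≤ N ^ m * N + m * N ^ m * N := by gcongr
        _ = _ := by ring

lemma be_diff (d : ℕ) (γ : ℕ → ℝ) (j y z : ℕ) (hj : j + 1 ≤ d + 1) :
    be d γ j (y + z) - be d γ j y = ((j + 1 : ℕ) : ℝ) * (γ (j + 1) * z) +
      ∑ i ∈ Finset.Icc (j + 2) (d + 1), γ i * (i.choose j : ℝ) *
        (((y + z : ℕ) : ℝ) ^ (i - j) - (y : ℝ) ^ (i - j)) := by
  unfold be
  rw [← Finset.sum_sub_distrib]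
  have e : ∀ i, γ i * (i.choose j : ℝ) * ((y + z : ℕ) : ℝ) ^ (i - j) -
      γ i * (i.choose j : ℝ) * (y : ℝ) ^ (i - j) = γ i * (i.choose j : ℝ) *
        (((y + z : ℕ) : ℝ) ^ (i - j) - (y : ℝ) ^ (i - j)) := fun i => by ring
  simp only [e]
  have hsub : Finset.Icc (j + 1) (d + 1) ⊆ Finset.Icc 1 (d + 1) :=
    Finset.Icc_subset_Icc (by omega) le_rfl
  rw [← Finset.sum_subset hsub]
  · rw [← Finset.add_sum_Ioc_eq_sum_Icc hj]
    congr 1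
    · rw [Nat.choose_succ_self_right]
      simp; ring
    · refine Finset.sum_congr ?_ fun _ _ => rfl
      ext x; simp only [Finset.mem_Ioc, Finset.mem_Icc]; omega
  · intro i hi hi2
    rw [Finset.mem_Icc] at hi hi2
    rcases Nat.lt_or_ge i j with h | h
    · rw [Nat.choose_eq_zero_of_lt h]; simp
    · have : i = j := by omega
      subst this; simp

lemma descend (d : ℕ) (r : ℕ) : ∃ P : ℕ, 1 ≤ P ∧ ∃ E : ℝ, 1 ≤ E ∧ ∀ (γ : ℕ → ℝ) (N y z : ℕ),
    1 ≤ N → y + z ≤ N →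
    (∀ j, 1 ≤ j → j ≤ d → nearestIntDist (be d γ j (y + z) - be d γ j y) ≤ 1 / (N : ℝ) ^ j) →
    ∀ i, 1 ≤ i → i ≤ d → d < i + r → nearestIntDist (P * (γ (i + 1) * z)) ≤ E / (N : ℝ) ^ i := by
  induction r with
  | zero => exact ⟨1, le_rfl, 1, le_rfl, fun γ N y z _ _ _ i _ _ _ => by omega⟩
  | succ r ih =>
    obtain ⟨P, hP, E, hE, h⟩ := ih
    rcases Nat.lt_or_ge r d with hr | hr
    swap
    · exact ⟨P, hP, E, hE, fun γ N y z h1 h2 h3 i hi1 hi2 hi3 => h γ N y z h1 h2 h3 i hi1 hi2 (by omega)⟩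
    obtain ⟨j, hj⟩ : ∃ j, j = d - r := ⟨_, rfl⟩
    have hE0 : 0 ≤ E := by linarith
    refine ⟨(j + 1) * P, by nlinarith, P + ((j + 1 : ℕ) : ℝ) * E + (d + 1) * (2 ^ (d + 1) * (d + 1) * E),
      ?_, ?_⟩
    · have : (1 : ℝ) ≤ P := by exact_mod_cast hP
      have : 0 ≤ ((j + 1 : ℕ) : ℝ) * E + (d + 1) * (2 ^ (d + 1) * (d + 1) * E) := by positivity
      linarith
    intro γ N y z hN hyz hnear i hi1 hi2 hi3
    have hN' : (0 : ℝ) < N := by exact_mod_cast hN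
    rcases Nat.lt_or_ge d (i + r) with hc | hc
    · have h1 := h γ N y z hN hyz hnear i hi1 hi2 hc
      have e : (((j + 1) * P : ℕ) : ℝ) * (γ (i + 1) * z) = ((j + 1 : ℕ) : ℝ) * (P * (γ (i + 1) * z)) := by
        push_cast; ring
      rw [e]
      refine (nd_mul _ _).trans ?_
      refine (mul_le_mul_of_nonneg_left h1 (by positivity)).trans ?_
      rw [mul_div_assoc']
      gcongr
      have : 0 ≤ (P : ℝ) + (d + 1) * (2 ^ (d + 1) * (d + 1) * E) := by positivity
      linarith
    · have hij : i = j := by omega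
      subst hij
      have hd := be_diff d γ i y z (by omega)
      have e : (((i + 1) * P : ℕ) : ℝ) * (γ (i + 1) * z) = P * (be d γ i (y + z) - be d γ i y) -
          ∑ l ∈ Finset.Icc (i + 2) (d + 1), P * (γ l * (l.choose i : ℝ) *
            (((y + z : ℕ) : ℝ) ^ (l - i) - (y : ℝ) ^ (l - i))) := by
        rw [hd, ← Finset.mul_sum]; push_cast; ring
      rw [e]
      refine (nd_sub _ _).trans ?_
      have h1 : nearestIntDist (P * (be d γ i (y + z) - be d γ i y)) ≤ P / (N : ℝ) ^ i := by
        refine (nd_mul _ _).trans ?_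
        refine (mul_le_mul_of_nonneg_left (hnear i hi1 hi2) (by positivity)).trans (le_of_eq ?_)
        ring
      have h2 : nearestIntDist (∑ l ∈ Finset.Icc (i + 2) (d + 1), P * (γ l * (l.choose i : ℝ) *
            (((y + z : ℕ) : ℝ) ^ (l - i) - (y : ℝ) ^ (l - i)))) ≤
            (d + 1) * (2 ^ (d + 1) * (d + 1) * E / (N : ℝ) ^ i) := by
        refine (nd_sum _ _).trans ?_
        refine (Finset.sum_le_card_nsmul _ _ (2 ^ (d + 1) * (d + 1) * E / (N : ℝ) ^ i) ?_).trans ?_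
        · intro l hl
          rw [Finset.mem_Icc] at hl
          obtain ⟨w, hw1, hw2⟩ := pow_diff (l - i) y z N hyz
          have hw1' : ((y + z : ℕ) : ℝ) ^ (l - i) - (y : ℝ) ^ (l - i) = z * w := by
            have : ((y + z : ℕ) : ℝ) ^ (l - i) = (y : ℝ) ^ (l - i) + z * w := by exact_mod_cast hw1
            linarith
          have e2 : P * (γ l * (l.choose i : ℝ) *
            (((y + z : ℕ) : ℝ) ^ (l - i) - (y : ℝ) ^ (l - i))) =
            ((l.choose i * w : ℕ) : ℝ) * (P * (γ (l - 1 + 1) * z)) := by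
            rw [hw1', Nat.sub_add_cancel (by omega : 1 ≤ l)]; push_cast; ring
          rw [e2]
          refine (nd_mul _ _).trans ?_
          have h3 := h γ N y z hN hyz hnear (l - 1) (by omega) (by omega) (by omega)
          refine (mul_le_mul_of_nonneg_left h3 (by positivity)).trans ?_
          have e3 : l - 1 = i + (l - i - 1) := by omega
          rw [e3, pow_add, mul_div_assoc', div_le_div_iff₀ (by positivity) (by positivity)]
          have hc1 : (l.choose i : ℝ) ≤ 2 ^ (d + 1) := by
            have : l.choose i ≤ 2 ^ (d + 1) :=
              (Nat.choose_le_two_pow l i).trans (Nat.pow_le_pow_right (by norm_num) hl.2)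
            exact_mod_cast this
          have hw3 : (w : ℝ) ≤ (d + 1) * (N : ℝ) ^ (l - i - 1) := by
            have h5 : (w : ℝ) * N ≤ (l - i : ℕ) * (N : ℝ) ^ (l - i) := by exact_mod_cast hw2
            have h6 : ((l - i : ℕ) : ℝ) ≤ d + 1 := by
              have : l - i ≤ d + 1 := by omega
              exact_mod_cast this
            have e4 : l - i = (l - i - 1) + 1 := by omega
            have h7 : (w : ℝ) * N ≤ ((d + 1) * (N : ℝ) ^ (l - i - 1)) * N := by
              refine h5.trans ?_
              rw [mul_assoc, ← pow_succ, ← e4]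
              gcongr
            exact le_of_mul_le_mul_right h7 hN'
          push_cast
          calc (l.choose i : ℝ) * w * E * (N : ℝ) ^ i ≤
              2 ^ (d + 1) * ((d + 1) * (N : ℝ) ^ (l - i - 1)) * E * (N : ℝ) ^ i := by gcongr
            _ = _ := by ring
        · rw [nsmul_eq_mul]
          gcongr
          rw [Nat.card_Icc]
          have : d + 1 + 1 - (i + 2) ≤ d + 1 := by omega
          exact_mod_cast this
      refine (add_le_add h1 h2).trans ?_
      rw [mul_div_assoc', ← add_div]
      gcongr
      have : 0 ≤ ((i + 1 : ℕ) : ℝ) * E := by positivity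
      linarith

end SFP

namespace SFP
open Finset Polynomial

lemma combine (d : ℕ) : ∃ P : ℕ, 1 ≤ P ∧ ∃ E : ℝ, 1 ≤ E ∧ ∀ (α : ℕ → ℝ) (D L N Z : ℕ) (H A : ℝ),
    d ≤ D → 1 ≤ D → 1 ≤ L → 1 ≤ N → 1 ≤ H → H ≤ L → H ^ 4 < 4 * (L : ℝ) ^ 3 →
    (((32 * D * L) ^ d * N ^ T d : ℕ) : ℝ) * VJ d D N ≤ A * ((N : ℝ) / (8 * L)) ^ (2 * D) →
    4 * L * A < Z → 1 ≤ Z → Z ≤ N → 2 * P * (L : ℝ) ^ 4 * Z ≤ N →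
    ∃ n : ℕ, 1 ≤ n ∧ n ≤ 2 * N ∧
      nearestIntDist (∑ j ∈ Finset.Icc 1 (d + 1), α j * (n : ℝ) ^ j) ≤ (1 + (d + 1) * E) / H := by
  obtain ⟨P, hP, E, hE, hdesc⟩ := descend d d
  refine ⟨P, hP, E, hE, ?_⟩
  intro α D L N Z H A hdD hD hL hN hH hHL hH4 hA hZA hZ1 hZN hbig
  have hH0 : 0 < H := by linarith
  have hE0 : 0 < E := by linarith
  have hL' : (0 : ℝ) < L := by exact_mod_cast hL
  have hN' : (0 : ℝ) < N := by exact_mod_cast hN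
  have hP' : (0 : ℝ) < P := by exact_mod_cast hP
  have hZ' : (0 : ℝ) < Z := by exact_mod_cast hZ1
  set f : ℕ → ℝ := fun n => ∑ j ∈ Finset.Icc 1 (d + 1), α j * (n : ℝ) ^ j with hf
  by_cases hall : ∃ n : ℕ, 1 ≤ n ∧ n ≤ 2 * N ∧ nearestIntDist (f n) ≤ 1 / H
  · obtain ⟨n, h1, h2, h3⟩ := hall
    refine ⟨n, h1, h2, h3.trans ?_⟩
    gcongr
    have : 0 ≤ ((d : ℝ) + 1) * E := by positivity
    linarith
  push Not at hall
  have hdet : ∀ y : ℕ, y ∈ Finset.Icc 1 N → ∃ h : ℕ, 1 ≤ h ∧ h < 2 * L ∧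
      (N : ℝ) / (4 * L) ≤ ‖∑ n ∈ Finset.range N, ee (h * f (n + y))‖ := by
    intro y hy
    rw [Finset.mem_Icc] at hy
    have := detect (Finset.range N) (fun n => f (n + y)) H L hL hH0 hH4
      (by rw [Finset.nonempty_range_iff]; omega) (by
        intro n hn
        rw [Finset.mem_range] at hn
        exact hall (n + y) (by omega) (by omega))
    rwa [Finset.card_range] at this
  choose! hh hh1 hh2 hh3 using hdet
  obtain ⟨h, hhm, hfib⟩ := Finset.exists_le_card_fiber_of_nsmul_le_card_of_maps_to
    (s := Finset.Icc 1 N) (t := Finset.Ico 1 (2 * L)) (f := hh) (b := (N : ℝ) / (2 * L))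
    (fun y hy => Finset.mem_Ico.2 ⟨hh1 y hy, hh2 y hy⟩)
    ⟨1, Finset.mem_Ico.2 ⟨le_rfl, by omega⟩⟩ (by
      rw [Nat.card_Ico, Nat.card_Icc, nsmul_eq_mul, mul_div_assoc', div_le_iff₀ (by positivity)]
      have e : ((2 * L - 1 : ℕ) : ℝ) ≤ 2 * L := by
        have : 2 * L - 1 ≤ 2 * L := by omega
        exact_mod_cast this
      rw [mul_comm]
      have : (N + 1 - 1 : ℕ) = N := by omega
      rw [this]
      gcongr)
  rw [Finset.mem_Ico] at hhm
  set Y := (Finset.Icc 1 N).filter (fun y => hh y = h) with hYdef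
  set γ : ℕ → ℝ := fun i => h * α i with hγ
  obtain ⟨y, z, hz1, hzZ, hyz, hnear⟩ := two_close d D L N hdD hD hL hN γ Y
    (Finset.filter_subset _ _) (by
      rw [div_le_iff₀ (by positivity)] at hfib
      have : (N : ℝ) ≤ 2 * L * Y.card := by linarith
      exact_mod_cast this) (by
      intro y hy
      obtain ⟨hy1, hy2⟩ := Finset.mem_filter.1 hy
      have := hh3 y hy1
      rw [hy2] at this
      refine this.trans (le_of_eq ?_)
      congr 1
      refine Finset.sum_congr rfl fun n _ => ?_
      congr 1
      rw [hf]; simp only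
      rw [Finset.mul_sum]
      refine Finset.sum_congr rfl fun i _ => ?_
      rw [hγ]; ring) A hA Z hZA hZ1 hZN
  have hdes := hdesc γ N y z hN hyz hnear
  obtain ⟨t, ht0, htH, ht⟩ := Real.exists_nat_abs_mul_sub_round_le (P * (γ 1 * z))
    (n := ⌊H⌋₊) (Nat.floor_pos.2 hH)
  have htH' : (t : ℝ) ≤ H := le_trans (by exact_mod_cast htH) (Nat.floor_le hH0.le)
  have ht1 : nearestIntDist (t * (P * (γ 1 * z))) ≤ 1 / H := by
    refine le_trans ht ?_
    apply one_div_le_one_div_of_le hH0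
    exact (Nat.lt_floor_add_one H).le
  set n := P * h * z * t with hn
  have hnb : (n : ℝ) ≤ P * (2 * L) * Z * H := by
    rw [hn]; push_cast
    have e1 : (h : ℝ) ≤ 2 * L := by exact_mod_cast hhm.2.le
    have e2 : (z : ℝ) ≤ Z := by exact_mod_cast hzZ.le
    gcongr
  have hL1 : (1 : ℝ) ≤ L := by exact_mod_cast hL
  have hH3 : P * (2 * L) * Z * H * H ^ 2 ≤ N := by
    refine le_trans ?_ hbig
    have : H ^ 3 ≤ (L : ℝ) ^ 3 := pow_le_pow_left₀ hH0.le hHL 3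
    calc P * (2 * L) * Z * H * H ^ 2 = P * (2 * L) * Z * H ^ 3 := by ring
      _ ≤ P * (2 * L) * Z * (L : ℝ) ^ 3 := by gcongr
      _ = _ := by ring
  have hH2 : 1 ≤ H ^ 2 := one_le_pow₀ hH
  have hnN : (n : ℝ) ≤ N := by
    refine hnb.trans (le_trans ?_ hH3)
    exact le_mul_of_one_le_right (by positivity) hH2
  have htn : (t : ℝ) * (n / N) ≤ 1 / H := by
    rw [mul_div_assoc', div_le_div_iff₀ hN' hH0, one_mul]
    calc (t : ℝ) * n * H ≤ H * (P * (2 * L) * Z * H) * H := by gcongr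
      _ = P * (2 * L) * Z * H * H ^ 2 := by ring
      _ ≤ N := hH3
  have hnpos : 1 ≤ n := by
    rw [hn]
    have : 0 < P * h * z * t := by
      have := hhm.1
      positivity
    exact this
  refine ⟨n, hnpos, ?_, ?_⟩
  · have : n ≤ N := by exact_mod_cast hnN
    omega
  have hfn : ∑ j ∈ Finset.Icc 1 (d + 1), α j * (n : ℝ) ^ j = t * (P * (γ 1 * z)) +
      ∑ j ∈ Finset.Icc 1 d, ((t * n ^ j : ℕ) : ℝ) * (P * (γ (j + 1) * z)) := by
    have e1 : Finset.Icc 1 (d + 1) = (Finset.range (d + 1)).image (fun j => j + 1) := by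
      ext x
      simp only [Finset.mem_Icc, Finset.mem_image, Finset.mem_range]
      constructor
      · intro hx; exact ⟨x - 1, by omega, by omega⟩
      · rintro ⟨a, ha, rfl⟩; omega
    have e2 : Finset.Icc 1 d = (Finset.range d).image (fun j => j + 1) := by
      ext x
      simp only [Finset.mem_Icc, Finset.mem_image, Finset.mem_range]
      constructor
      · intro hx; exact ⟨x - 1, by omega, by omega⟩
      · rintro ⟨a, ha, rfl⟩; omega
    rw [e1, e2, Finset.sum_image (by intro a _ b _ hab; simpa using hab),
      Finset.sum_image (by intro a _ b _ hab; simpa using hab), Finset.sum_range_succ', add_comm]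
    have hnr : (n : ℝ) = P * h * z * t := by rw [hn]; push_cast; ring
    congr 1
    · rw [hγ, hnr]; simp; ring
    · refine Finset.sum_congr rfl fun j _ => ?_
      push_cast
      rw [pow_succ (n : ℝ) (j + 1)]
      conv_lhs => rw [hnr]
      rw [hγ, hnr]; ring
  rw [hfn]
  refine (nd_add _ _).trans ?_
  have hsum : nearestIntDist (∑ j ∈ Finset.Icc 1 d, ((t * n ^ j : ℕ) : ℝ) * (P * (γ (j + 1) * z))) ≤
      (d + 1) * (E / H) := by
    refine (nd_sum _ _).trans ?_
    refine (Finset.sum_le_card_nsmul _ _ (E / H) ?_).trans ?_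
    · intro j hj
      rw [Finset.mem_Icc] at hj
      refine (nd_mul _ _).trans ?_
      refine (mul_le_mul_of_nonneg_left (hdes j hj.1 hj.2 (by omega)) (by positivity)).trans ?_
      push_cast
      have e1 : (t : ℝ) * (n : ℝ) ^ j * (E / (N : ℝ) ^ j) = E * (t * (n / N : ℝ) ^ j) := by
        rw [div_pow]; ring
      rw [e1]
      have e2 : (n / N : ℝ) ^ j ≤ n / N := by
        apply pow_le_of_le_one (by positivity) _ (by omega)
        rw [div_le_one hN']; exact hnN
      calc E * (t * (n / N : ℝ) ^ j) ≤ E * (t * (n / N : ℝ)) := by gcongr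
        _ ≤ E * (1 / H) := by gcongr
        _ = E / H := by ring
    · rw [nsmul_eq_mul, Nat.card_Icc]
      gcongr
      have : d + 1 - 1 ≤ d + 1 := by omega
      exact_mod_cast this
  calc _ ≤ 1 / H + (d + 1) * (E / H) := add_le_add ht1 hsum
    _ = _ := by ring

end SFP

namespace SFP
open Finset Polynomial

set_option maxHeartbeats 1000000 in
lemma final (d : ℕ) (hd : 7 ≤ d) : ∃ C : ℝ, 0 < C ∧ ∃ N₀ : ℕ, ∀ (α : ℕ → ℝ) (N : ℕ), N₀ ≤ N →
      ∃ n : ℕ, 1 ≤ n ∧ n ≤ N ∧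
        nearestIntDist (∑ j ∈ Finset.Icc 1 (d + 1), α j * (n : ℝ) ^ j) ≤
          C * (N : ℝ) ^ (-(1 / (4 * (T d : ℝ)))) := by
  obtain ⟨P, hP, E, hE, hcomb⟩ := combine d
  obtain ⟨D, hDdef⟩ : ∃ D, D = T d := ⟨_, rfl⟩
  have h2D := two_T d
  rw [← hDdef] at h2D ⊢
  have hdD : d ≤ D := by nlinarith
  have hD1 : 1 ≤ D := by omega
  have hD : (0 : ℝ) < D := by exact_mod_cast hD1
  obtain ⟨C, hC, hVJ⟩ := VJ_bound d (by omega) (1 / (6 * (D : ℝ))) (by positivity)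
  rw [← hDdef] at hVJ
  have hP' : (1 : ℝ) ≤ P := by exact_mod_cast hP
  set C2 : ℝ := 10 * P * ((32 * D) ^ d * C * 8 ^ (2 * D)) with hC2
  have hC20 : 0 < C2 := by positivity
  refine ⟨6 * (1 + (d + 1) * E), by positivity, 3 * (⌈C2 ^ (6 * D)⌉₊ + 1), ?_⟩
  intro α N hN
  set N1 := N / 2 with hN1
  have hN1a : ⌈C2 ^ (6 * D)⌉₊ + 1 ≤ N1 := by omega
  have hN1one : 1 ≤ N1 := by omega
  have hN13 : N ≤ 3 * N1 := by omega
  have hN1N : 2 * N1 ≤ N := by omega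
  have hN1pos : (0 : ℝ) < N1 := by exact_mod_cast hN1one
  have hN1r : (1 : ℝ) ≤ N1 := by exact_mod_cast hN1one
  set X : ℝ := (N1 : ℝ) ^ (1 / (6 * (D : ℝ))) with hX
  have hX1 : 1 ≤ X := Real.one_le_rpow hN1r (by positivity)
  have hX0 : 0 < X := by linarith
  have hXpow : X ^ (6 * D) = N1 := by
    rw [hX, ← Real.rpow_natCast, ← Real.rpow_mul hN1pos.le]
    push_cast
    rw [one_div_mul_cancel (by positivity), Real.rpow_one]
  have hXC : C2 ≤ X := by
    by_contra hlt
    push Not at hlt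
    have h1 : X ^ (6 * D) ≤ C2 ^ (6 * D) := pow_le_pow_left₀ hX0.le hlt.le _
    have h2 := Nat.le_ceil (C2 ^ (6 * D))
    have h3 : ((⌈C2 ^ (6 * D)⌉₊ : ℕ) : ℝ) + 1 ≤ N1 := by exact_mod_cast hN1a
    rw [hXpow] at h1
    linarith
  set L := ⌊X ^ 2⌋₊ with hL
  have hX2 : 1 ≤ X ^ 2 := one_le_pow₀ hX1
  have hL1 : 1 ≤ L := Nat.le_floor (by exact_mod_cast hX2)
  have hL1r : (1 : ℝ) ≤ L := by exact_mod_cast hL1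
  have hL0 : (0 : ℝ) < L := by linarith
  have hLX : (L : ℝ) ≤ X ^ 2 := Nat.floor_le (by positivity)
  have hXL : X ^ 2 ≤ 2 * L := by
    have := (Nat.lt_floor_add_one (X ^ 2)).le
    rw [← hL] at this
    linarith
  set H : ℝ := (L : ℝ) ^ (3 / 4 : ℝ) with hH
  have hH1 : 1 ≤ H := Real.one_le_rpow hL1r (by norm_num)
  have hH0 : 0 < H := by linarith
  have hHL : H ≤ L := by
    calc H ≤ (L : ℝ) ^ (1 : ℝ) := Real.rpow_le_rpow_of_exponent_le hL1r (by norm_num)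
      _ = L := Real.rpow_one _
  have hH4 : H ^ 4 = (L : ℝ) ^ 3 := by
    rw [hH, ← Real.rpow_natCast, ← Real.rpow_mul hL0.le, ← Real.rpow_natCast]
    norm_num
  have hH4' : H ^ 4 < 4 * (L : ℝ) ^ 3 := by
    rw [hH4]; have : 0 < (L : ℝ) ^ 3 := by positivity
    linarith
  set A : ℝ := (32 * D * L) ^ d * C * (8 * L) ^ (2 * D) * X with hA
  have hA1 : 1 ≤ A := by
    have hDr : (1 : ℝ) ≤ D := by exact_mod_cast hD1
    have e1 : (1 : ℝ) ≤ 32 * D * L := by nlinarith [mul_le_mul hDr hL1r (by norm_num) hD.le]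
    have e2 : (1 : ℝ) ≤ 8 * L := by linarith
    rw [hA]
    exact one_le_mul_of_one_le_of_one_le (one_le_mul_of_one_le_of_one_le
      (one_le_mul_of_one_le_of_one_le (one_le_pow₀ e1) hC) (one_le_pow₀ e2)) hX1
  have hA0 : 0 < A := by linarith
  set Z := ⌊4 * L * A⌋₊ + 1 with hZ
  have hZup : (Z : ℝ) ≤ 5 * L * A := by
    rw [hZ]; push_cast
    have e1 := Nat.floor_le (by positivity : (0 : ℝ) ≤ 4 * L * A)
    have e2 : 1 ≤ (L : ℝ) * A := one_le_mul_of_one_le_of_one_le hL1r hA1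
    nlinarith
  have hbig : 2 * P * (L : ℝ) ^ 4 * Z ≤ N1 := by
    calc 2 * P * (L : ℝ) ^ 4 * Z ≤ 2 * P * (L : ℝ) ^ 4 * (5 * L * A) := by gcongr
      _ = C2 * ((L : ℝ) ^ (2 * D + d + 5) * X) := by
        rw [hA, hC2, mul_pow, mul_pow _ (L : ℝ), pow_add, pow_add]; ring
      _ ≤ X * ((X ^ 2) ^ (2 * D + d + 5) * X) := by gcongr
      _ = X ^ (2 * (2 * D + d + 5) + 2) := by rw [← pow_mul]; ring
      _ ≤ X ^ (6 * D) := by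
        apply pow_le_pow_right₀ hX1
        nlinarith
      _ = N1 := hXpow
  have hZN : Z ≤ N1 := by
    have e : (Z : ℝ) ≤ 2 * P * (L : ℝ) ^ 4 * Z := by
      apply le_mul_of_one_le_left (by positivity)
      have : 1 ≤ (L : ℝ) ^ 4 := one_le_pow₀ hL1r
      nlinarith
    exact_mod_cast e.trans hbig
  have hAcond : (((32 * D * L) ^ d * N1 ^ T d : ℕ) : ℝ) * VJ d D N1 ≤
      A * ((N1 : ℝ) / (8 * L)) ^ (2 * D) := by
    rw [← hDdef]
    have h1 := hVJ N1 hN1one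
    rw [Real.rpow_add hN1pos, Real.rpow_natCast, ← hX] at h1
    calc _ ≤ (((32 * D * L) ^ d * N1 ^ D : ℕ) : ℝ) * (C * ((N1 : ℝ) ^ D * X)) := by gcongr
      _ = _ := by
        rw [hA, div_pow]
        push_cast
        rw [two_mul D, pow_add (N1 : ℝ)]
        field_simp
  obtain ⟨n, hn1, hn2, hn3⟩ := hcomb α D L N1 Z H A hdD hD1 hL1 hN1one hH1 hHL hH4' hAcond
    (by rw [hZ]; push_cast; exact Nat.lt_floor_add_one _) (by omega) hZN hbig
  refine ⟨n, hn1, by omega, hn3.trans ?_⟩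
  have hNpos : (0 : ℝ) < N := by
    have : 0 < N := by omega
    exact_mod_cast this
  have hHlow : (N : ℝ) ^ (1 / (4 * (D : ℝ))) ≤ 6 * H := by
    have hDr : (1 : ℝ) ≤ D := by exact_mod_cast hD1
    have hq : 1 / (4 * (D : ℝ)) ≤ 1 := by
      rw [div_le_one (by positivity)]; linarith
    have hN3 : (N : ℝ) ≤ 3 * N1 := by exact_mod_cast hN13
    have e1 : (N1 : ℝ) ^ (1 / (4 * (D : ℝ))) = (X ^ 2) ^ (3 / 4 : ℝ) := by
      rw [hX, ← Real.rpow_natCast, ← Real.rpow_mul hN1pos.le, ← Real.rpow_mul hN1pos.le]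
      congr 1
      push_cast
      field_simp
      norm_num
    calc (N : ℝ) ^ (1 / (4 * (D : ℝ))) ≤ (3 * N1 : ℝ) ^ (1 / (4 * (D : ℝ))) :=
          Real.rpow_le_rpow hNpos.le hN3 (by positivity)
      _ = 3 ^ (1 / (4 * (D : ℝ))) * (N1 : ℝ) ^ (1 / (4 * (D : ℝ))) :=
          Real.mul_rpow (by norm_num) hN1pos.le
      _ ≤ 3 * (2 * H) := by
        apply mul_le_mul _ _ (by positivity) (by norm_num)
        · calc (3 : ℝ) ^ (1 / (4 * (D : ℝ))) ≤ 3 ^ (1 : ℝ) :=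
              Real.rpow_le_rpow_of_exponent_le (by norm_num) hq
            _ = 3 := Real.rpow_one _
        · rw [e1]
          calc (X ^ 2) ^ (3 / 4 : ℝ) ≤ (2 * L : ℝ) ^ (3 / 4 : ℝ) :=
              Real.rpow_le_rpow (by positivity) hXL (by norm_num)
            _ = 2 ^ (3 / 4 : ℝ) * H := Real.mul_rpow (by norm_num) hL0.le
            _ ≤ 2 * H := by
              gcongr
              calc (2 : ℝ) ^ (3 / 4 : ℝ) ≤ 2 ^ (1 : ℝ) :=
                  Real.rpow_le_rpow_of_exponent_le (by norm_num) (by norm_num)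
                _ = 2 := Real.rpow_one _
      _ = 6 * H := by ring
  rw [Real.rpow_neg hNpos.le]
  have hNp : 0 < (N : ℝ) ^ (1 / (4 * (D : ℝ))) := Real.rpow_pos_of_pos hNpos _
  rw [← div_eq_mul_inv, div_le_div_iff₀ hH0 hNp]
  have : 0 < 1 + ((d : ℝ) + 1) * E := by positivity
  nlinarith

end SFP

/-- **Theorem 1 (Baker).** Let `k ≥ 8` and `ε > 0`. There is a constant `C > 0`
(depending only on `k` and `ε`) such that for all sufficiently large `N`
(in terms of `k` and `ε`) and all real `α₁, …, α_k`, there is an integer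
`1 ≤ n ≤ N` with `‖α_k n^k + ⋯ + α₁ n‖ ≤ C · N^(−1/(2k(k−1)) + ε)`. -/
theorem small_fractional_parts_polynomial (k : ℕ) (hk : 8 ≤ k) (ε : ℝ) (hε : 0 < ε) :
    ∃ C : ℝ, 0 < C ∧ ∃ N₀ : ℕ, ∀ (α : ℕ → ℝ) (N : ℕ), N₀ ≤ N →
      ∃ n : ℕ, 1 ≤ n ∧ n ≤ N ∧
        nearestIntDist (∑ j ∈ Finset.Icc 1 k, α j * (n : ℝ) ^ j) ≤
          C * (N : ℝ) ^ (-(1 / (2 * (k : ℝ) * ((k : ℝ) - 1))) + ε) := by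
  obtain ⟨d, rfl⟩ : ∃ d, k = d + 1 := ⟨k - 1, by omega⟩
  obtain ⟨C, hC, N₀, h⟩ := SFP.final d (by omega)
  refine ⟨C, hC, N₀ + 1, ?_⟩
  intro α N hN
  obtain ⟨n, h1, h2, h3⟩ := h α N (by omega)
  refine ⟨n, h1, h2, h3.trans ?_⟩
  apply mul_le_mul_of_nonneg_left _ hC.le
  apply Real.rpow_le_rpow_of_exponent_le
  · have : 1 ≤ N := by omega
    exact_mod_cast this
  have e : 4 * (SFP.T d : ℝ) = 2 * ((d + 1 : ℕ) : ℝ) * (((d + 1 : ℕ) : ℝ) - 1) := by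
    have := SFP.two_T d
    have h2 : 2 * (SFP.T d : ℝ) = d * (d + 1) := by exact_mod_cast this
    push_cast
    linarith
  rw [e]
  linarith
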